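/- With high probability over G drawn from G(n,1/2), the pseudoexpectation is positive semidefinite: for every multilinear polynomial p of degree at most d in x_1, \ldots, x_n, \tilde{E}_G[p(x)^2] \geq 0. Equivalently, the moment matrix \mathcal{M}, indexed by subsets I, J \subseteq [n] of size at most d with entries \mathcal{M}(I,J) = \tilde{E}_G[x_I x_J], is positive semidefinite with high probability. -/

import Mathlib

open Finset

attribute [local instance] Classical.propDecidable

namespace PlantedClique

/-- The set of potential edges of a graph on vertex set `Fin n`:
unordered pairs of distinct vertices. -/
abbrev Edge (n : ℕ) := {e : Sym2 (Fin n) // ¬ e.IsDiag}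

/-- A graph on vertex set `Fin n`, identified with its Boolean edge indicators. -/
abbrev Graph (n : ℕ) := Edge n → Bool

/-- The `±1` edge indicator `G_e`: `+1` if `e` is an edge of `G` and `-1` otherwise. -/
noncomputable def edgeSign {n : ℕ} (G : Graph n) (e : Edge n) : ℝ := if G e then 1 else -1

/-- The Fourier character `χ_T(G) = ∏_{e ∈ T} G_e`. -/
noncomputable def chi {n : ℕ} (G : Graph n) (T : Finset (Edge n)) : ℝ := ∏ e ∈ T, edgeSign G e

/-- `𝓥(T)`: the set of vertices incident to at least one edge of `T`. -/
noncomputable def vertsOf {n : ℕ} (T : Finset (Edge n)) : Finset (Fin n) :=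
  Finset.univ.filter fun v => ∃ e ∈ T, v ∈ (e : Sym2 (Fin n))

/-- The probability, over a uniformly random graph `G ∼ G(n,1/2)`, of the event `P`. -/
noncomputable def probGraph (n : ℕ) (P : Graph n → Prop) : ℝ :=
  (Finset.univ.filter P).card / (Fintype.card (Graph n))

/-- The pseudo-calibrated pseudoexpectation on monomials:
`Ẽ_G[x_S] = ∑_{T : |𝓥(T) ∪ S| ≤ τ} (ω/n)^{|𝓥(T) ∪ S|} χ_T(G)`. -/
noncomputable def tE {n : ℕ} (τ : ℕ) (ω : ℝ) (G : Graph n) (S : Finset (Fin n)) : ℝ :=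
  ∑ T : Finset (Edge n),
    if (vertsOf T ∪ S).card ≤ τ then (ω / n) ^ (vertsOf T ∪ S).card * chi G T else 0


/-- `X` contains `I \ S`, avoids `S`, and is closed under `T`-adjacency outside `S`. -/
def Closed {n : ℕ} (T : Finset (Edge n)) (I S X : Finset (Fin n)) : Prop :=
  (∀ v ∈ I, v ∉ S → v ∈ X) ∧ (∀ v ∈ X, v ∉ S) ∧
    ∀ e ∈ T, ∀ u ∈ (e : Sym2 (Fin n)), ∀ v ∈ (e : Sym2 (Fin n)), u ∈ X → v ∉ S → v ∈ X

/-- `S` separates `I` from `B` in `T`. -/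
def Sep {n : ℕ} (T : Finset (Edge n)) (I B S : Finset (Fin n)) : Prop :=
  ∃ X, Closed T I S X ∧ ∀ v ∈ X, v ∉ B

/-- Vertices reachable from `I` avoiding `S`. -/
noncomputable def reach {n : ℕ} (T : Finset (Edge n)) (I S : Finset (Fin n)) : Finset (Fin n) :=
  Finset.univ.filter fun v => ∀ X, Closed T I S X → v ∈ X

theorem mem_vertsOf {n : ℕ} {T : Finset (Edge n)} {v : Fin n} :
    v ∈ vertsOf T ↔ ∃ e ∈ T, v ∈ (e : Sym2 (Fin n)) := by
  simp [vertsOf]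

theorem mem_reach {n : ℕ} {T : Finset (Edge n)} {I S : Finset (Fin n)} {v : Fin n} :
    v ∈ reach T I S ↔ ∀ X, Closed T I S X → v ∈ X := by
  simp [reach]

theorem closed_top {n : ℕ} (T : Finset (Edge n)) (I S : Finset (Fin n)) :
    Closed T I S (univ \ S) := by
  refine ⟨?_, ?_, ?_⟩ <;> intros <;> simp_all

theorem closed_reach {n : ℕ} (T : Finset (Edge n)) (I S : Finset (Fin n)) :
    Closed T I S (reach T I S) := by
  refine ⟨?_, ?_, ?_⟩
  · intro v hv hS
    rw [mem_reach]
    intro X hX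
    exact hX.1 v hv hS
  · intro v hv
    have := mem_reach.1 hv _ (closed_top T I S)
    simpa using this
  · intro e he u hu v hv hur hvS
    rw [mem_reach] at hur ⊢
    intro X hX
    exact hX.2.2 e he u hu v hv (hur X hX) hvS

theorem reach_subset {n : ℕ} {T : Finset (Edge n)} {I S X : Finset (Fin n)}
    (h : Closed T I S X) : reach T I S ⊆ X := fun _ hv => mem_reach.1 hv X h

theorem sep_iff {n : ℕ} {T : Finset (Edge n)} {I B S : Finset (Fin n)} :
    Sep T I B S ↔ ∀ v ∈ reach T I S, v ∉ B := by
  constructor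
  · rintro ⟨X, hX, hB⟩ v hv
    exact hB v (reach_subset hX hv)
  · intro h
    exact ⟨_, closed_reach T I S, h⟩

theorem Closed.mono {n : ℕ} {T T' : Finset (Edge n)} {I S X : Finset (Fin n)}
    (h : Closed T I S X) (hT : T' ⊆ T) : Closed T' I S X :=
  ⟨h.1, h.2.1, fun e he => h.2.2 e (hT he)⟩

theorem Sep.mono {n : ℕ} {T T' : Finset (Edge n)} {I B S : Finset (Fin n)}
    (h : Sep T I B S) (hT : T' ⊆ T) : Sep T' I B S := by
  obtain ⟨X, hX, hB⟩ := h
  exact ⟨X, hX.mono hT, hB⟩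

theorem Sep.mono_sets {n : ℕ} {T : Finset (Edge n)} {I I' B B' S : Finset (Fin n)}
    (h : Sep T I B S) (hI : I' ⊆ I) (hB' : B' ⊆ B) : Sep T I' B' S := by
  obtain ⟨X, hX, hB⟩ := h
  exact ⟨X, ⟨fun v hv => hX.1 v (hI hv), hX.2⟩, fun v hv hv' => hB v hv (hB' hv')⟩

theorem Sep.symm {n : ℕ} {T : Finset (Edge n)} {I B S : Finset (Fin n)}
    (h : Sep T I B S) : Sep T B I S := by
  obtain ⟨X, ⟨h1, h2, h3⟩, hB⟩ := h
  refine ⟨univ \ (X ∪ S), ⟨?_, ?_, ?_⟩, ?_⟩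
  · intro v hv hS
    simp only [mem_sdiff, mem_univ, mem_union, true_and, not_or]
    exact ⟨fun hX => hB v hX hv, hS⟩
  · intro v hv
    simp_all
  · intro e he u hu v hv huX hvS
    simp only [mem_sdiff, mem_univ, mem_union, true_and, not_or] at huX ⊢
    exact ⟨fun hvX => huX.1 (h3 e he v hv u hu hvX huX.2), hvS⟩
  · intro v hv hvI
    simp only [mem_sdiff, mem_univ, mem_union, true_and, not_or] at hv
    exact hv.1 (h1 v hvI hv.2)

theorem sep_left {n : ℕ} (T : Finset (Edge n)) (I B : Finset (Fin n)) : Sep T I B I := by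
  refine ⟨∅, ⟨?_, ?_, ?_⟩, ?_⟩ <;> simp

theorem sep_right {n : ℕ} (T : Finset (Edge n)) (I B : Finset (Fin n)) : Sep T I B B :=
  (sep_left T B I).symm

/-- Class of left ribbons. -/
def LCl {n : ℕ} (T : Finset (Edge n)) (I A : Finset (Fin n)) : Prop :=
  (∀ S, Sep T I A S → S.card ≤ A.card → S = A) ∧
    ∀ e ∈ T, ∃ u ∈ (e : Sym2 (Fin n)), u ∈ reach T I A

/-- `A` is a minimum separator between `A` and `B`. -/
def NCl {n : ℕ} (T : Finset (Edge n)) (A B : Finset (Fin n)) : Prop :=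
  ∀ S, Sep T A B S → A.card ≤ S.card

theorem NCl.card_le {n : ℕ} {T : Finset (Edge n)} {A B : Finset (Fin n)} (h : NCl T A B) :
    A.card ≤ B.card := h B (sep_right T A B)

theorem LCl.card_le_of_sep {n : ℕ} {T : Finset (Edge n)} {I A S : Finset (Fin n)}
    (h : LCl T I A) (hS : Sep T I A S) : A.card ≤ S.card := by
  by_contra hlt
  push Not at hlt
  have := h.1 S hS hlt.le
  subst this
  exact lt_irrefl _ hlt

theorem LCl.card_le {n : ℕ} {T : Finset (Edge n)} {I A : Finset (Fin n)} (h : LCl T I A) :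
    A.card ≤ I.card := h.card_le_of_sep (sep_left T I A)

theorem LCl.eq_of_card {n : ℕ} {T : Finset (Edge n)} {I A : Finset (Fin n)} (h : LCl T I A)
    (hc : I.card ≤ A.card) : I = A := h.1 I (sep_left T I A) hc

/-- uncrossing -/
theorem uncross {n : ℕ} {T : Finset (Edge n)} {I B A S X1 X : Finset (Fin n)}
    (h1 : Closed T I A X1) (h1B : ∀ v ∈ X1, v ∉ B)
    (h2 : Closed T I S X) (h2B : ∀ v ∈ X, v ∉ B) :
    Sep T I A ((S ∩ X1) ∪ (A ∩ (S ∪ X))) ∧ Sep T A B ((S \ X1) ∪ (A \ (S ∪ X))) ∧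
    ((S ∩ X1) ∪ (A ∩ (S ∪ X))).card + ((S \ X1) ∪ (A \ (S ∪ X))).card ≤ S.card + A.card := by
  obtain ⟨a1, a2, a3⟩ := h1
  obtain ⟨b1, b2, b3⟩ := h2
  refine ⟨⟨X ∩ X1, ⟨?_, ?_, ?_⟩, ?_⟩, ⟨X ∪ X1, ⟨?_, ?_, ?_⟩, ?_⟩, ?_⟩
  · intro v hv hS
    have := a1 v hv
    have := b1 v hv
    simp only [mem_union, mem_inter] at *
    tauto
  · intro v hv hS
    have := a2 v
    have := b2 v
    simp only [mem_union, mem_inter] at *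
    tauto
  · intro e he u hu v hv huX hvS
    have := a3 e he u hu v hv
    have := b3 e he u hu v hv
    simp only [mem_union, mem_inter] at *
    tauto
  · intro v hv hA
    have := a2 v
    simp only [mem_union, mem_inter] at *
    tauto
  · intro v hv hS
    have := a2 v
    simp only [mem_union, mem_sdiff] at *
    tauto
  · intro v hv hS
    have := a2 v
    have := b2 v
    simp only [mem_union, mem_sdiff] at *
    tauto
  · intro e he u hu v hv huX hvS
    have := a3 e he u hu v hv
    have := b3 e he u hu v hv
    simp only [mem_union, mem_sdiff] at *
    tauto
  · intro v hv hA
    have := h1B v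
    have := h2B v
    simp only [mem_union] at *
    tauto
  · have e1 := card_union_le (S ∩ X1) (A ∩ (S ∪ X))
    have e2 := card_union_le (S \ X1) (A \ (S ∪ X))
    have e3 := card_inter_add_card_sdiff S X1
    have e4 := card_inter_add_card_sdiff A (S ∪ X)
    omega

/-- decomposition of a ribbon at its leftmost minimum separator -/
structure Decomp {n : ℕ} (T : Finset (Edge n)) (I B A : Finset (Fin n))
    (T1 T2 : Finset (Edge n)) : Prop where
  union : T1 ∪ T2 = T
  left : LCl T1 I A
  right : NCl T2 A B
  disj : Disjoint ((vertsOf T1 ∪ I) \ A) (vertsOf T2 ∪ A ∪ B)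

theorem LCl.reach_eq {n : ℕ} {T : Finset (Edge n)} {I A : Finset (Fin n)} (h : LCl T I A) :
    (vertsOf T ∪ I) \ A = reach T I A := by
  have hr := closed_reach T I A
  ext v
  constructor
  · intro hv
    simp only [mem_sdiff, mem_union] at hv
    obtain ⟨hv | hv, hA⟩ := hv
    · obtain ⟨e, he, hve⟩ := mem_vertsOf.1 hv
      obtain ⟨u, hu, hur⟩ := h.2 e he
      exact hr.2.2 e he u hu v hve hur hA
    · exact hr.1 v hv hA
  · intro hv
    refine reach_subset (X := (vertsOf T ∪ I) \ A) ⟨?_, ?_, ?_⟩ hv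
    · intro v hv hS
      simp [hv, hS]
    · intro v hv
      simp only [mem_sdiff] at hv
      exact hv.2
    · intro e he u hu v hv hu2 hvS
      simp only [mem_sdiff, mem_union]
      exact ⟨Or.inl (mem_vertsOf.2 ⟨e, he, hv⟩), hvS⟩

theorem LCl.sub {n : ℕ} {T : Finset (Edge n)} {I A : Finset (Fin n)} (h : LCl T I A) :
    ∀ a ∈ A, a ∈ I ∨ ∃ e ∈ T, a ∈ (e : Sym2 (Fin n)) ∧ ∃ u ∈ (e : Sym2 (Fin n)), u ∈ reach T I A := by
  have hr := closed_reach T I A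
  set S := A.filter fun a => a ∈ I ∨ ∃ e ∈ T, a ∈ (e : Sym2 (Fin n)) ∧ ∃ u ∈ (e : Sym2 (Fin n)), u ∈ reach T I A with hS
  have hsep : Sep T I A S := by
    refine ⟨reach T I A, ⟨?_, ?_, ?_⟩, hr.2.1⟩
    · intro v hv hvS
      by_cases hA : v ∈ A
      · exact absurd (by rw [hS, mem_filter]; exact ⟨hA, Or.inl hv⟩) hvS
      · exact hr.1 v hv hA
    · intro v hv hvS
      rw [hS, mem_filter] at hvS
      exact hr.2.1 v hv hvS.1
    · intro e he u hu v hv hur hvS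
      by_cases hA : v ∈ A
      · exact absurd (by rw [hS, mem_filter]; exact ⟨hA, Or.inr ⟨e, he, hv, u, hu, hur⟩⟩) hvS
      · exact hr.2.2 e he u hu v hv hur hA
  have hEq := h.1 S hsep (card_filter_le _ _)
  intro a ha
  rw [← hEq, hS, mem_filter] at ha
  exact ha.2

theorem LCl.A_sub {n : ℕ} {T : Finset (Edge n)} {I A : Finset (Fin n)} (h : LCl T I A) :
    A ⊆ vertsOf T ∪ I := by
  intro a ha
  rcases h.sub a ha with h1 | ⟨e, he, hae, -⟩
  · simp [h1]
  · simp only [mem_union]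
    exact Or.inl (mem_vertsOf.2 ⟨e, he, hae⟩)

section
variable {n : ℕ} {T : Finset (Edge n)} {I B A : Finset (Fin n)} {T1 T2 : Finset (Edge n)}

theorem Decomp.subl (h : Decomp T I B A T1 T2) : T1 ⊆ T := h.union ▸ subset_union_left
theorem Decomp.subr (h : Decomp T I B A T1 T2) : T2 ⊆ T := h.union ▸ subset_union_right

theorem Decomp.notin (h : Decomp T I B A T1 T2) {v : Fin n} (hv : v ∈ reach T1 I A) :
    v ∉ A ∧ v ∉ B ∧ ∀ e ∈ T2, v ∉ (e : Sym2 (Fin n)) := by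
  have h1 := h.disj
  rw [h.left.reach_eq] at h1
  have h2 := Finset.disjoint_left.1 h1 hv
  simp only [mem_union, not_or, mem_vertsOf, not_exists, not_and] at h2
  exact ⟨h2.1.2, h2.2, h2.1.1⟩

/-- vertices of `T1` -/
theorem Decomp.v1 (h : Decomp T I B A T1 T2) {v : Fin n} {e : Edge n} (he : e ∈ T1)
    (hv : v ∈ (e : Sym2 (Fin n))) : v ∈ reach T1 I A ∨ v ∈ A := by
  by_cases hA : v ∈ A
  · exact Or.inr hA
  · left
    rw [← h.left.reach_eq]
    simp only [mem_sdiff, mem_union]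
    exact ⟨Or.inl (mem_vertsOf.2 ⟨e, he, hv⟩), hA⟩

theorem Decomp.vI (h : Decomp T I B A T1 T2) {v : Fin n} (hv : v ∈ I) : v ∈ reach T1 I A ∨ v ∈ A := by
  by_cases hA : v ∈ A
  · exact Or.inr hA
  · exact Or.inl ((closed_reach T1 I A).1 v hv hA)

/-- every edge of `T` touching the reach is in `T1` -/
theorem Decomp.mem1 (h : Decomp T I B A T1 T2) {v : Fin n} {e : Edge n} (he : e ∈ T)
    (hv : v ∈ (e : Sym2 (Fin n))) (hr : v ∈ reach T1 I A) : e ∈ T1 := by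
  rw [← h.union, mem_union] at he
  rcases he with he | he
  · exact he
  · exact absurd hv ((h.notin hr).2.2 e he)

theorem Decomp.closedT (h : Decomp T I B A T1 T2) : Closed T I A (reach T1 I A) := by
  have hr := closed_reach T1 I A
  refine ⟨hr.1, hr.2.1, ?_⟩
  intro e he u hu v hv hur hvA
  exact hr.2.2 e (h.mem1 he hu hur) u hu v hv hur hvA

theorem Decomp.T1_eq (h : Decomp T I B A T1 T2) :
    T1 = T.filter fun e : Edge n => ∃ u ∈ (e : Sym2 (Fin n)), u ∈ reach T1 I A := by
  ext e
  rw [mem_filter]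
  constructor
  · intro he
    exact ⟨h.subl he, h.left.2 e he⟩
  · rintro ⟨he, u, hu, hur⟩
    exact h.mem1 he hu hur

theorem Decomp.reachT (h : Decomp T I B A T1 T2) : reach T I A = reach T1 I A := by
  apply subset_antisymm
  · exact reach_subset h.closedT
  · exact reach_subset ((closed_reach T I A).mono h.subl)

theorem Decomp.disjT (h : Decomp T I B A T1 T2) : Disjoint T1 T2 := by
  rw [Finset.disjoint_left]
  intro e he he2
  obtain ⟨u, hu, hur⟩ := h.left.2 e he
  exact (h.notin hur).2.2 e he2 hu

theorem Decomp.T2_eq (h : Decomp T I B A T1 T2) : T2 = T \ T1 := by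
  rw [← h.union, union_sdiff_left, sdiff_eq_self_of_disjoint h.disjT.symm]

theorem good_aux {A' : Finset (Fin n)} {X X' : Finset (Fin n)}
    (h1 : Closed T I A X) (h1B : ∀ v ∈ X, v ∉ B)
    (h2 : Closed T I A' X') (h2B : ∀ v ∈ X', v ∉ B)
    (hA : ∀ S, Sep T I A S → S.card ≤ A.card → S = A)
    (hA2 : ∀ S, Sep T A B S → A.card ≤ S.card) :
    A.card ≤ A'.card ∧ (A'.card ≤ A.card → (∀ v ∈ A', v ∉ X) ∧ A ⊆ A' ∪ X') := by
  obtain ⟨s1, s2, hc⟩ := uncross h1 h1B h2 h2B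
  have c2 := hA2 _ s2
  have c1 : A.card ≤ ((A' ∩ X) ∪ (A ∩ (A' ∪ X'))).card := by
    by_contra hlt
    push Not at hlt
    have := hA _ s1 hlt.le
    rw [this] at hlt
    exact lt_irrefl _ hlt
  refine ⟨by omega, fun hle => ?_⟩
  have e1 := hA _ s1 (by omega)
  constructor
  · intro v hv hX
    have : v ∈ A := by
      rw [← e1]; simp [hv, hX]
    exact h1.2.1 v hX this
  · intro v hv
    have hv' := hv
    rw [← e1] at hv'
    have := h1.2.1 v
    simp only [mem_union, mem_inter] at hv' ⊢
    tauto

theorem Decomp.good (h : Decomp T I B A T1 T2) :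
    (∀ S, Sep T I A S → S.card ≤ A.card → S = A) ∧ (∀ S, Sep T A B S → A.card ≤ S.card) :=
  ⟨fun S hS => h.left.1 S (hS.mono h.subl), fun S hS => h.right S (hS.mono h.subr)⟩

theorem Decomp.unique {A' : Finset (Fin n)} {T1' T2' : Finset (Edge n)}
    (h : Decomp T I B A T1 T2) (h' : Decomp T I B A' T1' T2') :
    A = A' ∧ T1 = T1' ∧ T2 = T2' := by
  have k1 := good_aux h.closedT (fun v hv => (h.notin hv).2.1) h'.closedT
    (fun v hv => (h'.notin hv).2.1) h.good.1 h.good.2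
  have k2 := good_aux h'.closedT (fun v hv => (h'.notin hv).2.1) h.closedT
    (fun v hv => (h.notin hv).2.1) h'.good.1 h'.good.2
  obtain ⟨p1, p2⟩ := k1.2 k2.1
  obtain ⟨q1, q2⟩ := k2.2 k1.1
  have hAA : A = A' := by
    apply subset_antisymm
    · intro v hv
      have := p2 hv
      rw [mem_union] at this
      rcases this with h | h
      · exact h
      · exact absurd h (q1 v hv)
    · intro v hv
      have := q2 hv
      rw [mem_union] at this
      rcases this with h | h
      · exact h
      · exact absurd h (p1 v hv)
  subst hAA
  have hT : T1 = T1' := by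
    rw [h.T1_eq, h'.T1_eq, ← h.reachT, ← h'.reachT]
  subst hT
  exact ⟨rfl, rfl, by rw [h.T2_eq, h'.T2_eq]⟩

theorem sep_trans {S : Finset (Fin n)} (h1 : Sep T I B A) (h2 : Sep T A B S) : Sep T I B S := by
  obtain ⟨X, ⟨a1, a2, a3⟩, hB⟩ := h1
  obtain ⟨Y, ⟨b1, b2, b3⟩, hB'⟩ := h2
  refine ⟨(X ∪ Y) \ S, ⟨?_, ?_, ?_⟩, ?_⟩
  · intro v hv hS
    have := a1 v hv
    have := b1 v
    simp only [mem_union, mem_sdiff] at *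
    tauto
  · intro v hv
    simp only [mem_sdiff] at hv
    exact hv.2
  · intro e he u hu v hv huX hvS
    have := a3 e he u hu v hv
    have := b3 e he u hu v hv
    have := b1 v
    simp only [mem_union, mem_sdiff] at *
    tauto
  · intro v hv hA
    have := hB v
    have := hB' v
    simp only [mem_union, mem_sdiff] at *
    tauto

theorem exists_decomp (T : Finset (Edge n)) (I B : Finset (Fin n)) :
    ∃ A T1 T2, Decomp T I B A T1 T2 := by
  -- lexicographic minimum of `(card, reach card)`
  obtain ⟨A, hA, hmin⟩ : ∃ A, Sep T I B A ∧ ∀ S, Sep T I B S →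
      A.card ≤ S.card ∧ (S.card ≤ A.card → (reach T I A).card ≤ (reach T I S).card) := by
    obtain ⟨A0, h0, hm0⟩ := Finset.exists_min_image (univ.filter fun S => Sep T I B S)
      (fun S => S.card) ⟨B, by simp [sep_right]⟩
    simp only [mem_filter, mem_univ, true_and] at h0 hm0
    obtain ⟨A, h1, hm1⟩ := Finset.exists_min_image
      (univ.filter fun S => Sep T I B S ∧ S.card ≤ A0.card)
      (fun S => (reach T I S).card) ⟨A0, by simp [h0]⟩
    simp only [mem_filter, mem_univ, true_and] at h1 hm1
    refine ⟨A, h1.1, fun S hS => ⟨h1.2.trans (hm0 S hS), fun hc => hm1 S ⟨hS, hc.trans h1.2⟩⟩⟩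
  have hr := closed_reach T I A
  have hrB := sep_iff.1 hA
  set X := reach T I A with hX
  set T1 := T.filter fun e : Edge n => ∃ u ∈ (e : Sym2 (Fin n)), u ∈ X with hT1
  have hT1s : T1 ⊆ T := filter_subset _ _
  have mem1 : ∀ e ∈ T, ∀ u ∈ (e : Sym2 (Fin n)), u ∈ X → e ∈ T1 := by
    intro e he u hu hux
    rw [hT1, mem_filter]
    exact ⟨he, u, hu, hux⟩
  have hr1 : reach T1 I A = X := by
    apply subset_antisymm
    · exact reach_subset (hr.mono hT1s)
    · rw [hX]
      have hc := closed_reach T1 I A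
      have hsub : reach T1 I A ⊆ X := reach_subset (hr.mono hT1s)
      refine reach_subset ⟨hc.1, hc.2.1, ?_⟩
      intro e he u hu v hv hur hvA
      exact hc.2.2 e (mem1 e he u hu (hsub hur)) u hu v hv hur hvA
  -- sets between
  have hAsub : ∀ a ∈ A, a ∈ I ∨ ∃ e ∈ T, a ∈ (e : Sym2 (Fin n)) ∧ ∃ u ∈ (e : Sym2 (Fin n)), u ∈ X := by
    set S := A.filter fun a => a ∈ I ∨ ∃ e ∈ T, a ∈ (e : Sym2 (Fin n)) ∧ ∃ u ∈ (e : Sym2 (Fin n)), u ∈ X with hS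
    have hsep : Sep T I B S := by
      refine ⟨X, ⟨?_, ?_, ?_⟩, hrB⟩
      · intro v hv hvS
        by_cases hA : v ∈ A
        · exact absurd (by rw [hS, mem_filter]; exact ⟨hA, Or.inl hv⟩) hvS
        · exact hr.1 v hv hA
      · intro v hv hvS
        rw [hS, mem_filter] at hvS
        exact hr.2.1 v hv hvS.1
      · intro e he u hu v hv hur hvS
        by_cases hA : v ∈ A
        · exact absurd (by rw [hS, mem_filter]; exact ⟨hA, Or.inr ⟨e, he, hv, u, hu, hur⟩⟩) hvS
        · exact hr.2.2 e he u hu v hv hur hA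
    have hEq : S = A := Finset.eq_of_subset_of_card_le (filter_subset _ _) (hmin S hsep).1
    intro a ha
    rw [← hEq, hS, mem_filter] at ha
    exact ha.2
  have hii : ∀ S, Sep T I A S → S.card ≤ A.card → S = A := by
    intro S hS hc
    have hSB : Sep T I B S := by
      have := sep_trans (sep_trans hA (sep_left T A B)) (sep_left T A B)
      obtain ⟨Y, ⟨b1, b2, b3⟩, hYA⟩ := hS
      refine ⟨Y ∩ X, ⟨?_, ?_, ?_⟩, ?_⟩
      · intro v hv hvS
        have := b1 v hv hvS
        rw [mem_inter]
        exact ⟨this, hr.1 v hv (hYA v this)⟩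
      · intro v hv
        exact b2 v (mem_inter.1 hv).1
      · intro e he u hu v hv hux hvS
        rw [mem_inter] at hux ⊢
        have := b3 e he u hu v hv hux.1 hvS
        exact ⟨this, hr.2.2 e he u hu v hv hux.2 (hYA v this)⟩
      · intro v hv
        exact hrB v (mem_inter.1 hv).2
    have hSA := sep_iff.1 hS
    have hsub : reach T I S ⊆ X := by
      have hc := closed_reach T I S
      have : Closed T I S (reach T I S ∩ X) := by
        refine ⟨?_, ?_, ?_⟩
        · intro v hv hvS
          have := hc.1 v hv hvS
          rw [mem_inter]
          exact ⟨this, hr.1 v hv (hSA v this)⟩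
        · intro v hv
          exact hc.2.1 v (mem_inter.1 hv).1
        · intro e he u hu v hv hux hvS
          rw [mem_inter] at hux ⊢
          have := hc.2.2 e he u hu v hv hux.1 hvS
          exact ⟨this, hr.2.2 e he u hu v hv hux.2 (hSA v this)⟩
      exact fun v hv => (mem_inter.1 (reach_subset this hv)).2
    have hXe : reach T I S = X :=
      Finset.eq_of_subset_of_card_le hsub ((hmin S hSB).2 hc)
    have hcS := closed_reach T I S
    have : A ⊆ S := by
      intro a ha
      by_contra haS
      rcases hAsub a ha with h | ⟨e, he, hae, u, hu, hux⟩
      · exact hSA a (hcS.1 a h haS) ha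
      · exact hSA a (hcS.2.2 e he u hu a hae (hXe ▸ hux) haS) ha
    exact (Finset.eq_of_subset_of_card_le this hc).symm
  have hiii : ∀ S, Sep T A B S → A.card ≤ S.card := by
    intro S hS
    exact (hmin S (sep_trans hA hS)).1
  have hT1LCl : LCl T1 I A := by
    refine ⟨?_, ?_⟩
    · intro S hS hc
      refine hii S ?_ hc
      obtain ⟨Y, ⟨b1, b2, b3⟩, hYA⟩ := hS
      refine ⟨Y ∩ X, ⟨?_, ?_, ?_⟩, ?_⟩
      · intro v hv hvS
        have := b1 v hv hvS
        rw [mem_inter]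
        exact ⟨this, hr.1 v hv (hYA v this)⟩
      · intro v hv
        exact b2 v (mem_inter.1 hv).1
      · intro e he u hu v hv hux hvS
        rw [mem_inter] at hux ⊢
        have := b3 e (mem1 e he u hu hux.2) u hu v hv hux.1 hvS
        exact ⟨this, hr.2.2 e he u hu v hv hux.2 (hYA v this)⟩
      · intro v hv
        exact hYA v (mem_inter.1 hv).1
    · intro e he
      rw [hr1]
      rw [hT1, mem_filter] at he
      exact he.2
  refine ⟨A, T1, T \ T1, union_sdiff_of_subset hT1s, hT1LCl, ?_, ?_⟩
  · intro S hS
    apply hiii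
    obtain ⟨Y, ⟨b1, b2, b3⟩, hYB⟩ := hS
    refine ⟨(Y ∪ X) \ S, ⟨?_, ?_, ?_⟩, ?_⟩
    · intro v hv hvS
      have := b1 v hv hvS
      simp [this, hvS]
    · intro v hv
      simp only [mem_sdiff] at hv
      exact hv.2
    · intro e he u hu v hv hux hvS
      simp only [mem_sdiff, mem_union] at hux ⊢
      refine ⟨?_, hvS⟩
      by_cases h1 : e ∈ T1
      · by_cases hvA : v ∈ A
        · exact Or.inl (b1 v hvA hvS)
        · right
          have hh := h1
          rw [hT1, mem_filter] at hh
          obtain ⟨-, w, hw, hwX⟩ := hh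
          exact hr.2.2 e he w hw v hv hwX hvA
      · have h2 : e ∈ T \ T1 := by simp [he, h1]
        rcases hux.1 with h | h
        · exact Or.inl (b3 e h2 u hu v hv h hvS)
        · exact absurd (mem1 e he u hu h) h1
    · intro v hv
      simp only [mem_sdiff, mem_union] at hv
      rcases hv.1 with h | h
      · exact hYB v h
      · exact hrB v h
  · rw [hT1LCl.reach_eq, hr1, Finset.disjoint_left]
    intro v hv
    simp only [mem_union, not_or]
    refine ⟨⟨?_, hr.2.1 v hv⟩, hrB v hv⟩
    intro hv2
    obtain ⟨e, he, hve⟩ := mem_vertsOf.1 hv2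
    rw [mem_sdiff] at he
    exact he.2 (mem1 e he.1 v hve hv)

/-- closed set used repeatedly -/
theorem Decomp.closed_glue (h : Decomp T I B A T1 T2) {S Y : Finset (Fin n)}
    (hY : Closed T2 A S Y) : Closed T I S ((Y ∪ reach T1 I A) \ S) := by
  have hr := closed_reach T1 I A
  obtain ⟨b1, b2, b3⟩ := hY
  refine ⟨?_, ?_, ?_⟩
  · intro v hv hvS
    simp only [mem_sdiff, mem_union]
    refine ⟨?_, hvS⟩
    rcases h.vI hv with h1 | h1
    · exact Or.inr h1
    · exact Or.inl (b1 v h1 hvS)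
  · intro v hv
    simp only [mem_sdiff] at hv
    exact hv.2
  · intro e he u hu v hv hux hvS
    simp only [mem_sdiff, mem_union] at hux ⊢
    refine ⟨?_, hvS⟩
    have he' := he
    rw [← h.union, mem_union] at he'
    rcases he' with he' | he'
    · rcases h.v1 he' hv with h1 | h1
      · exact Or.inr h1
      · exact Or.inl (b1 v h1 hvS)
    · rcases hux.1 with h1 | h1
      · exact Or.inl (b3 e he' u hu v hv h1 hvS)
      · exact absurd hu ((h.notin h1).2.2 e he')

theorem Decomp.LCl_iff {P : Finset (Fin n)} {A' : Finset (Fin n)}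
    (h : Decomp T I (A ∪ P) A' T1 T2) : LCl T I A ↔ LCl T2 A' A := by
  have hB : ∀ v ∈ reach T1 I A', v ∉ A := fun v hv hA =>
    (h.notin hv).2.1 (mem_union_left _ hA)
  have hr1 := closed_reach T1 I A'
  constructor
  · intro hL
    refine ⟨?_, ?_⟩
    · intro S hS hc
      refine hL.1 S ?_ hc
      obtain ⟨Y, hY, hYA⟩ := hS
      refine ⟨_, h.closed_glue hY, ?_⟩
      intro v hv
      simp only [mem_sdiff, mem_union] at hv
      rcases hv.1 with h1 | h1
      · exact hYA v h1
      · exact hB v h1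
    · intro e he
      obtain ⟨u, hu, hur⟩ := hL.2 e (h.subr he)
      have := reach_subset (h.closed_glue (closed_reach T2 A' A)) hur
      simp only [mem_sdiff, mem_union] at this
      rcases this.1 with h1 | h1
      · exact ⟨u, hu, h1⟩
      · exact absurd hu ((h.notin h1).2.2 e he)
  · intro hL
    refine ⟨?_, ?_⟩
    · intro S hS hc
      obtain ⟨X, hX, hXA⟩ := hS
      obtain ⟨s1, s2, hcard⟩ := uncross h.closedT hB hX hXA
      have c1 := h.left.card_le_of_sep (s1.mono h.subl)
      have e2 := hL.1 _ (s2.mono h.subr) (by omega)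
      rw [e2] at hcard
      have e1 := h.left.1 _ (s1.mono h.subl) (by omega)
      rw [← e2]
      ext v
      have k1 : v ∈ A' → v ∈ S ∪ X := by
        intro hv
        have hv' := hv
        rw [← e1] at hv'
        have := hr1.2.1 v
        simp only [mem_union, mem_inter] at hv' ⊢
        tauto
      have k2 : v ∈ S → v ∉ reach T1 I A' := by
        intro hv hX
        refine hr1.2.1 v hX ?_
        rw [← e1]
        simp [hv, hX]
      simp only [mem_union, mem_sdiff] at *
      tauto
    · have hsub : reach T1 I A' ⊆ reach T I A := by
        have hc := closed_reach T I A
        have : Closed T1 I A' (reach T I A ∩ reach T1 I A') := by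
          refine ⟨?_, ?_, ?_⟩
          · intro v hv hvA
            have := hr1.1 v hv hvA
            exact mem_inter.2 ⟨hc.1 v hv (hB v this), this⟩
          · intro v hv
            exact hr1.2.1 v (mem_inter.1 hv).2
          · intro e he u hu v hv hux hvA
            rw [mem_inter] at hux ⊢
            have := hr1.2.2 e he u hu v hv hux.2 hvA
            exact ⟨hc.2.2 e (h.subl he) u hu v hv hux.1 (hB v this), this⟩
        exact fun v hv => (mem_inter.1 (reach_subset this hv)).1
      have hsub2 : reach T2 A' A ⊆ reach T I A := by
        have hc := closed_reach T I A
        refine reach_subset ⟨?_, hc.2.1, fun e he => hc.2.2 e (h.subr he)⟩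
        intro v hv hvA
        rcases h.left.sub v hv with h1 | ⟨e, he, hve, u, hu, hur⟩
        · exact hc.1 v h1 hvA
        · exact hc.2.2 e (h.subl he) u hu v hve (hsub hur) hvA
      intro e he
      rw [← h.union, mem_union] at he
      rcases he with he | he
      · obtain ⟨u, hu, hur⟩ := h.left.2 e he
        exact ⟨u, hu, hsub hur⟩
      · obtain ⟨u, hu, hur⟩ := hL.2 e he
        exact ⟨u, hu, hsub2 hur⟩

/-- `B'` is the separator of `(J, A ∪ P)`. -/
theorem Decomp.NCl_iff {P J B' : Finset (Fin n)} {T3 : Finset (Edge n)}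
    (h : Decomp T J (A ∪ P) B' T3 T2) : NCl T A J ↔ NCl T2 A B' := by
  have hB : ∀ v ∈ reach T3 J B', v ∉ A := fun v hv hA =>
    (h.notin hv).2.1 (mem_union_left _ hA)
  constructor
  · intro hN S hS
    apply hN
    apply Sep.symm
    obtain ⟨Y, hY, hYA⟩ := hS.symm
    refine ⟨_, h.closed_glue hY, ?_⟩
    intro v hv
    simp only [mem_sdiff, mem_union] at hv
    rcases hv.1 with h1 | h1
    · exact hYA v h1
    · exact hB v h1
  · intro hN S hS
    obtain ⟨X, hX, hXA⟩ := hS.symm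
    obtain ⟨s1, s2, hcard⟩ := uncross h.closedT hB hX hXA
    have c1 := h.left.card_le_of_sep (s1.mono h.subl)
    have c2 := hN _ (s2.mono h.subr).symm
    omega

/-- vertex set bookkeeping -/
theorem Decomp.verts (h : Decomp T I B A T1 T2) :
    vertsOf T ∪ I ∪ B = ((vertsOf T1 ∪ I) \ A) ∪ (vertsOf T2 ∪ A ∪ B) := by
  have hv : vertsOf T = vertsOf T1 ∪ vertsOf T2 := by
    rw [← h.union]
    ext v
    simp only [mem_vertsOf, mem_union]
    constructor
    · rintro ⟨e, h1 | h1, h2⟩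
      · exact Or.inl ⟨e, h1, h2⟩
      · exact Or.inr ⟨e, h1, h2⟩
    · rintro (⟨e, h1, h2⟩ | ⟨e, h1, h2⟩)
      · exact ⟨e, Or.inl h1, h2⟩
      · exact ⟨e, Or.inr h1, h2⟩
  rw [hv]
  ext v
  have := @h.left.A_sub
  have hA : v ∈ A → v ∈ vertsOf T1 ∨ v ∈ I := by
    intro hv
    simpa using this hv
  simp only [mem_union, mem_sdiff]
  tauto

end


/-- index type: pairs (separator, auxiliary set) -/
abbrev PR (n : ℕ) := Finset (Fin n) × Finset (Fin n)

/-- sum of characters over a class -/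
noncomputable def sumChi {n : ℕ} (G : Graph n) (c : Finset (Edge n) → Prop) : ℝ :=
  ∑ T : Finset (Edge n), if c T then chi G T else 0

theorem sumChi_congr {n : ℕ} (G : Graph n) {c c' : Finset (Edge n) → Prop} (h : ∀ T, c T ↔ c' T) :
    sumChi G c = sumChi G c' := by
  have : c = c' := funext fun T => propext (h T)
  rw [this]

theorem sum_neg_one_subset {n : ℕ} (X : Finset (Fin n)) :
    ∑ P : Finset (Fin n), (if P ⊆ X then (-1 : ℝ) ^ P.card else 0) = if X = ∅ then 1 else 0 := by
  rw [← Finset.sum_filter]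
  have h1 : (Finset.univ.filter fun P : Finset (Fin n) => P ⊆ X) = X.powerset := by
    ext P; simp
  rw [h1]
  have := Finset.sum_powerset_neg_one_pow_card (x := X)
  have h2 : ((∑ m ∈ X.powerset, (-1 : ℤ) ^ m.card : ℤ) : ℝ) = ((if X = ∅ then 1 else 0 : ℤ) : ℝ) := by
    rw [this]
  push_cast at h2
  simpa using h2

theorem chi_union {n : ℕ} (G : Graph n) {T1 T2 : Finset (Edge n)} (h : Disjoint T1 T2) :
    chi G (T1 ∪ T2) = chi G T1 * chi G T2 := by
  unfold chi
  exact Finset.prod_union h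

theorem sum_decomp {n : ℕ} (I B : Finset (Fin n)) (f : Finset (Edge n) → ℝ) :
    ∑ T, f T = ∑ A : Finset (Fin n), ∑ T1 : Finset (Edge n), ∑ T2 : Finset (Edge n),
      if Decomp (T1 ∪ T2) I B A T1 T2 then f (T1 ∪ T2) else 0 := by
  have e1 : ∀ T, f T = ∑ A : Finset (Fin n), ∑ T1 : Finset (Edge n), ∑ T2 : Finset (Edge n),
      if Decomp T I B A T1 T2 then f T else 0 := by
    intro T
    obtain ⟨A, T1, T2, h⟩ := exists_decomp T I B
    rw [Finset.sum_eq_single A, Finset.sum_eq_single T1, Finset.sum_eq_single T2, if_pos h]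
    · intro T2' _ hne
      rw [if_neg]
      intro h'
      exact hne (h'.unique h).2.2
    · simp
    · intro T1' _ hne
      refine Finset.sum_eq_zero fun T2' _ => ?_
      rw [if_neg]
      intro h'
      exact hne (h'.unique h).2.1
    · simp
    · intro A' _ hne
      refine Finset.sum_eq_zero fun T1' _ => Finset.sum_eq_zero fun T2' _ => ?_
      rw [if_neg]
      intro h'
      exact hne (h'.unique h).1
    · simp
  rw [Finset.sum_congr rfl fun T _ => e1 T, Finset.sum_comm]
  refine Finset.sum_congr rfl fun A _ => ?_
  rw [Finset.sum_comm]
  refine Finset.sum_congr rfl fun T1 _ => ?_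
  rw [Finset.sum_comm]
  refine Finset.sum_congr rfl fun T2 _ => ?_
  rw [Finset.sum_eq_single (T1 ∪ T2)]
  · intro T _ hne
    rw [if_neg]
    intro h
    exact hne h.union.symm
  · simp

theorem ite_aux1 (a b x c d f y : Prop) (r s e : ℝ)
    [Decidable (a ∧ b ∧ x)] [Decidable (c ∧ d ∧ f ∧ y)] [Decidable (a ∧ c ∧ d ∧ b ∧ f)]
    [Decidable (x ∧ y)] :
    (if a ∧ b ∧ x then r else 0) * (e * (if c ∧ d ∧ f ∧ y then s else 0)) =
      (if a ∧ c ∧ d ∧ b ∧ f then r * s else 0) * (if x ∧ y then e else 0) := by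
  by_cases a <;> by_cases b <;> by_cases x <;> by_cases c <;> by_cases d <;> by_cases f <;>
    by_cases y <;> simp [*]
  ring

theorem ite_aux2 (a b c d f g : Prop) (r : ℝ)
    [Decidable (a ∧ c ∧ d ∧ b ∧ f)] [Decidable g] [Decidable (a ∧ c ∧ d ∧ g ∧ b ∧ f)] :
    (if a ∧ c ∧ d ∧ b ∧ f then r else 0) * (if g then 1 else 0) =
      (if a ∧ c ∧ d ∧ g ∧ b ∧ f then r else 0) := by
  by_cases a <;> by_cases b <;> by_cases c <;> by_cases d <;> by_cases f <;>
    by_cases g <;> simp [*]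

theorem gen {n : ℕ} (G : Graph n) (I B : Finset (Fin n)) (i : ℕ)
    (cond : Finset (Edge n) → Prop) (c : Finset (Fin n) → Finset (Edge n) → Prop)
    (w : Finset (Fin n) → Finset (Edge n) → ℕ)
    (h : ∀ T A T1 T2, Decomp T I B A T1 T2 →
      (cond T ↔ c A T2 ∧ ((vertsOf T1 ∪ I) \ A).card + w A T2 = i)) :
    sumChi G cond = ∑ p ∈ antidiagonal i, ∑ x : PR n,
      sumChi G (fun T1 => LCl T1 I x.1 ∧ ((vertsOf T1 ∪ I) \ x.1).card = p.1 ∧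
        x.2 ⊆ (vertsOf T1 ∪ I) \ x.1) *
      ((-1) ^ x.2.card * sumChi G (fun T2 => NCl T2 x.1 B ∧ c x.1 T2 ∧ w x.1 T2 = p.2 ∧
        x.2 ⊆ (vertsOf T2 ∪ x.1 ∪ B) \ x.1)) := by
  have hL : sumChi G cond = ∑ A : Finset (Fin n), ∑ T1 : Finset (Edge n), ∑ T2 : Finset (Edge n),
      if Decomp (T1 ∪ T2) I B A T1 T2 then (if cond (T1 ∪ T2) then chi G (T1 ∪ T2) else 0) else 0 := by
    unfold sumChi
    exact sum_decomp I B _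
  rw [hL]
  have hR : ∀ p : ℕ × ℕ, ∑ x : PR n,
      sumChi G (fun T1 => LCl T1 I x.1 ∧ ((vertsOf T1 ∪ I) \ x.1).card = p.1 ∧
        x.2 ⊆ (vertsOf T1 ∪ I) \ x.1) *
      ((-1) ^ x.2.card * sumChi G (fun T2 => NCl T2 x.1 B ∧ c x.1 T2 ∧ w x.1 T2 = p.2 ∧
        x.2 ⊆ (vertsOf T2 ∪ x.1 ∪ B) \ x.1)) =
      ∑ A : Finset (Fin n), ∑ T1 : Finset (Edge n), ∑ T2 : Finset (Edge n), ∑ P : Finset (Fin n),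
       (if LCl T1 I A ∧ ((vertsOf T1 ∪ I) \ A).card = p.1 ∧
        P ⊆ (vertsOf T1 ∪ I) \ A then chi G T1 else 0) * ((-1) ^ P.card *
        (if NCl T2 A B ∧ c A T2 ∧ w A T2 = p.2 ∧
        P ⊆ (vertsOf T2 ∪ A ∪ B) \ A then chi G T2 else 0)) := by
    intro p
    rw [Fintype.sum_prod_type]
    refine Finset.sum_congr rfl fun A _ => ?_
    have : ∀ P : Finset (Fin n), sumChi G (fun T1 => LCl T1 I A ∧ ((vertsOf T1 ∪ I) \ A).card = p.1 ∧
        P ⊆ (vertsOf T1 ∪ I) \ A) *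
      ((-1) ^ P.card * sumChi G (fun T2 => NCl T2 A B ∧ c A T2 ∧ w A T2 = p.2 ∧
        P ⊆ (vertsOf T2 ∪ A ∪ B) \ A)) = ∑ T1 : Finset (Edge n), ∑ T2 : Finset (Edge n),
         (if LCl T1 I A ∧ ((vertsOf T1 ∪ I) \ A).card = p.1 ∧
        P ⊆ (vertsOf T1 ∪ I) \ A then chi G T1 else 0) * ((-1) ^ P.card *
        (if NCl T2 A B ∧ c A T2 ∧ w A T2 = p.2 ∧
        P ⊆ (vertsOf T2 ∪ A ∪ B) \ A then chi G T2 else 0)) := by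
      intro P
      unfold sumChi
      rw [Finset.mul_sum, Finset.sum_mul_sum]
      refine Finset.sum_congr rfl fun T1 _ => Finset.sum_congr rfl fun T2 _ => ?_
      beta_reduce
      congr!
    rw [Finset.sum_congr rfl fun P _ => this P, Finset.sum_comm]
    refine Finset.sum_congr rfl fun T1 _ => ?_
    rw [Finset.sum_comm]
  rw [Finset.sum_congr rfl fun p _ => hR p]
  symm
  rw [Finset.sum_comm]
  refine Finset.sum_congr rfl fun A _ => ?_
  rw [Finset.sum_comm]
  refine Finset.sum_congr rfl fun T1 _ => ?_
  rw [Finset.sum_comm]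
  refine Finset.sum_congr rfl fun T2 _ => ?_
  have key : ∀ p : ℕ × ℕ, ∑ P : Finset (Fin n),
       (if LCl T1 I A ∧ ((vertsOf T1 ∪ I) \ A).card = p.1 ∧
        P ⊆ (vertsOf T1 ∪ I) \ A then chi G T1 else 0) * ((-1) ^ P.card *
        (if NCl T2 A B ∧ c A T2 ∧ w A T2 = p.2 ∧
        P ⊆ (vertsOf T2 ∪ A ∪ B) \ A then chi G T2 else 0)) =
      if LCl T1 I A ∧ NCl T2 A B ∧ c A T2 ∧ Disjoint ((vertsOf T1 ∪ I) \ A) (vertsOf T2 ∪ A ∪ B) ∧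
        ((vertsOf T1 ∪ I) \ A).card = p.1 ∧ w A T2 = p.2 then chi G T1 * chi G T2 else 0 := by
    intro p
    have : ∀ P : Finset (Fin n), (if LCl T1 I A ∧ ((vertsOf T1 ∪ I) \ A).card = p.1 ∧
        P ⊆ (vertsOf T1 ∪ I) \ A then chi G T1 else 0) * ((-1) ^ P.card *
        (if NCl T2 A B ∧ c A T2 ∧ w A T2 = p.2 ∧
        P ⊆ (vertsOf T2 ∪ A ∪ B) \ A then chi G T2 else 0)) =
        (if LCl T1 I A ∧ NCl T2 A B ∧ c A T2 ∧
        ((vertsOf T1 ∪ I) \ A).card = p.1 ∧ w A T2 = p.2 then chi G T1 * chi G T2 else 0) *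
        (if P ⊆ ((vertsOf T1 ∪ I) \ A) ∩ (vertsOf T2 ∪ A ∪ B) then (-1) ^ P.card else 0) := by
      intro P
      have hP : P ⊆ ((vertsOf T1 ∪ I) \ A) ∩ (vertsOf T2 ∪ A ∪ B) ↔
         (P ⊆ (vertsOf T1 ∪ I) \ A ∧ P ⊆ (vertsOf T2 ∪ A ∪ B) \ A) := by
        simp only [subset_iff, mem_inter, mem_sdiff]
        constructor
        · intro hh
          exact ⟨fun v hv => (hh hv).1, fun v hv => ⟨(hh hv).2, (hh hv).1.2⟩⟩
        · rintro ⟨h1, h2⟩ v hv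
          exact ⟨h1 hv, (h2 hv).1⟩
      rw [if_congr hP rfl rfl]
      exact ite_aux1 ..
    rw [Finset.sum_congr rfl fun P _ => this P, ← Finset.mul_sum, sum_neg_one_subset]
    have hd := Finset.disjoint_iff_inter_eq_empty (s := (vertsOf T1 ∪ I) \ A) (t := vertsOf T2 ∪ A ∪ B)
    rw [← if_congr hd rfl rfl]
    exact ite_aux2 ..
  rw [Finset.sum_congr rfl fun p _ => key p]
  symm
  by_cases hD : Decomp (T1 ∪ T2) I B A T1 T2
  · rw [if_pos hD, if_congr (h _ _ _ _ hD) rfl rfl]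
    by_cases hc : c A T2 ∧ ((vertsOf T1 ∪ I) \ A).card + w A T2 = i
    · rw [if_pos hc, Finset.sum_eq_single (((vertsOf T1 ∪ I) \ A).card, w A T2), if_pos, chi_union _ hD.disjT]
      · exact ⟨hD.left, hD.right, hc.1, hD.disj, rfl, rfl⟩
      · rintro ⟨p1, p2⟩ _ hne
        rw [if_neg]
        rintro ⟨_, _, _, _, h1, h2⟩
        apply hne
        simp only at h1 h2
        rw [← h1, ← h2]
      · intro hh
        exact absurd (mem_antidiagonal.2 hc.2) hh
    · rw [if_neg hc]
      symm
      refine Finset.sum_eq_zero fun p hp => ?_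
      rw [if_neg]
      rintro ⟨_, _, h3, _, h1, h2⟩
      apply hc
      rw [h1, h2]
      exact ⟨h3, mem_antidiagonal.1 hp⟩
  · rw [if_neg hD]
    symm
    refine Finset.sum_eq_zero fun p hp => ?_
    rw [if_neg]
    rintro ⟨h1, h2, _, h4, _⟩
    exact hD ⟨rfl, h1, h2, h4⟩



section
variable {n : ℕ} {T T1 T2 : Finset (Edge n)} {I B A : Finset (Fin n)}

theorem Decomp.verts' (h : Decomp T I B A T1 T2) :
    vertsOf T ∪ I = ((vertsOf T1 ∪ I) \ A) ∪ (vertsOf T2 ∪ A) := by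
  have hv : vertsOf T = vertsOf T1 ∪ vertsOf T2 := by
    rw [← h.union]
    ext v
    simp only [mem_vertsOf, mem_union]
    constructor
    · rintro ⟨e, h1 | h1, h2⟩
      · exact Or.inl ⟨e, h1, h2⟩
      · exact Or.inr ⟨e, h1, h2⟩
    · rintro (⟨e, h1, h2⟩ | ⟨e, h1, h2⟩)
      · exact ⟨e, Or.inl h1, h2⟩
      · exact ⟨e, Or.inr h1, h2⟩
  rw [hv]
  ext v
  have := @h.left.A_sub
  have hA : v ∈ A → v ∈ vertsOf T1 ∨ v ∈ I := by
    intro hv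
    simpa using this hv
  simp only [mem_union, mem_sdiff]
  tauto

end

/-- class for the left matrices -/
def LC {n : ℕ} (I : Finset (Fin n)) (y : PR n) (i : ℕ) (T : Finset (Edge n)) : Prop :=
  LCl T I y.1 ∧ ((vertsOf T ∪ I) \ y.1).card = i ∧ y.2 ⊆ (vertsOf T ∪ I) \ y.1

/-- class for the transfer matrices -/
def GC {n : ℕ} (d : ℕ) (x y : PR n) (w : ℕ) (T : Finset (Edge n)) : Prop :=
  NCl T x.1 (y.1 ∪ y.2) ∧ (x.1.card ≤ d ∧ LCl T x.1 y.1 ∧ y.2 ⊆ (vertsOf T ∪ x.1) \ y.1) ∧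
    ((vertsOf T ∪ x.1) \ y.1).card = w ∧ x.2 ⊆ (vertsOf T ∪ x.1 ∪ (y.1 ∪ y.2)) \ x.1

/-- class for the right remainder -/
def NC {n : ℕ} (x : PR n) (J : Finset (Fin n)) (w : ℕ) (T : Finset (Edge n)) : Prop :=
  NCl T x.1 J ∧ True ∧ (vertsOf T ∪ x.1 ∪ J).card = w ∧ x.2 ⊆ (vertsOf T ∪ x.1 ∪ J) \ x.1

/-- class for the middle matrices -/
def HC {n : ℕ} (d : ℕ) (x y : PR n) (u : ℕ) (T : Finset (Edge n)) : Prop :=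
  NCl T y.1 (x.1 ∪ x.2) ∧ (y.1.card ≤ d ∧ NCl T x.1 y.1 ∧ x.2 ⊆ (vertsOf T ∪ x.1 ∪ y.1) \ x.1) ∧
    (vertsOf T ∪ x.1 ∪ y.1).card = u ∧ y.2 ⊆ (vertsOf T ∪ y.1 ∪ (x.1 ∪ x.2)) \ y.1

/-- graded moment matrix -/
noncomputable def Mm {n : ℕ} (d : ℕ) (G : Graph n) (v : ℕ) : Matrix (PR n) (PR n) ℝ := fun x y =>
  if (x.2 = ∅ ∧ x.1.card ≤ d) ∧ (y.2 = ∅ ∧ y.1.card ≤ d) then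
    sumChi G (fun T => (vertsOf T ∪ x.1 ∪ y.1).card = v) else 0

noncomputable def Lh {n : ℕ} (d : ℕ) (G : Graph n) (i : ℕ) : Matrix (PR n) (PR n) ℝ := fun x y =>
  if x.2 = ∅ ∧ x.1.card ≤ d then sumChi G (LC x.1 y i) else 0

noncomputable def Gam {n : ℕ} (d : ℕ) (G : Graph n) (w : ℕ) : Matrix (PR n) (PR n) ℝ := fun x y =>
  (-1) ^ x.2.card * sumChi G (GC d x y w)

noncomputable def Nm {n : ℕ} (d : ℕ) (G : Graph n) (w : ℕ) : Matrix (PR n) (PR n) ℝ := fun x y =>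
  if y.2 = ∅ ∧ y.1.card ≤ d then (-1) ^ x.2.card * sumChi G (NC x y.1 w) else 0

noncomputable def Hm {n : ℕ} (d : ℕ) (G : Graph n) (u : ℕ) : Matrix (PR n) (PR n) ℝ := fun x y =>
  (-1) ^ x.2.card * ((-1) ^ y.2.card * sumChi G (HC d x y u))

theorem Lh_eq {n : ℕ} (d : ℕ) (G : Graph n) (i : ℕ) :
    Lh d G i = ∑ p ∈ antidiagonal i, Lh d G p.1 * Gam d G p.2 := by
  ext x y
  rw [Matrix.sum_apply]
  simp only [Matrix.mul_apply]
  by_cases hx : x.2 = ∅ ∧ x.1.card ≤ d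
  · have e1 : Lh d G i x y = sumChi G (LC x.1 y i) := if_pos hx
    rw [e1, gen G x.1 (y.1 ∪ y.2) i (LC x.1 y i)
      (fun A T => A.card ≤ d ∧ LCl T A y.1 ∧ y.2 ⊆ (vertsOf T ∪ A) \ y.1)
      (fun A T => ((vertsOf T ∪ A) \ y.1).card)]
    · refine Finset.sum_congr rfl fun p _ => Finset.sum_congr rfl fun z _ => ?_
      have e2 : Lh d G p.1 x z = sumChi G (LC x.1 z p.1) := if_pos hx
      rw [e2]
      rfl
    · intro T A T1 T2 h
      have hd : A.card ≤ d := h.left.card_le.trans hx.2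
      have h1 := h.LCl_iff
      have hv := h.verts'
      have hdj := h.disj
      rw [Finset.disjoint_left] at hdj
      have e2 : (vertsOf T ∪ x.1) \ y.1 = ((vertsOf T1 ∪ x.1) \ A) ∪ ((vertsOf T2 ∪ A) \ y.1) := by
        rw [hv]
        ext v
        have := @hdj v
        simp only [mem_union, mem_sdiff] at this ⊢
        tauto
      have e3 : ((vertsOf T ∪ x.1) \ y.1).card =
          ((vertsOf T1 ∪ x.1) \ A).card + ((vertsOf T2 ∪ A) \ y.1).card := by
        rw [e2, Finset.card_union_of_disjoint]
        rw [Finset.disjoint_left]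
        intro v hv1 hv2
        apply hdj hv1
        simp only [mem_union, mem_sdiff] at hv2 ⊢
        tauto
      have e4 : y.2 ⊆ (vertsOf T ∪ x.1) \ y.1 ↔ y.2 ⊆ (vertsOf T2 ∪ A) \ y.1 := by
        rw [e2]
        constructor
        · intro hs v hv1
          rcases mem_union.1 (hs hv1) with h2 | h2
          · exact absurd (by simp [hv1]) (hdj h2)
          · exact h2
        · intro hs
          exact hs.trans subset_union_right
      unfold LC
      rw [e3, e4, h1]
      tauto
  · have e1 : ∀ i z, Lh d G i x z = 0 := fun i z => if_neg hx
    simp [e1]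

theorem Mm_eq {n : ℕ} (d : ℕ) (G : Graph n) (v : ℕ) :
    Mm d G v = ∑ p ∈ antidiagonal v, Lh d G p.1 * Nm d G p.2 := by
  ext x y
  rw [Matrix.sum_apply]
  simp only [Matrix.mul_apply]
  by_cases hx : x.2 = ∅ ∧ x.1.card ≤ d
  · by_cases hy : y.2 = ∅ ∧ y.1.card ≤ d
    · have e1 : Mm d G v x y = sumChi G (fun T => (vertsOf T ∪ x.1 ∪ y.1).card = v) := if_pos ⟨hx, hy⟩
      rw [e1, gen G x.1 y.1 v _ (fun A T => True) (fun A T => (vertsOf T ∪ A ∪ y.1).card)]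
      · refine Finset.sum_congr rfl fun p _ => Finset.sum_congr rfl fun z _ => ?_
        have e2 : Lh d G p.1 x z = sumChi G (LC x.1 z p.1) := if_pos hx
        have e3 : Nm d G p.2 z y = (-1) ^ z.2.card * sumChi G (NC z y.1 p.2) := if_pos hy
        rw [e2, e3]
        rfl
      · intro T A T1 T2 h
        rw [h.verts, Finset.card_union_of_disjoint h.disj]
        tauto
    · have e1 : ∀ i z, Nm d G i z y = 0 := fun i z => if_neg hy
      have e2 : Mm d G v x y = 0 := if_neg fun h => hy h.2
      simp [e1, e2]
  · have e1 : ∀ i z, Lh d G i x z = 0 := fun i z => if_neg hx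
    have e2 : Mm d G v x y = 0 := if_neg fun h => hx h.1
    simp [e1, e2]

theorem Nm_eq {n : ℕ} (d : ℕ) (G : Graph n) (w : ℕ) :
    Nm d G w = ∑ p ∈ antidiagonal w, Hm d G p.1 * (Lh d G p.2).transpose := by
  ext x y
  rw [Matrix.sum_apply]
  simp only [Matrix.mul_apply, Matrix.transpose_apply]
  by_cases hy : y.2 = ∅ ∧ y.1.card ≤ d
  · have e1 : Nm d G w x y = (-1) ^ x.2.card * sumChi G (NC x y.1 w) := if_pos hy
    rw [e1, gen G y.1 (x.1 ∪ x.2) w _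
      (fun B T => B.card ≤ d ∧ NCl T x.1 B ∧ x.2 ⊆ (vertsOf T ∪ x.1 ∪ B) \ x.1)
      (fun B T => (vertsOf T ∪ x.1 ∪ B).card), Finset.mul_sum, ← Finset.Nat.sum_antidiagonal_swap]
    · refine Finset.sum_congr rfl fun p _ => ?_
      rw [Finset.mul_sum]
      refine Finset.sum_congr rfl fun z _ => ?_
      have e2 : Lh d G p.2 y z = sumChi G (LC y.1 z p.2) := if_pos hy
      rw [e2]
      have e3 : Hm d G p.1 x z = (-1) ^ x.2.card * ((-1) ^ z.2.card * sumChi G (HC d x z p.1)) := rfl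
      rw [e3]
      simp only [Prod.swap]
      have e4 : sumChi G (fun T1 ↦ LCl T1 y.1 z.1 ∧ #((vertsOf T1 ∪ y.1) \ z.1) = p.2 ∧ z.2 ⊆ (vertsOf T1 ∪ y.1) \ z.1)
        = sumChi G (LC y.1 z p.2) := rfl
      rw [e4]
      have e5 : sumChi G (fun T2 ↦ NCl T2 z.1 (x.1 ∪ x.2) ∧
              (#z.1 ≤ d ∧ NCl T2 x.1 z.1 ∧ x.2 ⊆ (vertsOf T2 ∪ x.1 ∪ z.1) \ x.1) ∧
                #(vertsOf T2 ∪ x.1 ∪ z.1) = p.1 ∧ z.2 ⊆ (vertsOf T2 ∪ z.1 ∪ (x.1 ∪ x.2)) \ z.1)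
        = sumChi G (HC d x z p.1) := rfl
      rw [e5]
      ring
    · intro T A T1 T2 h
      have hd : A.card ≤ d := h.left.card_le.trans hy.2
      have h1 := h.NCl_iff
      have hv := h.verts'
      have hdj := h.disj
      rw [Finset.disjoint_left] at hdj
      have e2 : vertsOf T ∪ x.1 ∪ y.1 = ((vertsOf T1 ∪ y.1) \ A) ∪ (vertsOf T2 ∪ x.1 ∪ A) := by
        have : vertsOf T ∪ x.1 ∪ y.1 = (vertsOf T ∪ y.1) ∪ x.1 := by
          ext v; simp only [mem_union]; tauto
        rw [this, hv]
        ext v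
        simp only [mem_union, mem_sdiff]
        tauto
      have e3 : (vertsOf T ∪ x.1 ∪ y.1).card =
          ((vertsOf T1 ∪ y.1) \ A).card + (vertsOf T2 ∪ x.1 ∪ A).card := by
        rw [e2, Finset.card_union_of_disjoint]
        rw [Finset.disjoint_left]
        intro v hv1 hv2
        apply hdj hv1
        simp only [mem_union] at hv2 ⊢
        tauto
      have e4 : x.2 ⊆ (vertsOf T ∪ x.1 ∪ y.1) \ x.1 ↔ x.2 ⊆ (vertsOf T2 ∪ x.1 ∪ A) \ x.1 := by
        rw [e2]
        constructor
        · intro hs v hv1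
          have h3 := hs hv1
          rw [mem_sdiff, mem_union] at h3
          rcases h3.1 with h2 | h2
          · exact absurd (by simp [hv1]) (hdj h2)
          · exact mem_sdiff.2 ⟨h2, h3.2⟩
        · intro hs v hv1
          have h3 := hs hv1
          rw [mem_sdiff] at h3 ⊢
          exact ⟨mem_union_right _ h3.1, h3.2⟩
      unfold NC
      rw [e3, e4, h1]
      tauto
  · have e1 : ∀ i z, Lh d G i y z = 0 := fun i z => if_neg hy
    have e2 : Nm d G w x y = 0 := if_neg hy
    simp [e1, e2]

section toggles
variable {n : ℕ}

/-- cliques -/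
def Clq (G : Graph n) (A : Finset (Fin n)) : Prop :=
  ∀ e : Edge n, (∀ v ∈ (e : Sym2 (Fin n)), v ∈ A) → G e = true

theorem chi_symmDiff (G : Graph n) (T : Finset (Edge n)) (e : Edge n) (he : G e = false) :
    chi G (symmDiff T {e}) = - chi G T := by
  unfold chi
  have hs : edgeSign G e = -1 := by simp [edgeSign, he]
  by_cases h : e ∈ T
  · have : symmDiff T {e} = T.erase e := by
      ext f
      simp only [Finset.mem_symmDiff, mem_singleton, mem_erase]
      constructor
      · rintro (⟨a, b⟩ | ⟨rfl, b⟩)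
        · exact ⟨b, a⟩
        · exact absurd h b
      · rintro ⟨a, b⟩
        exact Or.inl ⟨b, a⟩
    rw [this, ← Finset.mul_prod_erase T _ h, hs]
    ring
  · have : symmDiff T {e} = insert e T := by
      ext f
      simp only [Finset.mem_symmDiff, mem_singleton, mem_insert]
      constructor
      · rintro (⟨a, b⟩ | ⟨rfl, b⟩)
        · exact Or.inr a
        · exact Or.inl rfl
      · rintro (rfl | a)
        · exact Or.inr ⟨rfl, h⟩
        · refine Or.inl ⟨a, ?_⟩
          rintro rfl
          exact h a
    rw [this, Finset.prod_insert h, hs]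
    ring

theorem sumChi_toggle (G : Graph n) (c : Finset (Edge n) → Prop) (e : Edge n) (he : G e = false)
    (hc : ∀ T, c T → c (symmDiff T {e})) : sumChi G c = 0 := by
  have hinv : ∀ T : Finset (Edge n), symmDiff (symmDiff T {e}) {e} = T := by
    intro T
    rw [symmDiff_assoc, symmDiff_self]
    simp
  have hc' : ∀ T, c (symmDiff T {e}) ↔ c T := fun T => ⟨fun h => by
    have := hc _ h
    rwa [hinv] at this, hc T⟩
  have h1 : sumChi G c = - sumChi G c := by
    conv_lhs => unfold sumChi
    let σ : Equiv.Perm (Finset (Edge n)) :=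
      ⟨fun T => symmDiff T {e}, fun T => symmDiff T {e}, hinv, hinv⟩
    rw [← Equiv.sum_comp σ]
    unfold sumChi
    rw [← Finset.sum_neg_distrib]
    refine Finset.sum_congr rfl fun T _ => ?_
    have : σ T = symmDiff T {e} := rfl
    rw [this, chi_symmDiff _ _ _ he]
    by_cases h : c T
    · rw [if_pos h, if_pos ((hc' T).2 h)]
    · rw [if_neg h, if_neg (fun h' => h ((hc' T).1 h'))]; simp
  linarith

theorem Closed.toggle {T : Finset (Edge n)} {I S X : Finset (Fin n)} {e : Edge n}
    (he : ∀ v ∈ (e : Sym2 (Fin n)), v ∈ I) (h : Closed T I S X) : Closed (symmDiff T {e}) I S X := by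
  refine ⟨h.1, h.2.1, ?_⟩
  intro f hf u hu v hv huX hvS
  simp only [Finset.mem_symmDiff, mem_singleton] at hf
  rcases hf with ⟨a, _⟩ | ⟨rfl, _⟩
  · exact h.2.2 f a u hu v hv huX hvS
  · exact h.1 v (he v hv) hvS

theorem symmDiff_twice (T : Finset (Edge n)) (e : Edge n) : symmDiff (symmDiff T {e}) {e} = T := by
  rw [symmDiff_assoc, symmDiff_self]
  simp

theorem closed_toggle_iff {T : Finset (Edge n)} {I S X : Finset (Fin n)} {e : Edge n}
    (he : ∀ v ∈ (e : Sym2 (Fin n)), v ∈ I) : Closed (symmDiff T {e}) I S X ↔ Closed T I S X := by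
  constructor
  · intro h
    have := h.toggle he
    rwa [symmDiff_twice] at this
  · exact fun h => h.toggle he

theorem sep_toggle_iff {T : Finset (Edge n)} {I B S : Finset (Fin n)} {e : Edge n}
    (he : ∀ v ∈ (e : Sym2 (Fin n)), v ∈ I) : Sep (symmDiff T {e}) I B S ↔ Sep T I B S := by
  unfold Sep
  simp only [closed_toggle_iff he]

theorem sep_toggle_iff' {T : Finset (Edge n)} {I B S : Finset (Fin n)} {e : Edge n}
    (he : ∀ v ∈ (e : Sym2 (Fin n)), v ∈ B) : Sep (symmDiff T {e}) I B S ↔ Sep T I B S :=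
  ⟨fun h => ((sep_toggle_iff he).1 h.symm).symm, fun h => ((sep_toggle_iff he).2 h.symm).symm⟩

theorem reach_toggle {T : Finset (Edge n)} {I S : Finset (Fin n)} {e : Edge n}
    (he : ∀ v ∈ (e : Sym2 (Fin n)), v ∈ I) : reach (symmDiff T {e}) I S = reach T I S := by
  unfold reach
  simp only [closed_toggle_iff he]

theorem verts_toggle {T : Finset (Edge n)} {I : Finset (Fin n)} {e : Edge n}
    (he : ∀ v ∈ (e : Sym2 (Fin n)), v ∈ I) : vertsOf (symmDiff T {e}) ∪ I = vertsOf T ∪ I := by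
  have key : ∀ T' : Finset (Edge n), vertsOf (symmDiff T' {e}) ∪ I ⊆ vertsOf T' ∪ I := by
    intro T' v hv
    simp only [mem_union, mem_vertsOf, Finset.mem_symmDiff, mem_singleton] at hv ⊢
    rcases hv with ⟨f, ⟨a, _⟩ | ⟨rfl, _⟩, hvf⟩ | hv
    · exact Or.inl ⟨f, a, hvf⟩
    · exact Or.inr (he v hvf)
    · exact Or.inr hv
  refine subset_antisymm (key T) ?_
  have := key (symmDiff T {e})
  rwa [symmDiff_twice] at this

theorem not_clq {G : Graph n} {A : Finset (Fin n)} (h : ¬ Clq G A) :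
    ∃ e : Edge n, (∀ v ∈ (e : Sym2 (Fin n)), v ∈ A) ∧ G e = false := by
  unfold Clq at h
  push Not at h
  obtain ⟨e, h1, h2⟩ := h
  exact ⟨e, h1, by simpa using h2⟩

theorem Mm_clq_left (d : ℕ) (G : Graph n) (v : ℕ) (x y : PR n) (hx : ¬ Clq G x.1) :
    Mm d G v x y = 0 := by
  obtain ⟨e, he, hG⟩ := not_clq hx
  unfold Mm
  split_ifs
  · apply sumChi_toggle G _ e hG
    intro T hT
    rw [verts_toggle he]
    exact hT
  · rfl

theorem Mm_symm (d : ℕ) (G : Graph n) (v : ℕ) (x y : PR n) : Mm d G v x y = Mm d G v y x := by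
  unfold Mm
  rw [if_congr (and_comm) rfl rfl]
  split_ifs
  · apply sumChi_congr
    intro T
    have : vertsOf T ∪ x.1 ∪ y.1 = vertsOf T ∪ y.1 ∪ x.1 := by
      ext v; simp only [mem_union]; tauto
    rw [this]
  · rfl

theorem Mm_clq_right (d : ℕ) (G : Graph n) (v : ℕ) (x y : PR n) (hy : ¬ Clq G y.1) :
    Mm d G v x y = 0 := by
  rw [Mm_symm]; exact Mm_clq_left d G v y x hy

theorem Gam_clq (d : ℕ) (G : Graph n) (w : ℕ) (x y : PR n) (hx : ¬ Clq G x.1) (hy : Clq G y.1) :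
    Gam d G w x y = 0 := by
  obtain ⟨e, he, hG⟩ := not_clq hx
  have hne : ∃ v ∈ (e : Sym2 (Fin n)), v ∉ y.1 := by
    by_contra hcon
    push Not at hcon
    rw [hy e hcon] at hG
    exact absurd hG (by simp)
  obtain ⟨v, hv, hvy⟩ := hne
  have : sumChi G (GC d x y w) = 0 := by
    apply sumChi_toggle G _ e hG
    rintro T ⟨h1, ⟨h2, h3, h4⟩, h5, h6⟩
    refine ⟨?_, ⟨h2, ⟨?_, ?_⟩, ?_⟩, ?_, ?_⟩
    · intro S hS
      exact h1 S ((sep_toggle_iff he).1 hS)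
    · intro S hS
      exact h3.1 S ((sep_toggle_iff he).1 hS)
    · intro f hf
      rw [reach_toggle he]
      simp only [Finset.mem_symmDiff, mem_singleton] at hf
      rcases hf with ⟨a, _⟩ | ⟨rfl, _⟩
      · exact h3.2 f a
      · exact ⟨v, hv, (closed_reach T x.1 y.1).1 v (he v hv) hvy⟩
    · rwa [verts_toggle he]
    · rwa [verts_toggle he]
    · rwa [verts_toggle he]
  unfold Gam
  rw [this, mul_zero]

theorem Hm_clq_left (d : ℕ) (G : Graph n) (w : ℕ) (x y : PR n) (hx : ¬ Clq G x.1) :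
    Hm d G w x y = 0 := by
  obtain ⟨e, he, hG⟩ := not_clq hx
  have he' : ∀ v ∈ (e : Sym2 (Fin n)), v ∈ x.1 ∪ x.2 := fun v hv => mem_union_left _ (he v hv)
  have : sumChi G (HC d x y w) = 0 := by
    apply sumChi_toggle G _ e hG
    rintro T ⟨h1, ⟨h2, h3, h4⟩, h5, h6⟩
    refine ⟨?_, ⟨h2, ?_, ?_⟩, ?_, ?_⟩
    · intro S hS
      exact h1 S ((sep_toggle_iff' he').1 hS)
    · intro S hS
      exact h3 S ((sep_toggle_iff he).1 hS)
    · rwa [verts_toggle he]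
    · rwa [verts_toggle he]
    · have e1 : ∀ Z : Finset (Fin n), Z ∪ y.1 ∪ (x.1 ∪ x.2) = (Z ∪ (x.1 ∪ x.2)) ∪ y.1 := by
        intro Z; ext v; simp only [mem_union]; tauto
      rwa [e1, verts_toggle he', ← e1]
  unfold Hm
  rw [this, mul_zero, mul_zero]

theorem Hm_clq_right (d : ℕ) (G : Graph n) (w : ℕ) (x y : PR n) (hy : ¬ Clq G y.1) :
    Hm d G w x y = 0 := by
  obtain ⟨e, he, hG⟩ := not_clq hy
  have : sumChi G (HC d x y w) = 0 := by
    apply sumChi_toggle G _ e hG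
    rintro T ⟨h1, ⟨h2, h3, h4⟩, h5, h6⟩
    have e1 : ∀ Z : Finset (Fin n), Z ∪ x.1 ∪ y.1 = (Z ∪ y.1) ∪ x.1 := by
      intro Z; ext v; simp only [mem_union]; tauto
    refine ⟨?_, ⟨h2, ?_, ?_⟩, ?_, ?_⟩
    · intro S hS
      exact h1 S ((sep_toggle_iff he).1 hS)
    · intro S hS
      exact h3 S ((sep_toggle_iff' he).1 hS)
    · rwa [e1, verts_toggle he, ← e1]
    · rwa [e1, verts_toggle he, ← e1]
    · rwa [verts_toggle he]
  unfold Hm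
  rw [this, mul_zero, mul_zero]

end toggles



section algebra
variable {R : Type*} [Ring R]

/-- the auxiliary series solving the recursion `y = π g + y (1-π) g`. -/
noncomputable def yS (π : R) (g : ℕ → R) (i : ℕ) : R :=
  PowerSeries.coeff i (PowerSeries.C π * PowerSeries.mk g *
    PowerSeries.invOfUnit (1 - PowerSeries.C (1 - π) * PowerSeries.mk g) 1)

theorem unit_aux (π : R) (g : ℕ → R) (h0 : (1 - π) * g 0 = 0) :
    PowerSeries.constantCoeff (1 - PowerSeries.C (1 - π) * PowerSeries.mk g) = ((1 : Rˣ) : R) := by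
  simp only [map_sub, map_mul, map_one, PowerSeries.constantCoeff_C, Units.val_one,
    PowerSeries.constantCoeff_mk]
  rw [h0, sub_zero]

theorem yS_series (π : R) (g : ℕ → R) (h0 : (1 - π) * g 0 = 0) :
    PowerSeries.mk (yS π g) = PowerSeries.C π * PowerSeries.mk g +
      PowerSeries.mk (yS π g) * (PowerSeries.C (1 - π) * PowerSeries.mk g) := by
  have hu := unit_aux π g h0
  have h1 : PowerSeries.mk (yS π g) = PowerSeries.C π * PowerSeries.mk g *
    PowerSeries.invOfUnit (1 - PowerSeries.C (1 - π) * PowerSeries.mk g) 1 := by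
    ext i
    rw [PowerSeries.coeff_mk]
    rfl
  have h2 : PowerSeries.mk (yS π g) * (1 - PowerSeries.C (1 - π) * PowerSeries.mk g) =
      PowerSeries.C π * PowerSeries.mk g := by
    rw [h1, mul_assoc, PowerSeries.invOfUnit_mul _ _ hu, mul_one]
  rw [← h2]
  noncomm_ring

theorem yS_rec (π : R) (g : ℕ → R) (h0 : (1 - π) * g 0 = 0) (i : ℕ) :
    yS π g i = π * g i + ∑ p ∈ antidiagonal i, yS π g p.1 * ((1 - π) * g p.2) := by
  have := congrArg (PowerSeries.coeff i) (yS_series π g h0)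
  rw [map_add, PowerSeries.coeff_mul _ (PowerSeries.mk (yS π g)), PowerSeries.coeff_C_mul] at this
  simpa only [PowerSeries.coeff_mk, PowerSeries.coeff_C_mul] using this

theorem lh_yS (π : R) (g lh : ℕ → R) (h0 : (1 - π) * g 0 = 0) (hπ : π * π = π)
    (hL : ∀ i, lh i = ∑ p ∈ antidiagonal i, lh p.1 * g p.2) (i : ℕ) :
    lh i = ∑ p ∈ antidiagonal i, (lh p.1 * π) * yS π g p.2 := by
  have hu := unit_aux π g h0
  have e1 : PowerSeries.mk lh = PowerSeries.mk lh * PowerSeries.mk g := by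
    ext i
    rw [PowerSeries.coeff_mul]
    simpa using hL i
  have e2 : PowerSeries.mk lh * (1 - PowerSeries.C (1 - π) * PowerSeries.mk g) =
      PowerSeries.mk lh * PowerSeries.C π * (PowerSeries.C π * PowerSeries.mk g) := by
    have e3 : (PowerSeries.C π * (PowerSeries.C π * PowerSeries.mk g) : PowerSeries R) =
       PowerSeries.C π * PowerSeries.mk g := by
      rw [← mul_assoc, ← map_mul, hπ]
    rw [mul_assoc, e3, map_sub, map_one]
    calc _ = PowerSeries.mk lh - PowerSeries.mk lh * PowerSeries.mk g +
        PowerSeries.mk lh * (PowerSeries.C π * PowerSeries.mk g) := by noncomm_ring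
      _ = _ := by rw [← e1]; simp
  have e4 : PowerSeries.mk lh = PowerSeries.mk lh * PowerSeries.C π * PowerSeries.mk (yS π g) := by
    have h1 : PowerSeries.mk (yS π g) = PowerSeries.C π * PowerSeries.mk g *
      PowerSeries.invOfUnit (1 - PowerSeries.C (1 - π) * PowerSeries.mk g) 1 := by
      ext i
      rw [PowerSeries.coeff_mk]
      rfl
    rw [h1, ← mul_assoc, ← e2, mul_assoc, PowerSeries.mul_invOfUnit _ _ hu, mul_one]
  have := congrArg (PowerSeries.coeff i) e4
  rw [PowerSeries.coeff_mul] at this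
  simpa using this

theorem yS_proj (π Pi : R) (g : ℕ → R) (h0 : (1 - π) * g 0 = 0)
    (hc : π * Pi = Pi * π) (hg : ∀ i, g i * Pi = Pi * g i * Pi) (i : ℕ) :
    yS π g i * Pi = Pi * yS π g i * Pi := by
  induction i using Nat.strong_induction_on with
  | _ i ih =>
    rw [yS_rec π g h0 i]
    have e1 : π * g i * Pi = Pi * (π * g i) * Pi := by
      rw [mul_assoc, hg, ← mul_assoc, ← mul_assoc, hc]; noncomm_ring
    have e2 : ∀ p ∈ antidiagonal i, yS π g p.1 * ((1 - π) * g p.2) * Pi =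
        Pi * (yS π g p.1 * ((1 - π) * g p.2)) * Pi := by
      intro p hp
      rw [HasAntidiagonal.mem_antidiagonal] at hp
      by_cases h : p.2 = 0
      · rw [h, h0]; simp
      · have ihp := ih p.1 (by omega)
        have hc' : (1 - π) * Pi = Pi * (1 - π) := by
          rw [sub_mul, mul_sub, hc]; simp
        calc yS π g p.1 * ((1 - π) * g p.2) * Pi = yS π g p.1 * (1 - π) * (g p.2 * Pi) := by noncomm_ring
          _ = yS π g p.1 * ((1 - π) * Pi) * (g p.2 * Pi) := by
            conv_lhs => rw [hg p.2]
            noncomm_ring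
          _ = (yS π g p.1 * Pi) * ((1 - π) * (g p.2 * Pi)) := by rw [hc']; noncomm_ring
          _ = Pi * (yS π g p.1 * (Pi * (1 - π)) * (g p.2 * Pi)) := by rw [ihp]; noncomm_ring
          _ = Pi * (yS π g p.1 * (1 - π) * (Pi * g p.2 * Pi)) := by rw [← hc']; noncomm_ring
          _ = _ := by rw [← hg p.2]; noncomm_ring
    rw [add_mul, mul_add, add_mul, e1, Finset.sum_mul, Finset.sum_congr rfl e2, Finset.mul_sum,
      Finset.sum_mul]

/-- the middle factor -/
noncomputable def xS [StarRing R] (π : R) (g h : ℕ → R) (e : ℕ) : R :=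
  ∑ p ∈ antidiagonal e, ∑ q ∈ antidiagonal p.2, yS π g p.1 * h q.1 * star (yS π g q.2)

theorem m_eq [StarRing R] (π : R) (g h lh nn m : ℕ → R) (h0 : (1 - π) * g 0 = 0) (hπ : π * π = π)
    (hL : ∀ i, lh i = ∑ p ∈ antidiagonal i, lh p.1 * g p.2)
    (hM : ∀ i, m i = ∑ p ∈ antidiagonal i, lh p.1 * nn p.2)
    (hN : ∀ i, nn i = ∑ p ∈ antidiagonal i, h p.1 * star (lh p.2)) (v : ℕ) :
    m v = ∑ p ∈ antidiagonal v, ∑ q ∈ antidiagonal p.2,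
      (lh p.1 * π) * xS π g h q.1 * star (lh q.2 * π) := by
  set l : PowerSeries R := PowerSeries.mk fun i => lh i * π with hl
  set y : PowerSeries R := PowerSeries.mk (yS π g) with hy
  set ls : PowerSeries R := PowerSeries.mk fun i => star (lh i * π)
  set ys : PowerSeries R := PowerSeries.mk fun i => star (yS π g i)
  set H : PowerSeries R := PowerSeries.mk h
  have e1 : PowerSeries.mk lh = l * y := by
    ext i
    rw [PowerSeries.coeff_mul]
    simpa [l, y] using lh_yS π g lh h0 hπ hL i
  have e2 : PowerSeries.mk (fun i => star (lh i)) = ys * ls := by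
    ext i
    rw [PowerSeries.coeff_mul, ← Finset.Nat.sum_antidiagonal_swap]
    simp only [ys, ls, PowerSeries.coeff_mk, Prod.swap, ← star_mul, ← star_sum]
    rw [lh_yS π g lh h0 hπ hL i]
  have e3 : PowerSeries.mk nn = H * PowerSeries.mk (fun i => star (lh i)) := by
    ext i
    rw [PowerSeries.coeff_mul]
    simpa [H] using hN i
  have e4 : PowerSeries.mk m = PowerSeries.mk lh * PowerSeries.mk nn := by
    ext i
    rw [PowerSeries.coeff_mul]
    simpa using hM i
  have e5 : PowerSeries.mk (xS π g h) = y * (H * ys) := by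
    ext i
    rw [PowerSeries.coeff_mul]
    simp only [PowerSeries.coeff_mul, xS, PowerSeries.coeff_mk, y, H, ys, Finset.mul_sum, mul_assoc]
  have e6 : PowerSeries.mk m = l * (PowerSeries.mk (xS π g h) * ls) := by
    rw [e4, e3, e2, e1, e5]; simp only [mul_assoc]
  have := congrArg (PowerSeries.coeff v) e6
  rw [PowerSeries.coeff_mul] at this
  simp only [PowerSeries.coeff_mul, PowerSeries.coeff_mk, l, ls, Finset.mul_sum] at this
  simpa only [mul_assoc] using this

theorem xS_proj [StarRing R] (π Pi : R) (g h : ℕ → R) (h0 : (1 - π) * g 0 = 0)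
    (hc : π * Pi = Pi * π) (hs : star Pi = Pi)
    (hg : ∀ i, g i * Pi = Pi * g i * Pi)
    (hh : ∀ i, h i = Pi * h i * Pi) (e : ℕ) : xS π g h e = Pi * xS π g h e * Pi := by
  unfold xS
  rw [Finset.mul_sum, Finset.sum_mul]
  refine Finset.sum_congr rfl fun p _ => ?_
  rw [Finset.mul_sum, Finset.sum_mul]
  refine Finset.sum_congr rfl fun q _ => ?_
  have e1 := yS_proj π Pi g h0 hc hg p.1
  have e2 : Pi * star (yS π g q.2) = Pi * star (yS π g q.2) * Pi := by
    have := congrArg star (yS_proj π Pi g h0 hc hg q.2)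
    simpa only [star_mul, hs, mul_assoc] using this
  have e3 : Pi * h q.1 * Pi = h q.1 := (hh q.1).symm
  calc yS π g p.1 * h q.1 * star (yS π g q.2)
      = (yS π g p.1 * Pi) * h q.1 * (Pi * star (yS π g q.2)) := by
        conv_lhs => rw [← e3]
        noncomm_ring
    _ = (Pi * yS π g p.1 * Pi) * h q.1 * (Pi * star (yS π g q.2) * Pi) := by rw [← e1, ← e2]
    _ = Pi * (yS π g p.1 * (Pi * h q.1 * Pi) * star (yS π g q.2)) * Pi := by noncomm_ring
    _ = _ := by rw [e3]

end algebra

section normed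
variable {R : Type*} [NormedRing R]

theorem yS_norm (π : R) (g : ℕ → R) (h0 : (1 - π) * g 0 = 0) (q : ℝ) (hq : 0 ≤ q)
    (hπ : ‖π‖ ≤ 1) (hπ' : ‖1 - π‖ ≤ 1) (τ : ℕ) (hg : ∀ w ≤ τ, ‖g w‖ ≤ q ^ w) (i : ℕ) (hi : i ≤ τ) :
    ‖yS π g i‖ ≤ (2 * q) ^ i := by
  induction i using Nat.strong_induction_on with
  | _ i ih =>
    rw [yS_rec π g h0 i]
    have e1 : ‖π * g i‖ ≤ q ^ i := by
      calc _ ≤ ‖π‖ * ‖g i‖ := norm_mul_le _ _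
        _ ≤ 1 * q ^ i := by gcongr; exact hg i hi
        _ = _ := one_mul _
    have e2 : ∀ p ∈ antidiagonal i, ‖yS π g p.1 * ((1 - π) * g p.2)‖ ≤
        if p.2 = 0 then 0 else 2 ^ p.1 * q ^ i := by
      intro p hp
      rw [HasAntidiagonal.mem_antidiagonal] at hp
      split_ifs with h
      · rw [h, h0]; simp
      · have ihp := ih p.1 (by omega) (by omega)
        calc _ ≤ ‖yS π g p.1‖ * (‖1 - π‖ * ‖g p.2‖) :=
              (norm_mul_le _ _).trans (by gcongr; exact norm_mul_le _ _)
          _ ≤ (2 * q) ^ p.1 * (1 * q ^ p.2) := by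
              gcongr
              exact hg _ (by omega)
          _ = _ := by rw [← hp, mul_pow, pow_add]; ring
    have e3 : ∑ p ∈ antidiagonal i, (if p.2 = 0 then 0 else 2 ^ p.1 * q ^ i) = (2 ^ i - 1) * q ^ i := by
      rw [Finset.Nat.sum_antidiagonal_eq_sum_range_succ_mk, Finset.sum_range_succ]
      simp only [Nat.sub_self, if_true, add_zero]
      rw [Finset.sum_congr rfl (g := fun k => 2 ^ k * q ^ i)]
      · rw [← Finset.sum_mul]
        congr 1
        have := geom_sum_eq (x := (2 : ℝ)) (by norm_num) i
        rw [this]; norm_num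
      · intro k hk
        rw [mem_range] at hk
        rw [if_neg]; omega
    calc _ ≤ ‖π * g i‖ + ∑ p ∈ antidiagonal i, ‖yS π g p.1 * ((1 - π) * g p.2)‖ :=
          (norm_add_le _ _).trans (by gcongr; exact norm_sum_le _ _)
      _ ≤ q ^ i + (2 ^ i - 1) * q ^ i := by
          gcongr
          rw [← e3]
          exact Finset.sum_le_sum e2
      _ = _ := by rw [mul_pow]; ring

end normed



section walks
variable {κ : Type*} [Fintype κ]

theorem pow_walk (M : Matrix κ κ ℝ) (m : ℕ) (a b : κ) :
    (M ^ m) a b = ∑ x : Fin (m + 1) → κ, if x 0 = a ∧ x (Fin.last m) = b then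
      ∏ t : Fin m, M (x t.castSucc) (x t.succ) else 0 := by
  induction m generalizing a with
  | zero =>
    rw [pow_zero, Matrix.one_apply]
    have : ∀ x : Fin 1 → κ, x = fun _ => x 0 := by
      intro x; ext i; fin_cases i; rfl
    rw [← Equiv.sum_comp (Equiv.funUnique (Fin 1) κ).symm]
    simp only [Fin.isValue, univ_eq_empty, prod_empty]
    by_cases h : a = b
    · subst h
      rw [if_pos rfl, Finset.sum_eq_single a]
      · rw [if_pos]; exact ⟨rfl, rfl⟩
      · intro c _ hc
        rw [if_neg]
        rintro ⟨h1, _⟩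
        exact hc h1
      · simp
    · rw [if_neg h]
      symm
      refine Finset.sum_eq_zero fun c _ => ?_
      rw [if_neg]
      rintro ⟨h1, h2⟩
      exact h (h1.symm.trans h2)
  | succ m ih =>
    rw [pow_succ', Matrix.mul_apply, ← Equiv.sum_comp (Fin.consEquiv (fun _ : Fin (m + 2) => κ)),
      Fintype.sum_prod_type]
    symm
    rw [Finset.sum_eq_single a]
    · symm
      simp only [Fin.consEquiv, Equiv.coe_fn_mk, Fin.cons_zero, true_and]
      simp only [ih, Finset.mul_sum]
      rw [Finset.sum_comm]
      refine Finset.sum_congr rfl fun x _ => ?_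
      rw [Finset.sum_eq_single (x 0)]
      · rw [Fin.prod_univ_succ]
        have hl : (Fin.cons a x : Fin (m + 2) → κ) (Fin.last (m + 1)) = x (Fin.last m) := by
          rw [← Fin.succ_last, Fin.cons_succ]
        rw [hl]
        by_cases h : x (Fin.last m) = b
        · simp [h]
        · simp [h]
      · intro c _ hc
        rw [if_neg, mul_zero]
        rintro ⟨h, _⟩
        exact hc h.symm
      · simp
    · intro c _ hc
      refine Finset.sum_eq_zero fun x _ => ?_
      rw [if_neg]
      rintro ⟨h, _⟩
      exact hc h
    · simp

theorem trace_walk (M : Matrix κ κ ℝ) (m : ℕ) :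
    Matrix.trace (M ^ m) = ∑ x : Fin (m + 1) → κ, if x 0 = x (Fin.last m) then
      ∏ t : Fin m, M (x t.castSucc) (x t.succ) else 0 := by
  unfold Matrix.trace
  simp only [Matrix.diag_apply, pow_walk]
  rw [Finset.sum_comm]
  refine Finset.sum_congr rfl fun x _ => ?_
  rw [Finset.sum_eq_single (x 0)]
  · by_cases h : x 0 = x (Fin.last m)
    · rw [if_pos ⟨rfl, h.symm⟩, if_pos h]
    · rw [if_neg (fun h' => h h'.2.symm), if_neg h]
  · intro c _ hc
    rw [if_neg]
    rintro ⟨h, _⟩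
    exact hc h.symm
  · simp

theorem trace_count (Q : Matrix κ κ ℝ) (hQ : ∀ x y, 0 ≤ Q x y) (S : Finset κ)
    (hS : ∀ x, x ∉ S → ∀ y, Q x y = 0) (D : ℝ) (hD : 0 ≤ D) (hrow : ∀ x, ∑ y, Q x y ≤ D)
    (m : ℕ) (hm : 0 < m) : Matrix.trace (Q ^ m) ≤ S.card * D ^ m := by
  have h1 : ∀ m x y, 0 ≤ (Q ^ m) x y := by
    intro m
    induction m with
    | zero => intro x y; rw [pow_zero, Matrix.one_apply]; split_ifs <;> norm_num
    | succ m ih =>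
      intro x y
      rw [pow_succ, Matrix.mul_apply]
      exact Finset.sum_nonneg fun z _ => mul_nonneg (ih x z) (hQ z y)
  have h2 : ∀ m x, ∑ y, (Q ^ m) x y ≤ D ^ m := by
    intro m
    induction m with
    | zero => intro x; simp [Matrix.one_apply]
    | succ m ih =>
      intro x
      simp only [pow_succ, Matrix.mul_apply]
      rw [Finset.sum_comm]
      calc _ = ∑ z, (Q ^ m) x z * ∑ y, Q z y := by simp only [Finset.mul_sum]
        _ ≤ ∑ z, (Q ^ m) x z * D := Finset.sum_le_sum fun z _ => by
            gcongr
            · exact h1 m x z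
            · exact hrow z
        _ = (∑ z, (Q ^ m) x z) * D := by rw [Finset.sum_mul]
        _ ≤ _ := by gcongr; exact ih x
  have h3 : ∀ x, x ∉ S → ∀ y, (Q ^ m) x y = 0 := by
    intro x hx y
    obtain ⟨k, rfl⟩ : ∃ k, m = k + 1 := ⟨m - 1, by omega⟩
    rw [pow_succ', Matrix.mul_apply]
    exact Finset.sum_eq_zero fun z _ => by rw [hS x hx, zero_mul]
  unfold Matrix.trace
  simp only [Matrix.diag_apply]
  rw [← Finset.sum_subset (Finset.subset_univ S) (fun x _ hx => h3 x hx x)]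
  calc _ ≤ ∑ x ∈ S, D ^ m := Finset.sum_le_sum fun x _ =>
        (Finset.single_le_sum (fun y _ => h1 m x y) (mem_univ x)).trans (h2 m x)
    _ = _ := by simp

end walks

section vertexcount
variable {n : ℕ}

theorem union_bound {m : ℕ} (T : Fin m → Finset (Edge n)) (U : Fin (m + 1) → Finset (Fin n))
    (v s : ℕ) (hs : s ≤ v)
    (hv : ∀ t : Fin m, (vertsOf (T t) ∪ U t.castSucc ∪ U t.succ).card = v)
    (hsep : ∀ t : Fin m, ∀ S, Sep (T t) (U t.castSucc) (U t.succ) S → s ≤ S.card)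
    (hgood : ∀ t, ∀ e ∈ T t, ∃ t', t' ≠ t ∧ e ∈ T t') :
    2 * (Finset.univ.biUnion fun t : Fin m => vertsOf (T t) ∪ U t.castSucc ∪ U t.succ).card ≤
      m * (v - s) + 4 * v := by
  set W : Fin m → Finset (Fin n) := fun t => vertsOf (T t) ∪ U t.castSucc ∪ U t.succ with hW
  set F : Fin m → Finset (Fin n) := fun t => (W t).filter fun a => ∃ t', t' < t ∧ a ∈ W t' with hF
  set L : Fin m → Finset (Fin n) := fun t => (W t).filter fun a => ∃ t', t < t' ∧ a ∈ W t' with hL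
  have hnew : (Finset.univ.biUnion W) ⊆ Finset.univ.biUnion fun t => W t \ F t := by
    intro a ha
    simp only [mem_biUnion, mem_univ, true_and] at ha ⊢
    obtain ⟨t0, h0⟩ := ha
    have hne : (Finset.univ.filter fun t => a ∈ W t).Nonempty := ⟨t0, by simp [h0]⟩
    refine ⟨(Finset.univ.filter fun t => a ∈ W t).min' hne, ?_⟩
    have hmem := Finset.min'_mem _ hne
    rw [mem_filter] at hmem
    rw [mem_sdiff]
    refine ⟨hmem.2, ?_⟩
    intro hf
    rw [hF, mem_filter] at hf
    obtain ⟨_, t', ht', hat'⟩ := hf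
    have := Finset.min'_le _ t' (show t' ∈ Finset.univ.filter (fun t => a ∈ W t) from by
      simp [hat'])
    exact absurd ht' (not_lt.2 this)
  have hlast : (Finset.univ.biUnion W) ⊆ Finset.univ.biUnion fun t => W t \ L t := by
    intro a ha
    simp only [mem_biUnion, mem_univ, true_and] at ha ⊢
    obtain ⟨t0, h0⟩ := ha
    have hne : (Finset.univ.filter fun t => a ∈ W t).Nonempty := ⟨t0, by simp [h0]⟩
    refine ⟨(Finset.univ.filter fun t => a ∈ W t).max' hne, ?_⟩
    have hmem := Finset.max'_mem _ hne
    rw [mem_filter] at hmem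
    rw [mem_sdiff]
    refine ⟨hmem.2, ?_⟩
    intro hf
    rw [hL, mem_filter] at hf
    obtain ⟨_, t', ht', hat'⟩ := hf
    have := Finset.le_max' _ t' (show t' ∈ Finset.univ.filter (fun t => a ∈ W t) from by
      simp [hat'])
    exact absurd ht' (not_lt.2 this)
  have h1 : (Finset.univ.biUnion W).card ≤ ∑ t, (W t \ F t).card :=
    (card_le_card hnew).trans card_biUnion_le
  have h2 : (Finset.univ.biUnion W).card ≤ ∑ t, (W t \ L t).card :=
    (card_le_card hlast).trans card_biUnion_le
  have hvW : ∀ t (e : Edge n), e ∈ T t → ∀ a ∈ (e : Sym2 (Fin n)), a ∈ W t := by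
    intro t e he a ha
    simp only [hW, mem_union, mem_vertsOf]
    exact Or.inl (Or.inl ⟨e, he, ha⟩)
  have hedge : ∀ t, ∀ e ∈ T t, (∀ a ∈ (e : Sym2 (Fin n)), a ∈ F t) ∨
      (∀ a ∈ (e : Sym2 (Fin n)), a ∈ L t) := by
    intro t e he
    obtain ⟨t', hne, he'⟩ := hgood t e he
    rcases lt_or_gt_of_ne hne with hlt | hlt
    · left
      intro a ha
      exact mem_filter.2 ⟨hvW t e he a ha, t', hlt, hvW t' e he' a ha⟩
    · right
      intro a ha
      exact mem_filter.2 ⟨hvW t e he a ha, t', hlt, hvW t' e he' a ha⟩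
  have h_inner : ∀ t : Fin m, 0 < t.val → t.val + 1 < m → (W t \ F t).card + (W t \ L t).card ≤ v - s := by
    intro t ht0 ht1
    have hUF : U t.castSucc ⊆ F t := by
      intro a ha
      refine mem_filter.2 ⟨?_, ⟨t.val - 1, by omega⟩, ?_, ?_⟩
      · simp only [hW, mem_union]; exact Or.inl (Or.inr ha)
      · rw [Fin.lt_def]; simp only; omega
      · simp only [hW, mem_union]
        right
        have : (⟨t.val - 1, by omega⟩ : Fin m).succ = t.castSucc := by
          apply Fin.ext; simp only [Fin.val_succ, Fin.val_castSucc]; omega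
        rw [this]; exact ha
    have hUL : U t.succ ⊆ L t := by
      intro a ha
      refine mem_filter.2 ⟨?_, ⟨t.val + 1, by omega⟩, ?_, ?_⟩
      · simp only [hW, mem_union]; exact Or.inr ha
      · rw [Fin.lt_def]; simp only; omega
      · simp only [hW, mem_union]
        left; right
        have : (⟨t.val + 1, by omega⟩ : Fin m).castSucc = t.succ := by
          apply Fin.ext; simp only [Fin.val_succ, Fin.val_castSucc]
        rw [this]; exact ha
    have hFL : F t ∪ L t = W t := by
      apply subset_antisymm
      · exact union_subset (filter_subset _ _) (filter_subset _ _)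
      · intro a ha
        simp only [hW, mem_union, mem_vertsOf] at ha
        rw [mem_union]
        rcases ha with (⟨e, he, hae⟩ | ha) | ha
        · rcases hedge t e he with h | h
          · exact Or.inl (h a hae)
          · exact Or.inr (h a hae)
        · exact Or.inl (hUF ha)
        · exact Or.inr (hUL ha)
    have hS := hsep t (F t ∩ L t) ⟨F t \ L t, ⟨?_, ?_, ?_⟩, ?_⟩
    · have c1 := card_union_add_card_inter (F t) (L t)
      rw [hFL] at c1
      have c2 := card_sdiff_add_card_eq_card (s := F t) (t := W t) (filter_subset _ _)
      have c3 := card_sdiff_add_card_eq_card (s := L t) (t := W t) (filter_subset _ _)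
      have c4 : (W t).card = v := hv t
      omega
    · intro a ha hn
      have := hUF ha
      simp only [mem_inter, mem_sdiff] at hn ⊢
      tauto
    · intro a ha
      simp only [mem_inter, mem_sdiff] at ha ⊢
      tauto
    · intro e he a ha b hb haX hbS
      rcases hedge t e he with h | h
      · have := h b hb
        simp only [mem_inter, mem_sdiff] at hbS ⊢
        tauto
      · have := h a ha
        simp only [mem_sdiff] at haX
        tauto
    · intro a ha ha'
      have := hUL ha'
      simp only [mem_sdiff] at ha
      tauto
  have hall : ∀ t : Fin m, (W t \ F t).card + (W t \ L t).card ≤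
      (v - s) + ((if t.val = 0 then 2 * v else 0) + (if t.val = m - 1 then 2 * v else 0)) := by
    intro t
    have c2 := card_le_card (sdiff_subset (s := W t) (t := F t))
    have c3 := card_le_card (sdiff_subset (s := W t) (t := L t))
    have c4 : (W t).card = v := hv t
    have := t.isLt
    split_ifs with ha hb hb
    · omega
    · omega
    · omega
    · have := h_inner t (by omega) (by omega)
      omega
  have hsum := Finset.sum_le_sum fun t (_ : t ∈ (Finset.univ : Finset (Fin m))) => hall t
  rw [Finset.sum_add_distrib, Finset.sum_add_distrib, Finset.sum_add_distrib] at hsum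
  have hz : ∀ k : ℕ, ∑ t : Fin m, (if t.val = k then 2 * v else 0) ≤ 2 * v := by
    intro k
    by_cases hk : k < m
    · rw [Finset.sum_eq_single (⟨k, hk⟩ : Fin m)]
      · simp
      · intro t _ ht
        rw [if_neg]
        intro h
        exact ht (Fin.ext h)
      · simp
    · rw [Finset.sum_eq_zero]
      · omega
      · intro t _
        rw [if_neg]
        have := t.isLt
        omega
  have h3 := hz 0
  have h4 := hz (m - 1)
  simp only [Finset.sum_const, card_univ, Fintype.card_fin, smul_eq_mul] at hsum
  omega

theorem exists_cover (hn : 0 < n) (N : ℕ) (U : Finset (Fin n)) (h : U.card ≤ N) :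
    ∃ g : Fin N → Fin n, U ⊆ Finset.univ.image g := by
  classical
  let e := U.equivFin
  refine ⟨fun i => if hi : i.val < U.card then (e.symm ⟨i.val, hi⟩ : Fin n) else ⟨0, hn⟩, ?_⟩
  intro a ha
  rw [mem_image]
  have hlt := (e ⟨a, ha⟩).isLt
  refine ⟨⟨(e ⟨a, ha⟩).val, by omega⟩, mem_univ _, ?_⟩
  simp

end vertexcount

section expectation
variable {n : ℕ}

theorem edgeSign_sq (G : Graph n) (e : Edge n) : |edgeSign G e| = 1 := by
  unfold edgeSign; split_ifs <;> simp

theorem abs_chi (G : Graph n) (T : Finset (Edge n)) : |chi G T| = 1 := by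
  unfold chi
  rw [Finset.abs_prod]
  exact Finset.prod_eq_one fun e _ => edgeSign_sq G e

theorem chi_flip (G : Graph n) (e : Edge n) (T : Finset (Edge n)) :
    chi (Function.update G e (!(G e))) T = if e ∈ T then - chi G T else chi G T := by
  unfold chi
  have hs : ∀ f, f ≠ e → edgeSign (Function.update G e (!(G e))) f = edgeSign G f := by
    intro f hf
    simp [edgeSign, Function.update_of_ne hf]
  have hse : edgeSign (Function.update G e (!(G e))) e = - edgeSign G e := by
    simp only [edgeSign, Function.update_self]
    cases G e <;> simp
  split_ifs with h
  · rw [← Finset.mul_prod_erase T _ h, ← Finset.mul_prod_erase T _ h, hse]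
    rw [Finset.prod_congr rfl fun f hf => hs f (Finset.ne_of_mem_erase hf)]
    ring
  · refine Finset.prod_congr rfl fun f hf => hs f ?_
    rintro rfl
    exact h hf

theorem sum_prod_chi_le {m : ℕ} (T : Fin m → Finset (Edge n)) :
    ∑ G : Graph n, ∏ t, chi G (T t) ≤
      if (∀ t, ∀ e ∈ T t, ∃ t', t' ≠ t ∧ e ∈ T t') then (Fintype.card (Graph n) : ℝ) else 0 := by
  split_ifs with h
  · calc _ ≤ ∑ G : Graph n, (1 : ℝ) := Finset.sum_le_sum fun G _ => by
          refine (le_abs_self _).trans ?_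
          rw [Finset.abs_prod]
          exact (Finset.prod_eq_one fun t _ => abs_chi G (T t)).le
      _ = _ := by simp
  · push Not at h
    obtain ⟨t, e, he, hne⟩ := h
    have key : ∑ G : Graph n, ∏ t, chi G (T t) = - ∑ G : Graph n, ∏ t, chi G (T t) := by
      have hinv : ∀ G : Graph n, Function.update (Function.update G e (!(G e))) e
          (!((Function.update G e (!(G e))) e)) = G := by
        intro G
        simp
      let σ : Equiv.Perm (Graph n) := ⟨fun G => Function.update G e (!(G e)),
        fun G => Function.update G e (!(G e)), hinv, hinv⟩
      conv_lhs => rw [← Equiv.sum_comp σ]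
      rw [← Finset.sum_neg_distrib]
      refine Finset.sum_congr rfl fun G _ => ?_
      have : ∀ t', chi (σ G) (T t') = if t' = t then - chi G (T t') else chi G (T t') := by
        intro t'
        have h1 : σ G = Function.update G e (!(G e)) := rfl
        rw [h1, chi_flip]
        by_cases ht : t' = t
        · subst ht
          rw [if_pos he, if_pos rfl]
        · rw [if_neg (hne t' ht), if_neg ht]
      simp only [this]
      rw [← Finset.mul_prod_erase univ _ (mem_univ t), ← Finset.mul_prod_erase univ _ (mem_univ t),
        if_pos rfl, Finset.prod_congr rfl fun f hf => if_neg (Finset.ne_of_mem_erase hf)]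
      ring
    linarith

noncomputable def cMat {κ : Type*} (G : Graph n) (c : κ → κ → Finset (Finset (Edge n))) :
    Matrix κ κ ℝ := fun x y => ∑ T ∈ c x y, chi G T

/-- main trace-moment estimate for symmetric classes -/
theorem trace_moment {κ : Type*} [Fintype κ] (hn : 0 < n) (U : κ → Finset (Fin n))
    (c : κ → κ → Finset (Finset (Edge n))) (v s m N K : ℕ) (D : ℝ) (hs : s ≤ v) (hm : 0 < m)
    (hN : m * (v - s) + 4 * v ≤ 2 * N)
    (hv : ∀ x y, ∀ T ∈ c x y, (vertsOf T ∪ U x ∪ U y).card = v)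
    (hsep : ∀ x y, ∀ T ∈ c x y, ∀ S, Sep T (U x) (U y) S → s ≤ S.card)
    (hD0 : 0 ≤ D)
    (hD : ∀ Ω : Finset (Fin n), Ω.card ≤ N → ∀ x,
      ∑ y, (((c x y).filter fun T => vertsOf T ∪ U x ∪ U y ⊆ Ω).card : ℝ) ≤ D)
    (hK : ∀ Ω : Finset (Fin n), Ω.card ≤ N →
      (Finset.univ.filter fun x => U x ⊆ Ω ∧ ∃ y, (c x y).Nonempty).card ≤ K) :
    ∑ G : Graph n, Matrix.trace (cMat G c ^ m) ≤
      Fintype.card (Graph n) * ((n : ℝ) ^ N * (K * D ^ m)) := by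
  have h1 : ∀ G : Graph n, Matrix.trace (cMat G c ^ m) =
      ∑ x : Fin (m + 1) → κ, ∑ T ∈ Fintype.piFinset (fun t : Fin m => c (x t.castSucc) (x t.succ)),
        if x 0 = x (Fin.last m) then ∏ t, chi G (T t) else 0 := by
    intro G
    rw [trace_walk]
    refine Finset.sum_congr rfl fun x _ => ?_
    split_ifs with h
    · simp only [cMat]
      rw [Finset.prod_univ_sum]
    · simp
  set Q : (Fin N → Fin n) → Matrix κ κ ℝ := fun g x y =>
    ∑ T ∈ c x y, if vertsOf T ∪ U x ∪ U y ⊆ Finset.univ.image g then (1 : ℝ) else 0 with hQ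
  have h2 : ∀ g, Matrix.trace (Q g ^ m) =
      ∑ x : Fin (m + 1) → κ, ∑ T ∈ Fintype.piFinset (fun t : Fin m => c (x t.castSucc) (x t.succ)),
        if x 0 = x (Fin.last m) then ∏ t, (if vertsOf (T t) ∪ U (x t.castSucc) ∪ U (x t.succ) ⊆
          Finset.univ.image g then (1 : ℝ) else 0) else 0 := by
    intro g
    rw [trace_walk]
    refine Finset.sum_congr rfl fun x _ => ?_
    split_ifs with h
    · simp only [hQ]
      rw [Finset.prod_univ_sum]
    · simp
  have hQe : ∀ g x y, Q g x y = (((c x y).filter fun T => vertsOf T ∪ U x ∪ U y ⊆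
      Finset.univ.image g).card : ℝ) := by
    intro g x y
    simp only [hQ]
    rw [Finset.sum_boole]
  have h3 : ∀ g, Matrix.trace (Q g ^ m) ≤ K * D ^ m := by
    intro g
    have hc : (Finset.univ.image g).card ≤ N := by
      simpa using (Finset.card_image_le (s := (Finset.univ : Finset (Fin N))) (f := g))
    refine (trace_count (Q g) ?_ (Finset.univ.filter fun x => U x ⊆ Finset.univ.image g ∧
      ∃ y, (c x y).Nonempty) ?_ D hD0 ?_ m hm).trans ?_
    · intro x y; rw [hQe]; positivity
    · intro x hx y
      rw [hQe, Finset.filter_eq_empty_iff.2]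
      · simp
      · intro T hT hsub
        apply hx
        refine mem_filter.2 ⟨mem_univ _, ?_, y, T, hT⟩
        refine Subset.trans ?_ hsub
        intro a ha
        simp [ha]
    · intro x
      simp only [hQe]
      exact hD _ hc x
    · gcongr
      exact hK _ hc
  calc _ = ∑ x : Fin (m + 1) → κ,
        ∑ T ∈ Fintype.piFinset (fun t : Fin m => c (x t.castSucc) (x t.succ)),
        if x 0 = x (Fin.last m) then ∑ G : Graph n, ∏ t, chi G (T t) else 0 := by
        rw [Finset.sum_congr rfl fun G _ => h1 G, Finset.sum_comm]
        refine Finset.sum_congr rfl fun x _ => ?_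
        rw [Finset.sum_comm]
        refine Finset.sum_congr rfl fun T _ => ?_
        split_ifs <;> simp
    _ ≤ ∑ x : Fin (m + 1) → κ,
        ∑ T ∈ Fintype.piFinset (fun t : Fin m => c (x t.castSucc) (x t.succ)),
        ∑ g : Fin N → Fin n, (Fintype.card (Graph n) : ℝ) *
        if x 0 = x (Fin.last m) then ∏ t, (if vertsOf (T t) ∪ U (x t.castSucc) ∪ U (x t.succ) ⊆
          Finset.univ.image g then (1 : ℝ) else 0) else 0 := by
        refine Finset.sum_le_sum fun x _ => Finset.sum_le_sum fun T hT => ?_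
        rw [Fintype.mem_piFinset] at hT
        by_cases hx : x 0 = x (Fin.last m)
        · simp only [if_pos hx]
          refine (sum_prod_chi_le T).trans ?_
          have hnn : ∀ g : Fin N → Fin n, 0 ≤ (Fintype.card (Graph n) : ℝ) * ∏ t : Fin m,
            (if vertsOf (T t) ∪ U (x t.castSucc) ∪ U (x t.succ) ⊆
            Finset.univ.image g then (1 : ℝ) else 0) := by
            intro g
            refine mul_nonneg (by positivity) (Finset.prod_nonneg fun t _ => ?_)
            split_ifs <;> norm_num
          split_ifs with hg
          · have hub := union_bound T (fun t => U (x t)) v s hs (fun t => hv _ _ _ (hT t))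
              (fun t => hsep _ _ _ (hT t)) hg
            obtain ⟨g, hgc⟩ := exists_cover hn N
              (Finset.univ.biUnion fun t => vertsOf (T t) ∪ U (x t.castSucc) ∪ U (x t.succ))
              (by omega)
            refine le_trans ?_ (Finset.single_le_sum (fun g _ => hnn g) (mem_univ g))
            rw [Finset.prod_eq_one, mul_one]
            intro t _
            rw [if_pos]
            exact (Finset.subset_biUnion_of_mem
              (fun t : Fin m => vertsOf (T t) ∪ U (x t.castSucc) ∪ U (x t.succ)) (mem_univ t)).trans hgc
          · exact Finset.sum_nonneg fun g _ => hnn g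
        · simp [if_neg hx]
    _ = ∑ g : Fin N → Fin n, (Fintype.card (Graph n) : ℝ) * Matrix.trace (Q g ^ m) := by
        simp only [h2, Finset.mul_sum]
        symm
        rw [Finset.sum_comm]
        refine Finset.sum_congr rfl fun x _ => ?_
        rw [Finset.sum_comm]
    _ ≤ ∑ g : Fin N → Fin n, (Fintype.card (Graph n) : ℝ) * (K * D ^ m) := by
        gcongr with g
        exact h3 g
    _ = _ := by
        rw [Finset.sum_const, card_univ, Fintype.card_fun, Fintype.card_fin, Fintype.card_fin]
        simp
        ring

end expectation



section norms
open scoped Matrix.Norms.L2Operator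
variable {κ : Type*} [Fintype κ] [DecidableEq κ]

theorem norm_sq_le_trace (A : Matrix κ κ ℝ) : ‖A‖ ^ 2 ≤ Matrix.trace (A * A.transpose) := by
  have htr : Matrix.trace (A * A.transpose) = ∑ i, ∑ j, A i j ^ 2 := by
    unfold Matrix.trace
    refine Finset.sum_congr rfl fun i _ => ?_
    rw [Matrix.diag_apply, Matrix.mul_apply]
    refine Finset.sum_congr rfl fun j _ => ?_
    rw [Matrix.transpose_apply]; ring
  rw [htr]
  have hnn : 0 ≤ ∑ i, ∑ j, A i j ^ 2 := by positivity
  have : ‖A‖ ≤ Real.sqrt (∑ i, ∑ j, A i j ^ 2) := by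
    rw [Matrix.l2_opNorm_def]
    refine ContinuousLinearMap.opNorm_le_bound _ (Real.sqrt_nonneg _) fun x => ?_
    rw [EuclideanSpace.norm_eq, EuclideanSpace.norm_eq, ← Real.sqrt_mul hnn]
    apply Real.sqrt_le_sqrt
    rw [Finset.sum_mul]
    refine Finset.sum_le_sum fun i _ => ?_
    have := Finset.sum_mul_sq_le_sq_mul_sq Finset.univ (fun j => A i j) (fun j => x j)
    simp only [Real.norm_eq_abs, sq_abs]
    refine le_trans (le_of_eq ?_) this
    rfl
  calc ‖A‖ ^ 2 ≤ (Real.sqrt (∑ i, ∑ j, A i j ^ 2)) ^ 2 := by gcongr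
    _ = _ := Real.sq_sqrt hnn

theorem norm_pow_le_trace (M : Matrix κ κ ℝ) (k : ℕ) :
    ‖M‖ ^ (2 ^ (k + 2)) ≤ Matrix.trace ((Matrix.fromBlocks 0 M M.transpose 0) ^ (2 ^ (k + 2))) := by
  set S := M * M.transpose with hS
  set S' := M.transpose * M with hS'
  have hsa : ∀ (X : Matrix κ κ ℝ), X.transpose = X → ∀ j, (X ^ j).transpose = X ^ j := by
    intro X hX j
    rw [Matrix.transpose_pow, hX]
  have hSt : S.transpose = S := by simp [hS]
  have hSt' : S'.transpose = S' := by simp [hS']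
  have h2 : (Matrix.fromBlocks 0 M M.transpose 0) ^ 2 = Matrix.fromBlocks S 0 0 S' := by
    rw [pow_two, Matrix.fromBlocks_multiply]
    simp [hS, hS']
  have hp : ∀ j, (Matrix.fromBlocks S 0 0 S') ^ j = Matrix.fromBlocks (S ^ j) 0 0 (S' ^ j) := by
    intro j
    induction j with
    | zero => simp
    | succ j ih =>
      rw [pow_succ, ih, Matrix.fromBlocks_multiply]
      simp [pow_succ]
  have e1 : (2 : ℕ) ^ (k + 2) = 2 * (2 ^ k * 2) := by ring
  have hnS : ‖S‖ = ‖M‖ ^ 2 := by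
    have := Matrix.l2_opNorm_conjTranspose_mul_self M.transpose
    have h3 : M.transpose.conjTranspose = M := by
      ext; simp [Matrix.conjTranspose]
    rw [h3] at this
    have h4 : ‖M.transpose‖ = ‖M‖ := by
      have := Matrix.l2_opNorm_conjTranspose M
      rw [← this]; congr 1
    rw [hS, this, h4, pow_two]
  have hnp : ‖S‖ ^ (2 ^ k) = ‖S ^ (2 ^ k)‖ := by
    have hs : IsSelfAdjoint S := by
      rw [isSelfAdjoint_iff]
      ext i j
      have := congrFun (congrFun hSt i) j
      simpa [Matrix.star_apply] using this
    have := hs.nnnorm_pow_two_pow k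
    have h5 := congrArg (fun t : NNReal => (t : ℝ)) this
    simpa using h5.symm
  have hfr := norm_sq_le_trace (S ^ 2 ^ k)
  have hfr' := norm_sq_le_trace (S' ^ 2 ^ k)
  rw [hsa _ hSt, ← pow_two, ← pow_mul] at hfr
  rw [hsa _ hSt', ← pow_two, ← pow_mul] at hfr'
  rw [e1, pow_mul _ 2, pow_mul _ 2, ← hnS, h2, hp, pow_mul, hnp]
  simp only [Matrix.trace, Matrix.diag_apply, Fintype.sum_sum_type, Matrix.fromBlocks_apply₁₁,
    Matrix.fromBlocks_apply₂₂] at hfr hfr' ⊢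
  have : 0 ≤ ‖S' ^ 2 ^ k‖ ^ 2 := by positivity
  linarith

end norms

section gm
open scoped Matrix.Norms.L2Operator
variable {n : ℕ}

/-- Class of shapes to which the norm bound applies. -/
structure GMC (c : PR n → PR n → Finset (Edge n) → Prop) (v s a b : ℕ) : Prop where
  ca : ∀ {x y T}, c x y T → x.1.card = a
  cb : ∀ {x y T}, c x y T → y.1.card = b
  cW : ∀ {x y T}, c x y T → (vertsOf T ∪ x.1 ∪ y.1).card = v
  cP : ∀ {x y T}, c x y T → x.2 ⊆ (vertsOf T ∪ x.1 ∪ y.1) \ x.1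
  cQ : ∀ {x y T}, c x y T → y.2 ⊆ (vertsOf T ∪ x.1 ∪ y.1) \ y.1
  csep : ∀ {x y T}, c x y T → ∀ S, Sep T (x.1 ∪ x.2) (y.1 ∪ y.2) S → s ≤ S.card
  cin : ∀ {x y T}, c x y T → ∀ e ∈ T, ∃ u ∈ (e : Sym2 (Fin n)), u ∉ x.1 ∩ y.1

theorem union_perm (X Y Z : Finset (Fin n)) : X ∪ Y ∪ Z = X ∪ Z ∪ Y := by
  ext; simp only [mem_union]; tauto

theorem GMC.swap {c : PR n → PR n → Finset (Edge n) → Prop} {v s a b : ℕ} (h : GMC c v s a b) :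
    GMC (fun x y T => c y x T) v s b a where
  ca := h.cb
  cb := h.ca
  cW := fun hc => by rw [union_perm]; exact h.cW hc
  cP := fun {x y T} hc => by rw [union_perm]; exact h.cQ hc
  cQ := fun hc => by rw [union_perm]; exact h.cP hc
  csep := fun hc S hS => h.csep hc S hS.symm
  cin := fun hc e he => by
    obtain ⟨u, hu, hu'⟩ := h.cin hc e he
    exact ⟨u, hu, by rwa [inter_comm]⟩

noncomputable def edgesTouch (R W : Finset (Fin n)) : Finset (Edge n) :=
  Finset.univ.filter fun e => ∃ p ∈ R ×ˢ W, (e : Sym2 (Fin n)) = s(p.1, p.2)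

theorem card_edgesTouch (R W : Finset (Fin n)) : (edgesTouch R W).card ≤ R.card * W.card := by
  rw [← card_product]
  have : (edgesTouch R W).image Subtype.val ⊆
      (R ×ˢ W).image (fun p => s(p.1, p.2)) := by
    intro e he
    rw [mem_image] at he ⊢
    obtain ⟨e', he', rfl⟩ := he
    obtain ⟨p, hp, hp'⟩ := (mem_filter.1 he').2
    exact ⟨p, hp, hp'.symm⟩
  rw [← card_image_of_injective _ Subtype.val_injective]
  exact (card_le_card this).trans card_image_le

theorem GMC.row {c : PR n → PR n → Finset (Edge n) → Prop} {v s a b : ℕ} (h : GMC c v s a b)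
    (N : ℕ) (hN : 1 ≤ N) (Ω : Finset (Fin n)) (hΩ : Ω.card ≤ N) (x : PR n) :
    ∑ y, ((Finset.univ.filter fun T => c x y T ∧ vertsOf T ∪ x.1 ∪ y.1 ⊆ Ω).card) ≤
      (N * 2 ^ (v + 1)) ^ ((v - a) + (v - b)) := by
  by_cases hx : x.1.card = a ∧ a ≤ v
  swap
  · rw [Finset.sum_eq_zero]
    · exact Nat.zero_le _
    · intro y _
      rw [card_eq_zero, filter_eq_empty_iff]
      rintro T _ ⟨hT, _⟩
      apply hx
      refine ⟨h.ca hT, ?_⟩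
      rw [← h.ca hT, ← h.cW hT]
      apply card_le_card
      intro u hu
      simp [hu]
  obtain ⟨hx, hav⟩ := hx
  set F : Finset ((_ : PR n) × Finset (Edge n)) :=
    (powersetCard (v - a) Ω ×ˢ powersetCard (v - b) Ω).biUnion fun R =>
      (powerset R.2 ×ˢ powerset (edgesTouch (R.1 ∪ R.2) (x.1 ∪ R.1))).image fun q =>
        ⟨((x.1 ∪ R.1) \ R.2, q.1), q.2⟩ with hF
  rw [← Finset.card_sigma]
  have hsub : (Finset.univ.sigma fun y : PR n =>
      (Finset.univ.filter fun T => c x y T ∧ vertsOf T ∪ x.1 ∪ y.1 ⊆ Ω)) ⊆ F := by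
    rintro ⟨y, T⟩ hyT
    simp only [mem_sigma, mem_univ, mem_filter, true_and] at hyT
    obtain ⟨hc, hsub⟩ := hyT
    set W := vertsOf T ∪ x.1 ∪ y.1 with hW
    have hxW : x.1 ⊆ W := by intro u hu; simp [hW, hu]
    have hyW : y.1 ⊆ W := by intro u hu; simp [hW, hu]
    have hWc : W.card = v := h.cW hc
    have hxW' : x.1 ∪ W \ x.1 = W := union_sdiff_of_subset hxW
    rw [hF, mem_biUnion]
    refine ⟨(W \ x.1, W \ y.1), ?_, ?_⟩
    · rw [mem_product, mem_powersetCard, mem_powersetCard]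
      refine ⟨⟨sdiff_subset.trans hsub, ?_⟩, ⟨sdiff_subset.trans hsub, ?_⟩⟩
      · simp only; rw [card_sdiff_of_subset hxW, hWc, h.ca hc]
      · simp only; rw [card_sdiff_of_subset hyW, hWc, h.cb hc]
    · rw [mem_image]
      refine ⟨(y.2, T), ?_, ?_⟩
      · rw [mem_product, mem_powerset, mem_powerset]
        refine ⟨h.cQ hc, ?_⟩
        simp only
        rw [hxW']
        intro e he
        refine mem_filter.2 ⟨mem_univ _, ?_⟩
        obtain ⟨u, hu, hu'⟩ := h.cin hc e he
        obtain ⟨w, hw⟩ := Sym2.mem_iff_exists.1 hu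
        have huW : u ∈ W := by
          simp only [hW, mem_union, mem_vertsOf]; exact Or.inl (Or.inl ⟨e, he, hu⟩)
        have hwW : w ∈ W := by
          simp only [hW, mem_union, mem_vertsOf]
          exact Or.inl (Or.inl ⟨e, he, by rw [hw]; exact Sym2.mem_mk_right _ _⟩)
        refine ⟨(u, w), ?_, hw⟩
        simp only [mem_product, mem_union, mem_sdiff, mem_inter] at hu' ⊢
        tauto
      · simp only
        rw [hxW', Finset.sdiff_sdiff_eq_self hyW]
  refine (card_le_card hsub).trans ?_
  have hcF : F.card ≤ ∑ R ∈ (powersetCard (v - a) Ω ×ˢ powersetCard (v - b) Ω),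
      2 ^ (v - b) * 2 ^ (((v - a) + (v - b)) * v) := by
    rw [hF]
    refine card_biUnion_le.trans (Finset.sum_le_sum fun R hR => ?_)
    rw [mem_product, mem_powersetCard, mem_powersetCard] at hR
    refine card_image_le.trans ?_
    rw [card_product, card_powerset, card_powerset, hR.2.2]
    gcongr
    · norm_num
    refine (card_edgesTouch _ _).trans ?_
    gcongr
    · exact (card_union_le _ _).trans (by rw [hR.1.2, hR.2.2])
    · exact (card_union_le _ _).trans (by rw [hR.1.2, hx]; omega)
  refine hcF.trans ?_
  rw [sum_const, card_product, card_powersetCard, card_powersetCard, smul_eq_mul]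
  have h1 : Ω.card.choose (v - a) ≤ N ^ (v - a) :=
    (Nat.choose_le_pow _ _).trans (Nat.pow_le_pow_left hΩ _)
  have h2 : Ω.card.choose (v - b) ≤ N ^ (v - b) :=
    (Nat.choose_le_pow _ _).trans (Nat.pow_le_pow_left hΩ _)
  calc _ ≤ N ^ (v - a) * N ^ (v - b) *
        (2 ^ ((v - a) + (v - b)) * 2 ^ (((v - a) + (v - b)) * v)) := by
        gcongr
        · norm_num
        · omega
    _ = _ := by rw [mul_pow, ← pow_add, ← pow_mul, ← pow_add]; ring_nf

theorem GMC.start {c : PR n → PR n → Finset (Edge n) → Prop} {v s a b : ℕ} (h : GMC c v s a b)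
    (N : ℕ) (hN : 1 ≤ N) (Ω : Finset (Fin n)) (hΩ : Ω.card ≤ N) :
    (Finset.univ.filter fun x : PR n => x.1 ∪ x.2 ⊆ Ω ∧ ∃ y T, c x y T).card ≤
      (v + 1) * N ^ (2 * v) := by
  by_cases hav : a ≤ v
  swap
  · rw [filter_eq_empty_iff.2]
    · simp
    · rintro x _ ⟨_, y, T, hT⟩
      apply hav
      rw [← h.ca hT, ← h.cW hT]
      apply card_le_card
      intro u hu
      simp [hu]
  have hsub : (Finset.univ.filter fun x : PR n => x.1 ∪ x.2 ⊆ Ω ∧ ∃ y T, c x y T) ⊆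
      powersetCard a Ω ×ˢ ((Finset.range (v + 1)).biUnion fun j => powersetCard j Ω) := by
    intro x hx
    obtain ⟨_, hx1, y, T, hT⟩ := mem_filter.1 hx
    rw [mem_product, mem_biUnion, mem_powersetCard]
    refine ⟨⟨subset_union_left.trans hx1, h.ca hT⟩, x.2.card, ?_, ?_⟩
    · rw [mem_range, Nat.lt_succ_iff, ← h.cW hT]
      exact card_le_card ((h.cP hT).trans sdiff_subset)
    · rw [mem_powersetCard]
      exact ⟨subset_union_right.trans hx1, rfl⟩
  refine (card_le_card hsub).trans ?_
  rw [card_product, card_powersetCard]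
  have h1 : Ω.card.choose a ≤ N ^ v :=
    ((Nat.choose_le_pow _ _).trans (Nat.pow_le_pow_left hΩ _)).trans
      (Nat.pow_le_pow_right hN hav)
  have h2 : ((Finset.range (v + 1)).biUnion fun j => powersetCard j Ω).card ≤ (v + 1) * N ^ v := by
    refine card_biUnion_le.trans ?_
    calc _ ≤ ∑ j ∈ Finset.range (v + 1), N ^ v := by
          refine Finset.sum_le_sum fun j hj => ?_
          rw [card_powersetCard]
          exact ((Nat.choose_le_pow _ _).trans (Nat.pow_le_pow_left hΩ _)).trans
            (Nat.pow_le_pow_right hN (by rw [mem_range] at hj; omega))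
      _ = _ := by simp
  calc _ ≤ N ^ v * ((v + 1) * N ^ v) := Nat.mul_le_mul h1 h2
    _ = _ := by ring

noncomputable def gmat (G : Graph n) (c : PR n → PR n → Finset (Edge n) → Prop) :
    Matrix (PR n) (PR n) ℝ := fun x y => sumChi G (c x y)

noncomputable def symC (c : PR n → PR n → Finset (Edge n) → Prop) :
    PR n ⊕ PR n → PR n ⊕ PR n → Finset (Finset (Edge n))
  | .inl x, .inr y => Finset.univ.filter fun T => c x y T
  | .inr y, .inl x => Finset.univ.filter fun T => c x y T
  | .inl _, .inl _ => ∅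
  | .inr _, .inr _ => ∅

def symU : PR n ⊕ PR n → Finset (Fin n)
  | .inl x => x.1 ∪ x.2
  | .inr x => x.1 ∪ x.2

theorem cMat_symC (G : Graph n) (c : PR n → PR n → Finset (Edge n) → Prop) :
    cMat G (symC c) = Matrix.fromBlocks 0 (gmat G c) (gmat G c).transpose 0 := by
  ext x y
  rcases x with x | x <;> rcases y with y | y
  · simp [cMat, symC]
  · simp [cMat, symC, gmat, sumChi, Finset.sum_filter]
  · simp [cMat, symC, gmat, sumChi, Finset.sum_filter]
  · simp [cMat, symC]

theorem GMC.moment {c : PR n → PR n → Finset (Edge n) → Prop} {v s a b : ℕ} (h : GMC c v s a b)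
    (hn : 0 < n) (hs : s ≤ v) (k N : ℕ) (hN : 1 ≤ N)
    (hN2 : 2 ^ (k + 2) * (v - s) + 4 * v ≤ 2 * N) :
    ∑ G : Graph n, ‖gmat G c‖ ^ (2 ^ (k + 2)) ≤
      Fintype.card (Graph n) * ((n : ℝ) ^ N * ((2 * ((v + 1) * N ^ (2 * v)) : ℕ) *
        (((N * 2 ^ (v + 1)) ^ ((v - a) + (v - b)) : ℕ) : ℝ) ^ (2 ^ (k + 2)))) := by
  have hWU : ∀ {x y T}, c x y T → vertsOf T ∪ (x.1 ∪ x.2) ∪ (y.1 ∪ y.2) =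
      vertsOf T ∪ x.1 ∪ y.1 := by
    intro x y T hc
    have h1 := h.cP hc
    have h2 := h.cQ hc
    ext u
    have h3 := @h1 u
    have h4 := @h2 u
    simp only [mem_union, mem_sdiff] at h3 h4 ⊢
    tauto
  refine le_trans (Finset.sum_le_sum fun G _ => ?_) (trace_moment hn symU (symC c) v s (2 ^ (k + 2)) N
    _ (((N * 2 ^ (v + 1)) ^ ((v - a) + (v - b)) : ℕ) : ℝ) hs (by positivity) hN2 ?_ ?_ (by positivity)
    ?_ ?_)
  · have := norm_pow_le_trace (gmat G c) k
    rw [← cMat_symC] at this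
    refine this.trans (le_of_eq ?_)
    congr!
  · rintro (x | x) (y | y) T hT
    · simp [symC] at hT
    · simp only [symC, mem_filter, mem_univ, true_and] at hT
      simp only [symU]
      rw [hWU hT]; exact h.cW hT
    · simp only [symC, mem_filter, mem_univ, true_and] at hT
      simp only [symU]
      rw [union_perm, hWU hT]; exact h.cW hT
    · simp [symC] at hT
  · rintro (x | x) (y | y) T hT S hS
    · simp [symC] at hT
    · simp only [symC, mem_filter, mem_univ, true_and] at hT
      exact h.csep hT S hS
    · simp only [symC, mem_filter, mem_univ, true_and] at hT
      exact h.csep hT S hS.symm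
    · simp [symC] at hT
  · intro Ω hΩ x
    rw [Fintype.sum_sum_type]
    rcases x with x | x
    · rw [Finset.sum_eq_zero (s := (Finset.univ : Finset (PR n))) (fun y _ => by simp [symC]), zero_add,
        ← Nat.cast_sum, Nat.cast_le]
      refine le_trans (Finset.sum_le_sum fun y _ => card_le_card ?_) (h.row N hN Ω hΩ x)
      intro T hT
      have h1 := mem_filter.1 hT
      have h2 : c x y T := (mem_filter.1 h1.1).2
      have h3 : vertsOf T ∪ (x.1 ∪ x.2) ∪ (y.1 ∪ y.2) ⊆ Ω := h1.2
      rw [hWU h2] at h3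
      exact mem_filter.2 ⟨mem_univ _, h2, h3⟩
    · rw [add_comm, Finset.sum_eq_zero (s := (Finset.univ : Finset (PR n))) (fun y _ => by simp [symC]),
        zero_add, ← Nat.cast_sum, Nat.cast_le, add_comm (v - a)]
      refine le_trans (Finset.sum_le_sum fun y _ => card_le_card ?_) (h.swap.row N hN Ω hΩ x)
      intro T hT
      have h1 := mem_filter.1 hT
      have h2 : c y x T := (mem_filter.1 h1.1).2
      have h3 : vertsOf T ∪ (x.1 ∪ x.2) ∪ (y.1 ∪ y.2) ⊆ Ω := h1.2
      rw [union_perm, hWU h2, union_perm] at h3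
      exact mem_filter.2 ⟨mem_univ _, h2, h3⟩
  · intro Ω hΩ
    have h1 := h.start N hN Ω hΩ
    have h2 := h.swap.start N hN Ω hΩ
    have : (Finset.univ.filter fun x => symU x ⊆ Ω ∧ ∃ y, (symC c x y).Nonempty) ⊆
        ((Finset.univ.filter fun x : PR n => x.1 ∪ x.2 ⊆ Ω ∧ ∃ y T, c x y T).image Sum.inl) ∪
        ((Finset.univ.filter fun x : PR n => x.1 ∪ x.2 ⊆ Ω ∧ ∃ y T, c y x T).image Sum.inr) := by
      intro x hx
      simp only [mem_filter, mem_univ, true_and] at hx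
      obtain ⟨hx1, y, T, hT⟩ := hx
      rcases x with x | x <;> rcases y with y | y
      · simp [symC] at hT
      · simp only [symC, mem_filter, mem_univ, true_and] at hT
        rw [mem_union]
        left
        rw [mem_image]
        exact ⟨x, mem_filter.2 ⟨mem_univ _, hx1, y, T, hT⟩, rfl⟩
      · simp only [symC, mem_filter, mem_univ, true_and] at hT
        rw [mem_union]
        right
        rw [mem_image]
        exact ⟨x, mem_filter.2 ⟨mem_univ _, hx1, y, T, hT⟩, rfl⟩
      · simp [symC] at hT
    refine (card_le_card this).trans ((card_union_le _ _).trans ?_)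
    have h3 := card_image_le (s := Finset.univ.filter fun x : PR n => x.1 ∪ x.2 ⊆ Ω ∧ ∃ y T, c x y T)
      (f := (Sum.inl : PR n → PR n ⊕ PR n))
    have h4 := card_image_le (s := Finset.univ.filter fun x : PR n => x.1 ∪ x.2 ⊆ Ω ∧ ∃ y T, c y x T)
      (f := (Sum.inr : PR n → PR n ⊕ PR n))
    omega

/-- Markov's inequality version. -/
theorem GMC.markov {c : PR n → PR n → Finset (Edge n) → Prop} {v s a b : ℕ} (h : GMC c v s a b)
    (hn : 0 < n) (hs : s ≤ v) (k N : ℕ) (hN : 1 ≤ N)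
    (hN2 : 2 ^ (k + 2) * (v - s) + 4 * v ≤ 2 * N) (B : ℝ) (hB : 0 ≤ B) :
    probGraph n (fun G => B < ‖gmat G c‖) * B ^ (2 ^ (k + 2)) ≤
      (n : ℝ) ^ N * ((2 * ((v + 1) * N ^ (2 * v)) : ℕ) *
        (((N * 2 ^ (v + 1)) ^ ((v - a) + (v - b)) : ℕ) : ℝ) ^ (2 ^ (k + 2))) := by
  have hm := h.moment hn hs k N hN hN2
  have hpos : (0 : ℝ) < Fintype.card (Graph n) := by
    exact_mod_cast Fintype.card_pos
  unfold probGraph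
  rw [div_mul_eq_mul_div, div_le_iff₀ hpos, mul_comm _ (Fintype.card (Graph n) : ℝ)]
  refine le_trans ?_ hm
  calc _ = ∑ G ∈ Finset.univ.filter (fun G : Graph n => B < ‖gmat G c‖), B ^ (2 ^ (k + 2)) := by
        rw [sum_const, nsmul_eq_mul]
    _ ≤ ∑ G ∈ Finset.univ.filter (fun G : Graph n => B < ‖gmat G c‖), ‖gmat G c‖ ^ (2 ^ (k + 2)) := by
        refine Finset.sum_le_sum fun G hG => ?_
        have := (mem_filter.1 hG).2
        gcongr
    _ ≤ _ := Finset.sum_le_sum_of_subset_of_nonneg (Finset.filter_subset _ _) fun G _ _ => by positivity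

end gm


section factor
variable {n : ℕ}

theorem chi_symmDiff_true (G : Graph n) (T : Finset (Edge n)) (e : Edge n) (he : G e = true) :
    chi G (symmDiff T {e}) = chi G T := by
  have hs : edgeSign G e = 1 := by simp [edgeSign, he]
  unfold chi
  by_cases h : e ∈ T
  · have e1 : symmDiff T {e} = T.erase e := by
      ext f
      simp only [Finset.mem_symmDiff, mem_singleton, mem_erase]
      by_cases hf : f = e
      · subst hf; simp [h]
      · simp [hf]
    rw [e1, ← Finset.mul_prod_erase T _ h, hs, one_mul]
  · have e1 : symmDiff T {e} = insert e T := by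
      ext f
      simp only [Finset.mem_symmDiff, mem_singleton, mem_insert]
      by_cases hf : f = e
      · subst hf; simp [h]
      · simp [hf]
    rw [e1, Finset.prod_insert h, hs, one_mul]

theorem sumChi_double (G : Graph n) (c : Finset (Edge n) → Prop) (e : Edge n) (he : G e = true)
    (hc : ∀ T, c T → c (symmDiff T {e})) :
    sumChi G c = 2 * sumChi G (fun T => c T ∧ e ∉ T) := by
  have hc' : ∀ T, c (symmDiff T {e}) ↔ c T := fun T => ⟨fun h => by
    have := hc _ h
    rwa [symmDiff_twice] at this, hc T⟩
  have h1 : sumChi G c = sumChi G (fun T => c T ∧ e ∈ T) + sumChi G (fun T => c T ∧ e ∉ T) := by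
    unfold sumChi
    rw [← Finset.sum_add_distrib]
    refine Finset.sum_congr rfl fun T _ => ?_
    by_cases h : c T <;> by_cases h' : e ∈ T <;> simp [h, h']
  have h2 : sumChi G (fun T => c T ∧ e ∈ T) = sumChi G (fun T => c T ∧ e ∉ T) := by
    let σ : Equiv.Perm (Finset (Edge n)) :=
      ⟨fun T => symmDiff T {e}, fun T => symmDiff T {e}, fun T => symmDiff_twice T e,
        fun T => symmDiff_twice T e⟩
    unfold sumChi
    rw [← Equiv.sum_comp σ]
    refine Finset.sum_congr rfl fun T _ => ?_
    have : σ T = symmDiff T {e} := rfl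
    rw [this, chi_symmDiff_true _ _ _ he]
    have hiff : (c (symmDiff T {e}) ∧ e ∈ symmDiff T {e}) ↔ (c T ∧ e ∉ T) := by
      rw [hc' T]
      simp [Finset.mem_symmDiff]
    by_cases h : c T ∧ e ∉ T
    · rw [if_pos h, if_pos (hiff.2 h)]
    · rw [if_neg h, if_neg (fun h' => h (hiff.1 h'))]
  rw [h1, h2]; ring

theorem sumChi_factor (G : Graph n) (c : Finset (Edge n) → Prop) (F : Finset (Edge n))
    (hF : ∀ e ∈ F, G e = true) (hc : ∀ e ∈ F, ∀ T, c T → c (symmDiff T {e})) :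
    sumChi G c = 2 ^ F.card * sumChi G (fun T => c T ∧ ∀ e ∈ F, e ∉ T) := by
  induction F using Finset.induction_on with
  | empty => simp
  | insert e F he ih =>
    rw [ih (fun f hf => hF f (mem_insert_of_mem hf)) (fun f hf => hc f (mem_insert_of_mem hf)),
      sumChi_double G _ e (hF e (mem_insert_self _ _)), card_insert_of_notMem he, pow_succ]
    · rw [mul_assoc]
      congr 2
      apply sumChi_congr
      intro T
      simp only [mem_insert, forall_eq_or_imp]
      tauto
    · rintro T ⟨h1, h2⟩
      refine ⟨hc e (mem_insert_self _ _) T h1, ?_⟩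
      intro f hf
      have := h2 f hf
      have hne : f ≠ e := by rintro rfl; exact he hf
      simp [Finset.mem_symmDiff, this, hne]

noncomputable def edgesIn (A : Finset (Fin n)) : Finset (Edge n) :=
  Finset.univ.filter fun e => ∀ v ∈ (e : Sym2 (Fin n)), v ∈ A

theorem card_edgesIn (A : Finset (Fin n)) : (edgesIn A).card = A.card.choose 2 := by
  rw [← Sym2.card_image_offDiag, ← card_image_of_injective (edgesIn A) Subtype.val_injective]
  congr 1
  ext e
  induction e using Sym2.ind with
  | _ a b =>
    simp only [mem_image, edgesIn, mem_filter, mem_univ, true_and, mem_offDiag, Subtype.exists,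
      exists_and_right, exists_eq_right, Prod.exists, Function.uncurry]
    constructor
    · rintro ⟨h1, h2⟩
      refine ⟨a, b, ⟨h2 a (by simp), h2 b (by simp), ?_⟩, rfl⟩
      simpa using h1
    · rintro ⟨a', b', ⟨h1, h2, h3⟩, h4⟩
      have h4' : s(a', b') = s(a, b) := h4
      rw [← h4']
      refine ⟨by simpa using h3, ?_⟩
      intro v hv
      rw [Sym2.mem_iff] at hv
      rcases hv with rfl | rfl <;> assumption

theorem HC_toggle {d u : ℕ} {x y : PR n} {e : Edge n} (he : ∀ v ∈ (e : Sym2 (Fin n)), v ∈ x.1)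
    {T : Finset (Edge n)} (h : HC d x y u T) : HC d x y u (symmDiff T {e}) := by
  have he' : ∀ v ∈ (e : Sym2 (Fin n)), v ∈ x.1 ∪ x.2 := fun v hv => mem_union_left _ (he v hv)
  obtain ⟨h1, ⟨h2, h3, h4⟩, h5, h6⟩ := h
  refine ⟨?_, ⟨h2, ?_, ?_⟩, ?_, ?_⟩
  · intro S hS
    exact h1 S ((sep_toggle_iff' he').1 hS)
  · intro S hS
    exact h3 S ((sep_toggle_iff he).1 hS)
  · rwa [verts_toggle he]
  · rwa [verts_toggle he]
  · have e1 : ∀ Z : Finset (Fin n), Z ∪ y.1 ∪ (x.1 ∪ x.2) = (Z ∪ (x.1 ∪ x.2)) ∪ y.1 := by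
      intro Z; ext v; simp only [mem_union]; tauto
    rwa [e1, verts_toggle he', ← e1]

def HC0 (d : ℕ) (u : ℕ) (x y : PR n) (T : Finset (Edge n)) : Prop :=
  HC d x y u T ∧ ∀ e ∈ T, ∃ v ∈ (e : Sym2 (Fin n)), v ∉ x.1

theorem HC_factor (d u : ℕ) (G : Graph n) (x y : PR n) (hx : Clq G x.1) :
    sumChi G (HC d x y u) = 2 ^ (x.1.card.choose 2) * sumChi G (HC0 d u x y) := by
  rw [sumChi_factor G (HC d x y u) (edgesIn x.1), card_edgesIn]
  · congr 1
    apply sumChi_congr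
    intro T
    unfold HC0
    refine and_congr_right fun _ => ?_
    constructor
    · intro h e he
      by_contra hcon
      push Not at hcon
      exact h e (mem_filter.2 ⟨mem_univ _, hcon⟩) he
    · intro h e he heT
      obtain ⟨v, hv, hv'⟩ := h e heT
      exact hv' ((mem_filter.1 he).2 v hv)
  · intro e he
    exact hx e (mem_filter.1 he).2
  · intro e he T hT
    exact HC_toggle (mem_filter.1 he).2 hT

end factor

section classes
variable {n : ℕ}

def cL (d i a0 a : ℕ) (x y : PR n) (T : Finset (Edge n)) : Prop :=
  (x.2 = ∅ ∧ y.2 = ∅ ∧ x.1.card = a0 ∧ y.1.card = a ∧ x.1.card ≤ d) ∧ LC x.1 y i T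

def cG (d w a' a : ℕ) (x y : PR n) (T : Finset (Edge n)) : Prop :=
  GC d x y w T ∧ x.1.card = a' ∧ y.1.card = a

def cH (d u a b : ℕ) (x y : PR n) (T : Finset (Edge n)) : Prop :=
  HC0 d u x y T ∧ x.1.card = a ∧ y.1.card = b

theorem LCl.union_eq {T : Finset (Edge n)} {I A : Finset (Fin n)} (h : LCl T I A) :
    vertsOf T ∪ I ∪ A = vertsOf T ∪ I := union_eq_left.2 h.A_sub

theorem LCl.card_eq {T : Finset (Edge n)} {I A : Finset (Fin n)} (h : LCl T I A) :
    (vertsOf T ∪ I ∪ A).card = A.card + ((vertsOf T ∪ I) \ A).card := by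
  rw [h.union_eq, add_comm, card_sdiff_add_card_eq_card h.A_sub]

theorem LCl.edge {T : Finset (Edge n)} {I A : Finset (Fin n)} (h : LCl T I A) :
    ∀ e ∈ T, ∃ u ∈ (e : Sym2 (Fin n)), u ∉ A := by
  intro e he
  obtain ⟨u, hu, hu'⟩ := h.2 e he
  rw [← h.reach_eq] at hu'
  exact ⟨u, hu, (mem_sdiff.1 hu').2⟩

theorem gmc_L (d i a0 a : ℕ) : GMC (cL (n := n) d i a0 a) (a + i) a a0 a where
  ca := fun h => h.1.2.2.1
  cb := fun h => h.1.2.2.2.1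
  cW := fun h => by rw [h.2.1.card_eq, h.2.2.1, h.1.2.2.2.1]
  cP := fun h => by rw [h.1.1]; simp
  cQ := fun h => by rw [h.1.2.1]; simp
  csep := fun h S hS => by
    rw [← h.1.2.2.2.1]
    exact h.2.1.card_le_of_sep (hS.mono_sets subset_union_left subset_union_left)
  cin := fun h e he => by
    obtain ⟨u, hu, hu'⟩ := h.2.1.edge e he
    exact ⟨u, hu, fun hh => hu' (mem_inter.1 hh).2⟩

theorem cL_le {d i a0 a : ℕ} {x y : PR n} {T : Finset (Edge n)} (h : cL d i a0 a x y T) :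
    a ≤ a0 ∧ a0 ≤ d ∧ a0 ≤ a + i := by
  have h1 := h.2.1.card_le
  have h2 := (gmc_L d i a0 a).cW h
  have h3 : x.1.card ≤ (vertsOf T ∪ x.1 ∪ y.1).card := card_le_card (by intro u hu; simp [hu])
  obtain ⟨⟨_, _, h4, h5, h6⟩, _⟩ := h
  omega

theorem gmc_G (d w a' a : ℕ) : GMC (cG (n := n) d w a' a) (a + w) a' a' a where
  ca := fun h => h.2.1
  cb := fun h => h.2.2
  cW := fun h => by rw [h.1.2.1.2.1.card_eq, h.1.2.2.1, h.2.2]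
  cP := fun {x y T} h => by
    have h1 := h.1.2.2.2
    have h2 := h.1.2.1.2.2
    intro u hu
    have h3 := h1 hu
    have h4 := @h2 u
    simp only [mem_sdiff, mem_union] at h3 h4 ⊢
    tauto
  cQ := fun {x y T} h => by
    rw [h.1.2.1.2.1.union_eq]; exact h.1.2.1.2.2
  csep := fun h S hS => by
    rw [← h.2.1]
    exact h.1.1 S (hS.mono_sets subset_union_left subset_rfl)
  cin := fun h e he => by
    obtain ⟨u, hu, hu'⟩ := h.1.2.1.2.1.edge e he
    exact ⟨u, hu, fun hh => hu' (mem_inter.1 hh).2⟩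

theorem cG_le {d w a' a : ℕ} {x y : PR n} {T : Finset (Edge n)} (h : cG d w a' a x y T) :
    a ≤ a' ∧ a' ≤ d ∧ a' ≤ a + w := by
  have h1 := h.1.2.1.2.1.card_le
  have h2 := (gmc_G d w a' a).cW h
  have h3 : x.1.card ≤ (vertsOf T ∪ x.1 ∪ y.1).card := card_le_card (by intro u hu; simp [hu])
  have h6 := h.1.2.1.1
  obtain ⟨_, h4, h5⟩ := h
  omega

theorem gmc_H (d u a b : ℕ) : GMC (cH (n := n) d u a b) u b a b where
  ca := fun h => h.2.1
  cb := fun h => h.2.2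
  cW := fun h => h.1.1.2.2.1
  cP := fun {x y T} h => h.1.1.2.1.2.2
  cQ := fun {x y T} h => by
    have h1 := h.1.1.2.2.2
    have h2 := h.1.1.2.1.2.2
    intro u hu
    have h3 := h1 hu
    have h4 := @h2 u
    simp only [mem_sdiff, mem_union] at h3 h4 ⊢
    tauto
  csep := fun h S hS => by
    rw [← h.2.2]
    exact h.1.1.1 S (hS.symm.mono_sets subset_union_left subset_rfl)
  cin := fun h e he => by
    obtain ⟨u, hu, hu'⟩ := h.1.2 e he
    exact ⟨u, hu, fun hh => hu' (mem_inter.1 hh).1⟩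

theorem cH_le {d u a b : ℕ} {x y : PR n} {T : Finset (Edge n)} (h : cH d u a b x y T) :
    a ≤ b ∧ b ≤ d ∧ b ≤ u := by
  have h1 := h.1.1.2.1.2.1.card_le
  have h2 := (gmc_H d u a b).cW h
  have h3 : y.1.card ≤ (vertsOf T ∪ x.1 ∪ y.1).card := card_le_card (by intro u hu; simp [hu])
  have h6 := h.1.1.2.1.1
  obtain ⟨_, h4, h5⟩ := h
  omega

theorem sumChi_empty (G : Graph n) (c : Finset (Edge n) → Prop) (p : Prop) [Decidable p]
    (h : ∀ T, c T ↔ T = ∅ ∧ p) : sumChi G c = if p then 1 else 0 := by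
  unfold sumChi
  rw [Finset.sum_eq_single ∅]
  · by_cases hp : p
    · rw [if_pos ((h ∅).2 ⟨rfl, hp⟩), if_pos hp]
      simp [chi]
    · rw [if_neg hp, if_neg]
      intro h'
      exact hp ((h ∅).1 h').2
  · intro T _ hT
    rw [if_neg]
    intro h'
    exact hT ((h T).1 h').1
  · simp

theorem vertsOf_empty : vertsOf (∅ : Finset (Edge n)) = ∅ := by
  ext v; simp [mem_vertsOf]

theorem sep_empty {I S : Finset (Fin n)} (h : Sep (∅ : Finset (Edge n)) I I S) : I ⊆ S := by
  obtain ⟨X, hX, hB⟩ := h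
  intro v hv
  by_contra hS
  exact hB v (hX.1 v hv hS) hv

theorem LCl_zero {T : Finset (Edge n)} {I A : Finset (Fin n)} :
    (LCl T I A ∧ ((vertsOf T ∪ I) \ A).card = 0) ↔ T = ∅ ∧ I = A := by
  constructor
  · rintro ⟨h, h0⟩
    rw [card_eq_zero] at h0
    have hr := h.reach_eq
    rw [h0] at hr
    have hT : T = ∅ := by
      rw [eq_empty_iff_forall_notMem]
      intro e he
      obtain ⟨u, _, hu⟩ := h.2 e he
      rw [← hr] at hu
      simp at hu
    refine ⟨hT, ?_⟩
    subst hT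
    rw [sdiff_eq_empty_iff_subset] at h0
    have := h.A_sub
    rw [vertsOf_empty, empty_union] at this h0
    exact subset_antisymm h0 this
  · rintro ⟨rfl, rfl⟩
    refine ⟨⟨?_, by simp⟩, by simp [vertsOf_empty]⟩
    intro S hS hc
    exact (eq_of_subset_of_card_le (sep_empty hS) hc).symm

theorem LC_zero (G : Graph n) (I : Finset (Fin n)) (y : PR n) :
    sumChi G (LC I y 0) = if I = y.1 ∧ y.2 = ∅ then 1 else 0 := by
  apply sumChi_empty
  intro T
  have h := @LCl_zero n T I y.1
  unfold LC
  constructor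
  · rintro ⟨h1, h2, h3⟩
    obtain ⟨h4, h5⟩ := h.1 ⟨h1, h2⟩
    rw [card_eq_zero] at h2
    rw [h2, subset_empty] at h3
    exact ⟨h4, h5, h3⟩
  · rintro ⟨h4, h5, h6⟩
    obtain ⟨h1, h2⟩ := h.2 ⟨h4, h5⟩
    exact ⟨h1, h2, by rw [h6]; simp⟩

theorem GC_zero (d : ℕ) (G : Graph n) (x y : PR n) :
    sumChi G (GC d x y 0) = if x = y ∧ x.2 = ∅ ∧ x.1.card ≤ d then 1 else 0 := by
  apply sumChi_empty
  intro T
  have h := @LCl_zero n T x.1 y.1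
  unfold GC
  constructor
  · rintro ⟨_, ⟨h0, h1, h3⟩, h2, h6⟩
    obtain ⟨h4, h5⟩ := h.1 ⟨h1, h2⟩
    rw [card_eq_zero] at h2
    rw [h2, subset_empty] at h3
    rw [h4, h5, h3, vertsOf_empty] at h6
    simp only [empty_union, union_empty, union_idempotent, sdiff_self, bot_eq_empty,
      subset_empty] at h6
    refine ⟨h4, Prod.ext h5 (h6.trans h3.symm), h6, h0⟩
  · rintro ⟨rfl, rfl, h6, h7⟩
    obtain ⟨h1, h2⟩ := h.2 ⟨rfl, rfl⟩
    refine ⟨?_, ⟨h7, h1, by rw [h6]; simp⟩, h2, by rw [h6]; simp⟩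
    rw [h6, union_empty]
    intro S hS
    exact card_le_card (sep_empty hS)

theorem HC0_diag (d u : ℕ) (G : Graph n) (x y : PR n) :
    gmat G (cH d u u u) x y = if x = y ∧ x.2 = ∅ ∧ x.1.card = u ∧ u ≤ d then 1 else 0 := by
  unfold gmat
  apply sumChi_empty
  intro T
  constructor
  · rintro h
    have hW := (gmc_H d u u u).cW h
    have hx := (gmc_H d u u u).ca h
    have hy := (gmc_H d u u u).cb h
    have hP := (gmc_H d u u u).cP h
    have hQ := (gmc_H d u u u).cQ h
    set W := vertsOf T ∪ x.1 ∪ y.1 with hWd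
    have hxW : x.1 = W := eq_of_subset_of_card_le (by intro v hv; simp [hWd, hv]) (by omega)
    have hyW : y.1 = W := eq_of_subset_of_card_le (by intro v hv; simp [hWd, hv]) (by omega)
    rw [hxW, sdiff_self, bot_eq_empty, subset_empty] at hP
    rw [hyW, sdiff_self, bot_eq_empty, subset_empty] at hQ
    refine ⟨?_, Prod.ext (hxW.trans hyW.symm) (hP.trans hQ.symm), hP, hx, ?_⟩
    · rw [eq_empty_iff_forall_notMem]
      intro e he
      obtain ⟨v, hv, hv'⟩ := h.1.2 e he
      apply hv'
      rw [hxW, hWd, mem_union, mem_union, mem_vertsOf]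
      exact Or.inl (Or.inl ⟨e, he, hv⟩)
    · rw [← hy]; exact h.1.1.2.1.1
  · rintro ⟨rfl, rfl, h6, h7, h8⟩
    refine ⟨⟨⟨?_, ⟨by omega, ?_, by rw [h6]; simp⟩, by simp [vertsOf_empty, h7], by rw [h6]; simp⟩,
      by simp⟩, h7, h7⟩
    · rw [h6, union_empty]
      intro S hS
      exact card_le_card (sep_empty hS)
    · intro S hS
      exact card_le_card (sep_empty hS)

end classes


section event
open scoped Matrix.Norms.L2Operator
variable {n : ℕ}

theorem exists_pow_two (x : ℝ) (hx : 4 ≤ x) : ∃ k : ℕ, x ≤ 2 * 2 ^ (k + 2) ∧ (2 : ℝ) ^ (k + 2) ≤ x := by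
  obtain ⟨j, h1, h2⟩ := exists_nat_pow_near (x := x) (y := 2) (by linarith) (by norm_num)
  have hj : 2 ≤ j := by
    by_contra hj
    have hj' : j + 1 ≤ 2 := by omega
    have : (2 : ℝ) ^ (j + 1) ≤ 2 ^ 2 := pow_le_pow_right₀ (by norm_num) hj'
    linarith
  refine ⟨j - 2, ?_, ?_⟩
  · rw [Nat.sub_add_cancel hj, ← pow_succ']; exact h2.le
  · rw [Nat.sub_add_cancel hj]; exact h1

theorem probGraph_nonneg (P : Graph n → Prop) : 0 ≤ probGraph n P := by
  unfold probGraph; positivity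

theorem GMC.tail {c : PR n → PR n → Finset (Edge n) → Prop} {v s a a' : ℕ} (h : GMC c v s a a')
    (hn : 0 < n) (hs : s ≤ v) (l b : ℝ) (hl : l = Real.log n) (hl1 : 1000 ≤ l)
    (hv : 1000 * (v : ℝ) ≤ l) (hb : Real.exp 2 ≤ b) (hb2 : l ^ 4 * 2 ^ (v + 1) ≤ b) :
    probGraph n (fun G => b * √(n : ℝ) ^ (v - s) * b ^ ((v - a) + (v - a')) < ‖gmat G c‖)
      ≤ Real.exp (-19 * l ^ 2) := by
  obtain ⟨k, hk1, hk2⟩ := exists_pow_two (20 * l ^ 2) (by nlinarith)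
  set m : ℕ := 2 ^ (k + 2) with hm
  have hmr : (m : ℝ) = 2 ^ (k + 2) := by rw [hm]; push_cast; rfl
  have hm2 : m = 2 * 2 ^ (k + 1) := by rw [hm]; ring
  rw [← hmr] at hk1 hk2
  set N : ℕ := 2 ^ (k + 1) * (v - s) + 2 * v + 1 with hN
  have hN2 : 2 * N = m * (v - s) + 2 * (2 * v + 1) := by rw [hN, hm2]; ring
  have hb0 : 0 < b := lt_of_lt_of_le (Real.exp_pos _) hb
  have hnr : (0 : ℝ) < n := by exact_mod_cast hn
  have hR : 0 < √(n : ℝ) := Real.sqrt_pos.2 hnr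
  set r := (v - a) + (v - a') with hr
  have key := h.markov hn hs k N (by omega) (by rw [hN2, ← hm]; omega)
    (b * √(n : ℝ) ^ (v - s) * b ^ r) (by positivity)
  rw [← hm] at key
  set p := probGraph n (fun G => b * √(n : ℝ) ^ (v - s) * b ^ r < ‖gmat G c‖) with hp
  have hNl : (N : ℝ) ≤ l ^ 4 := by
    have h1 : N ≤ m * v + 2 * v + 1 := by
      have : 2 ^ (k + 1) * (v - s) ≤ m * v := Nat.mul_le_mul (by omega) (by omega)
      omega
    have h2 : (N : ℝ) ≤ m * v + 2 * v + 1 := by exact_mod_cast h1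
    have h3 : (m : ℝ) * v ≤ 20 * l ^ 2 * (l / 1000) :=
      mul_le_mul hk2 (by linarith) (by positivity) (by positivity)
    have h4 : l ^ 4 ≥ 1000 * l ^ 3 := by
      have : l ^ 4 = l * l ^ 3 := by ring
      rw [this]; gcongr
    have h5 : l ^ 3 ≥ 1000 * l ^ 2 := by
      have : l ^ 3 = l * l ^ 2 := by ring
      rw [this]; gcongr
    have h6 : l ^ 2 ≥ 1000 * l := by nlinarith
    nlinarith
  have hD : ((N * 2 ^ (v + 1) : ℕ) : ℝ) ≤ b := by
    push_cast
    refine le_trans ?_ hb2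
    gcongr
  have hl0 : 0 < l := by linarith
  have hle : (n : ℝ) = Real.exp l := by rw [hl, Real.exp_log hnr]
  have hlexp : l ≤ Real.exp l := by linarith [Real.add_one_le_exp l]
  have hnN : (n : ℝ) ^ N = (√(n : ℝ) ^ (v - s)) ^ m * (n : ℝ) ^ (2 * v + 1) := by
    have h1 : (n : ℝ) = √(n : ℝ) ^ 2 := (Real.sq_sqrt hnr.le).symm
    have h2 : (n : ℝ) ^ N = √(n : ℝ) ^ (2 * N) := by
      conv_lhs => rw [h1]
      rw [pow_mul]
    have h3 : (n : ℝ) ^ (2 * v + 1) = √(n : ℝ) ^ (2 * (2 * v + 1)) := by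
      conv_lhs => rw [h1]
      rw [← pow_mul]
    rw [h2, h3, hN2, pow_add, ← pow_mul, mul_comm m]
  set Q : ℝ := (√(n : ℝ) ^ (v - s)) ^ m * (b ^ r) ^ m with hQ
  have hQ0 : 0 < Q := by positivity
  have key2 : p * b ^ m ≤ (n : ℝ) ^ (2 * v + 1) * ((2 * ((v + 1) * N ^ (2 * v)) : ℕ) : ℝ) := by
    refine le_of_mul_le_mul_right ?_ hQ0
    calc p * b ^ m * Q = p * (b * √(n : ℝ) ^ (v - s) * b ^ r) ^ m := by
          rw [hQ, mul_pow, mul_pow]; ring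
      _ ≤ _ := key
      _ ≤ (n : ℝ) ^ N * ((2 * ((v + 1) * N ^ (2 * v)) : ℕ) * (b ^ r) ^ m) := by
          have : (((N * 2 ^ (v + 1)) ^ r : ℕ) : ℝ) ≤ b ^ r := by
            push_cast at hD ⊢
            gcongr
          gcongr
      _ = _ := by rw [hnN, hQ]; ring
  have hc : (n : ℝ) ^ (2 * v + 1) * ((2 * ((v + 1) * N ^ (2 * v)) : ℕ) : ℝ) ≤ Real.exp (l ^ 2) := by
    have h1 : (n : ℝ) ^ (2 * v + 1) = Real.exp ((2 * v + 1) * l) := by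
      rw [hle, ← Real.exp_nat_mul]; push_cast; rfl
    have h2 : (2 * (v + 1) : ℝ) ≤ Real.exp l := by linarith
    have h3 : (N : ℝ) ^ (2 * v) ≤ Real.exp (8 * v * l) := by
      calc (N : ℝ) ^ (2 * v) ≤ ((Real.exp l) ^ 4) ^ (2 * v) := by
            gcongr
            exact hNl.trans (by gcongr)
        _ = _ := by rw [← pow_mul, ← Real.exp_nat_mul]; congr 1; push_cast; ring
    push_cast
    rw [h1]
    calc Real.exp ((2 * v + 1) * l) * (2 * ((v + 1) * (N : ℝ) ^ (2 * v)))
        = Real.exp ((2 * v + 1) * l) * ((2 * (v + 1)) * (N : ℝ) ^ (2 * v)) := by ring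
      _ ≤ Real.exp ((2 * v + 1) * l) * (Real.exp l * Real.exp (8 * v * l)) := by gcongr
      _ = Real.exp ((10 * v + 2) * l) := by rw [← Real.exp_add, ← Real.exp_add]; congr 1; ring
      _ ≤ _ := by
          apply Real.exp_le_exp.2
          nlinarith
  have hbm : Real.exp (20 * l ^ 2) ≤ b ^ m := by
    calc Real.exp (20 * l ^ 2) ≤ Real.exp (m * 2) := Real.exp_le_exp.2 (by linarith)
      _ = Real.exp 2 ^ m := by rw [Real.exp_nat_mul]
      _ ≤ b ^ m := by gcongr
  have hp0 : 0 ≤ p := probGraph_nonneg _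
  have : p * Real.exp (20 * l ^ 2) ≤ Real.exp (l ^ 2) :=
    (mul_le_mul_of_nonneg_left hbm hp0).trans (key2.trans hc)
  have h5 : Real.exp (l ^ 2) = Real.exp (-19 * l ^ 2) * Real.exp (20 * l ^ 2) := by
    rw [← Real.exp_add]; congr 1; ring
  rw [h5] at this
  exact le_of_mul_le_mul_right this (Real.exp_pos _)

theorem probGraph_mono {P Q : Graph n → Prop} (h : ∀ G, P G → Q G) : probGraph n P ≤ probGraph n Q := by
  unfold probGraph
  gcongr with G
  exact h G

theorem probGraph_or (P Q : Graph n → Prop) :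
    probGraph n (fun G => P G ∨ Q G) ≤ probGraph n P + probGraph n Q := by
  unfold probGraph
  rw [← add_div]
  gcongr
  rw [← Nat.cast_add, Nat.cast_le]
  refine le_trans (card_le_card ?_) (card_union_le _ _)
  intro G hG
  simpa using hG

theorem probGraph_exists {ι : Type*} (F : Finset ι) (P : ι → Graph n → Prop) (x : ℝ)
    (h : ∀ i ∈ F, probGraph n (P i) ≤ x) :
    probGraph n (fun G => ∃ i ∈ F, P i G) ≤ F.card * x := by
  induction F using Finset.induction_on with
  | empty => simp [probGraph]
  | insert i F hi ih =>
    have h1 := ih fun j hj => h j (mem_insert_of_mem hj)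
    have h2 := h i (mem_insert_self _ _)
    have h3 : probGraph n (fun G => ∃ j ∈ insert i F, P j G) ≤ _ :=
      (probGraph_mono (Q := fun G => P i G ∨ ∃ j ∈ F, P j G) (by
        rintro G ⟨j, hj, hG⟩
        rcases mem_insert.1 hj with rfl | hj
        · exact Or.inl hG
        · exact Or.inr ⟨j, hj, hG⟩)).trans (probGraph_or _ _)
    rw [card_insert_of_notMem hi]
    push_cast
    linarith

theorem probGraph_compl (P : Graph n → Prop) : 1 - probGraph n (fun G => ¬ P G) ≤ probGraph n P := by
  have h := probGraph_or P (fun G => ¬ P G)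
  have h1 : probGraph n (fun G => P G ∨ ¬ P G) = 1 := by
    unfold probGraph
    simp [em]
  linarith

/-- norm bound for a class -/
noncomputable def bd (n : ℕ) (b : ℝ) (e r : ℕ) : ℝ := b * √(n : ℝ) ^ e * b ^ r

structure Good (G : Graph n) (d τ : ℕ) (b : ℝ) : Prop where
  hL : ∀ i a0 a, i ≤ τ → a0 ≤ d → a ≤ d →
    ‖gmat G (cL d i a0 a)‖ ≤ bd n b i ((a + i - a0) + i)
  hG : ∀ w a' a, w ≤ τ → a' ≤ d → a ≤ d → a' ≤ a + w →
    ‖gmat G (cG d w a' a)‖ ≤ bd n b (a + w - a') ((a + w - a') + w)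
  hH : ∀ u a a', u ≤ τ → a ≤ d → a' ≤ d → a' ≤ u →
    ‖gmat G (cH d u a a')‖ ≤ bd n b (u - a') ((u - a) + (u - a'))

theorem good_prob (hn : 0 < n) (d τ : ℕ) (l b : ℝ) (hl : l = Real.log n) (hl1 : 1000 ≤ l)
    (hd : d ≤ τ) (hv : 2000 * (τ : ℝ) ≤ l) (hb : Real.exp 2 ≤ b)
    (hb2 : l ^ 4 * 2 ^ (2 * τ + 1) ≤ b) :
    probGraph n (fun G => ¬ Good G d τ b) ≤ Real.exp (-10 * l ^ 2) := by
  have tail : ∀ {c : PR n → PR n → Finset (Edge n) → Prop} {v s a a' : ℕ}, GMC c v s a a' →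
      s ≤ v → v ≤ 2 * τ →
      probGraph n (fun G => b * √(n : ℝ) ^ (v - s) * b ^ ((v - a) + (v - a')) < ‖gmat G c‖)
      ≤ Real.exp (-19 * l ^ 2) := by
    intro c v s a a' h hs hvv
    have hv' : (v : ℝ) ≤ 2 * τ := by exact_mod_cast hvv
    refine h.tail hn hs l b hl hl1 (by linarith) hb (le_trans ?_ hb2)
    gcongr
    norm_num
  set F : Finset (ℕ × ℕ × ℕ) := (range (τ + 1)) ×ˢ ((range (τ + 1)) ×ˢ (range (τ + 1))) with hF
  have hcF : (F.card : ℝ) ≤ l ^ 3 := by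
    have h1 : F.card = (τ + 1) ^ 3 := by rw [hF]; simp [card_product]; ring
    rw [h1]
    push_cast
    gcongr
    linarith
  have memF : ∀ i j k, i ≤ τ → j ≤ τ → k ≤ τ → (i, j, k) ∈ F := by
    intro i j k hi hj hk
    simp [hF]; omega
  have memF' : ∀ t ∈ F, t.1 ≤ τ ∧ t.2.1 ≤ τ ∧ t.2.2 ≤ τ := by
    intro t ht
    simp [hF] at ht; omega
  set P1 : ℕ × ℕ × ℕ → Graph n → Prop := fun t G =>
    bd n b t.1 ((t.2.2 + t.1 - t.2.1) + t.1) < ‖gmat G (cL d t.1 t.2.1 t.2.2)‖ with hP1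
  set P2 : ℕ × ℕ × ℕ → Graph n → Prop := fun t G => t.2.1 ≤ t.2.2 + t.1 ∧
    bd n b (t.2.2 + t.1 - t.2.1) ((t.2.2 + t.1 - t.2.1) + t.1) < ‖gmat G (cG d t.1 t.2.1 t.2.2)‖
    with hP2
  set P3 : ℕ × ℕ × ℕ → Graph n → Prop := fun t G => t.2.2 ≤ t.1 ∧
    bd n b (t.1 - t.2.2) ((t.1 - t.2.1) + (t.1 - t.2.2)) < ‖gmat G (cH d t.1 t.2.1 t.2.2)‖
    with hP3
  have hx : 0 ≤ Real.exp (-19 * l ^ 2) := (Real.exp_pos _).le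
  have zero : probGraph n (fun _ => False) = 0 := by simp [probGraph]
  have q1 := probGraph_exists F P1 _ (fun t ht => by
    obtain ⟨h1, h2, h3⟩ := memF' t ht
    have := tail (gmc_L (n := n) d t.1 t.2.1 t.2.2) (by omega) (by omega)
    rw [Nat.add_sub_cancel_left] at this
    exact this)
  have q2 := probGraph_exists F P2 _ (fun t ht => by
    obtain ⟨h1, h2, h3⟩ := memF' t ht
    by_cases hc : t.2.1 ≤ t.2.2 + t.1
    · have := tail (gmc_G (n := n) d t.1 t.2.1 t.2.2) (by omega) (by omega)
      rw [Nat.add_sub_cancel_left] at this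
      exact (probGraph_mono fun G hG => hG.2).trans this
    · refine le_trans (probGraph_mono (Q := fun _ => False) fun G hG => hc hG.1) (by rw [zero]; exact hx))
  have q3 := probGraph_exists F P3 _ (fun t ht => by
    obtain ⟨h1, h2, h3⟩ := memF' t ht
    by_cases hc : t.2.2 ≤ t.1
    · have := tail (gmc_H (n := n) d t.1 t.2.1 t.2.2) (by omega) (by omega)
      exact (probGraph_mono fun G hG => hG.2).trans this
    · refine le_trans (probGraph_mono (Q := fun _ => False) fun G hG => hc hG.1) (by rw [zero]; exact hx))
  have main : probGraph n (fun G => ¬ Good G d τ b) ≤ 3 * (F.card * Real.exp (-19 * l ^ 2)) := by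
    refine le_trans (probGraph_mono (Q := fun G => (∃ t ∈ F, P1 t G) ∨ ((∃ t ∈ F, P2 t G) ∨
      (∃ t ∈ F, P3 t G))) ?_) ?_
    · intro G hG
      by_contra hcon
      push Not at hcon
      obtain ⟨c1, c2, c3⟩ := hcon
      apply hG
      refine ⟨?_, ?_, ?_⟩
      · intro i a0 a hi ha0 ha
        exact not_lt.1 (c1 (i, a0, a) (memF _ _ _ hi (by omega) (by omega)))
      · intro i a0 a hi ha0 ha hh
        by_contra hlt
        exact c2 (i, a0, a) (memF _ _ _ hi (by omega) (by omega)) ⟨hh, not_le.1 hlt⟩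
      · intro i a0 a hi ha0 ha hh
        by_contra hlt
        exact c3 (i, a0, a) (memF _ _ _ hi (by omega) (by omega)) ⟨hh, not_le.1 hlt⟩
    · have h1 := probGraph_or (fun G => ∃ t ∈ F, P1 t G) (fun G => (∃ t ∈ F, P2 t G) ∨
        (∃ t ∈ F, P3 t G))
      have h2 := probGraph_or (fun G => ∃ t ∈ F, P2 t G) (fun G => ∃ t ∈ F, P3 t G)
      linarith
  refine main.trans ?_
  have h3 : 3 * (F.card : ℝ) ≤ Real.exp (4 * l) := by
    have hlexp : l ≤ Real.exp l := by linarith [Real.add_one_le_exp l]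
    calc 3 * (F.card : ℝ) ≤ l * l ^ 3 := by gcongr; linarith
      _ = l ^ 4 := by ring
      _ ≤ Real.exp l ^ 4 := by gcongr
      _ = _ := by rw [← Real.exp_nat_mul]; push_cast; rfl
  calc 3 * (F.card * Real.exp (-19 * l ^ 2)) = 3 * F.card * Real.exp (-19 * l ^ 2) := by ring
    _ ≤ Real.exp (4 * l) * Real.exp (-19 * l ^ 2) := by gcongr
    _ = Real.exp (4 * l + -19 * l ^ 2) := by rw [Real.exp_add]
    _ ≤ _ := Real.exp_le_exp.2 (by nlinarith)

end event


structure Par (n d τ : ℕ) (α b : ℝ) : Prop where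
  hn : 1 ≤ n
  hb : 100 ≤ b
  hα : 0 < α
  hα1 : α * √(n : ℝ) * b ^ 40 = 1
  hαn : 1 ≤ α * n
  hd : (n : ℝ) ^ d ≤ b ^ τ
  hdτ : 2 * d ≤ τ
  hτ : (τ : ℝ) + 1 ≤ b
  h2 : (2 : ℝ) ^ τ ≤ b

noncomputable def thi (d : ℕ) (α : ℝ) (a : ℕ) : ℝ :=
  if a ≤ d then √α ^ a * √2 ^ (a.choose 2) else 1

section scalar
variable {n d τ : ℕ} {α b : ℝ}

theorem thi_pos (hα : 0 < α) (a : ℕ) : 0 < thi d α a := by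
  unfold thi
  split_ifs
  · have := Real.sqrt_pos.2 hα
    positivity
  · norm_num

namespace Par

theorem b1 (P : Par n d τ α b) : 1 ≤ b := by linarith [P.hb]
theorem b0 (P : Par n d τ α b) : 0 < b := by linarith [P.hb]
theorem nr (P : Par n d τ α b) : (1 : ℝ) ≤ n := by exact_mod_cast P.hn
theorem R1 (P : Par n d τ α b) : 1 ≤ √(n : ℝ) := Real.one_le_sqrt.2 P.nr
theorem c0 (P : Par n d τ α b) : 0 < √α := Real.sqrt_pos.2 P.hα
theorem csq (P : Par n d τ α b) : √α * √α = α := Real.mul_self_sqrt P.hα.le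
theorem aR (P : Par n d τ α b) : α * √(n : ℝ) = (b⁻¹) ^ 40 := by
  rw [inv_pow]
  exact eq_inv_of_mul_eq_one_left P.hα1

theorem cR (P : Par n d τ α b) : 1 ≤ √α * √(n : ℝ) := by
  rw [← Real.sqrt_mul P.hα.le]
  exact Real.one_le_sqrt.2 P.hαn

theorem d1 (P : Par n d τ α b) : (d : ℝ) + 1 ≤ b := by
  have h1 : d ≤ τ := by have := P.hdτ; omega
  have h2 : (d : ℝ) ≤ τ := by exact_mod_cast h1
  linarith [P.hτ]

theorem ab (P : Par n d τ α b) : α * b ≤ 1 := by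
  have h := P.hα1
  have h1 : b ≤ √(n : ℝ) * b ^ 40 := by
    calc b = 1 * b ^ 1 := by ring
      _ ≤ √(n : ℝ) * b ^ 40 := by
        have := P.R1
        have hb := P.b1
        gcongr
        norm_num
  calc α * b ≤ α * (√(n : ℝ) * b ^ 40) := by
        have := P.hα.le
        gcongr
    _ = 1 := by rw [← h]; ring

theorem a1 (P : Par n d τ α b) : α ≤ 1 := by
  have h := P.ab
  have := P.hα
  nlinarith [P.b1]

theorem thi_le_one (P : Par n d τ α b) (a : ℕ) : thi d α a ≤ 1 := by
  unfold thi
  split_ifs with h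
  · have h2 : (2 : ℝ) ^ d ≤ b := le_trans (pow_le_pow_right₀ (by norm_num) (by have := P.hdτ; omega)) P.h2
    have hc := P.c0
    have h3 : √2 ^ (a.choose 2) ≤ (√2 ^ d) ^ a := by
      rw [← pow_mul]
      apply pow_le_pow_right₀ (Real.one_le_sqrt.2 (by norm_num))
      rw [Nat.choose_two_right]
      refine (Nat.div_le_self _ _).trans ?_
      rw [mul_comm]
      exact Nat.mul_le_mul (by omega) le_rfl
    calc √α ^ a * √2 ^ (a.choose 2) ≤ √α ^ a * (√2 ^ d) ^ a := by gcongr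
      _ = (√α * √2 ^ d) ^ a := by rw [mul_pow]
      _ ≤ 1 := by
        apply pow_le_one₀ (by positivity)
        rw [← abs_of_pos (show (0:ℝ) < √α * √2 ^ d by positivity)]
        rw [← sq_le_one_iff_abs_le_one, mul_pow, ← pow_mul, mul_comm d, pow_mul,
          Real.sq_sqrt P.hα.le, Real.sq_sqrt (by norm_num)]
        exact le_trans (by have := P.hα.le; gcongr) P.ab
  · exact le_rfl

theorem thi_ge (P : Par n d τ α b) (a : ℕ) : α ^ d ≤ thi d α a * thi d α a := by
  unfold thi
  have ha := P.hα
  split_ifs with h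
  · have h1 : 1 ≤ √2 ^ (a.choose 2) := one_le_pow₀ (Real.one_le_sqrt.2 (by norm_num))
    calc α ^ d ≤ α ^ a := pow_le_pow_of_le_one P.hα.le P.a1 h
      _ = √α ^ a * √α ^ a := by rw [← mul_pow, P.csq]
      _ ≤ (√α ^ a * √2 ^ (a.choose 2)) * (√α ^ a * √2 ^ (a.choose 2)) := by
        have : √α ^ a ≤ √α ^ a * √2 ^ (a.choose 2) := le_mul_of_one_le_right (by positivity) h1
        gcongr
  · rw [one_mul]
    exact pow_le_one₀ P.hα.le P.a1

theorem base (P : Par n d τ α b) (i e r : ℕ) (hr : r ≤ 2 * i) (k : ℕ) (hk : k + e = i)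
    (x : ℝ) (hx : x ≤ (√α ^ k)⁻¹) :
    α ^ i * x * bd n b e r ≤ b * ((b⁻¹) ^ 38) ^ i := by
  have hb := P.b0
  have hb1 := P.b1
  have hc := P.c0
  have hα := P.hα
  have hR : 0 < √(n : ℝ) := by linarith [P.R1]
  have h1 : α ^ i * (√α ^ k)⁻¹ * √(n : ℝ) ^ e ≤ ((b⁻¹) ^ 40) ^ i := by
    rw [← P.aR, mul_pow α]
    have e1 : √(n : ℝ) ^ i = √(n : ℝ) ^ k * √(n : ℝ) ^ e := by rw [← hk, pow_add]
    rw [e1, mul_assoc]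
    apply mul_le_mul_of_nonneg_left _ (by positivity)
    apply mul_le_mul_of_nonneg_right _ (by positivity)
    rw [inv_le_iff_one_le_mul₀ (by positivity), mul_comm, ← mul_pow]
    exact one_le_pow₀ P.cR
  have h2 : b ^ r ≤ (b ^ 2) ^ i := by
    rw [← pow_mul]
    exact pow_le_pow_right₀ hb1 hr
  unfold bd
  calc α ^ i * x * (b * √(n : ℝ) ^ e * b ^ r)
      ≤ α ^ i * (√α ^ k)⁻¹ * (b * √(n : ℝ) ^ e * b ^ r) := by gcongr
    _ = b * (α ^ i * (√α ^ k)⁻¹ * √(n : ℝ) ^ e) * b ^ r := by ring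
    _ ≤ b * ((b⁻¹) ^ 40) ^ i * (b ^ 2) ^ i := by gcongr
    _ = b * ((b⁻¹) ^ 38) ^ i := by
      rw [mul_assoc, ← mul_pow]
      congr 2
      field_simp

theorem thi_ratio (P : Par n d τ α b) {a a' : ℕ} (h : a ≤ a') (h' : a' ≤ d) :
    (thi d α a')⁻¹ * thi d α a ≤ (√α ^ (a' - a))⁻¹ := by
  have hc := P.c0
  unfold thi
  rw [if_pos h', if_pos (h.trans h')]
  have e1 : √α ^ a' = √α ^ (a' - a) * √α ^ a := by rw [← pow_add, Nat.sub_add_cancel h]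
  have h1 : √2 ^ (a.choose 2) ≤ √2 ^ (a'.choose 2) :=
    pow_le_pow_right₀ (Real.one_le_sqrt.2 (by norm_num)) (Nat.choose_le_choose 2 h)
  rw [inv_mul_le_iff₀ (by positivity), e1]
  have : √α ^ (a' - a) * √α ^ a * √2 ^ a'.choose 2 * (√α ^ (a' - a))⁻¹ = √α ^ a * √2 ^ a'.choose 2 := by
    field_simp
  rw [this]
  gcongr

theorem thi_prod (P : Par n d τ α b) {a a' : ℕ} (h : a ≤ a') (h' : a' ≤ d) :
    (thi d α a)⁻¹ * (thi d α a')⁻¹ * 2 ^ (a.choose 2) ≤ (√α ^ (a + a'))⁻¹ := by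
  have hc := P.c0
  unfold thi
  rw [if_pos h', if_pos (h.trans h')]
  have h1 : √2 ^ (a.choose 2) ≤ √2 ^ (a'.choose 2) :=
    pow_le_pow_right₀ (Real.one_le_sqrt.2 (by norm_num)) (Nat.choose_le_choose 2 h)
  have e2 : (2 : ℝ) ^ (a.choose 2) = √2 ^ (a.choose 2) * √2 ^ (a.choose 2) := by
    rw [← mul_pow, Real.mul_self_sqrt (by norm_num)]
  rw [← mul_inv, inv_mul_le_iff₀ (by positivity), e2, pow_add]
  have : √α ^ a * √2 ^ a.choose 2 * (√α ^ a' * √2 ^ a'.choose 2) * (√α ^ a * √α ^ a')⁻¹ =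
    √2 ^ a.choose 2 * √2 ^ a'.choose 2 := by
    field_simp
  rw [this]
  gcongr

theorem thi_diag (P : Par n d τ α b) {u : ℕ} (h' : u ≤ d) :
    α ^ u * ((thi d α u)⁻¹ * (thi d α u)⁻¹ * 2 ^ (u.choose 2)) = 1 := by
  have hc := P.c0
  unfold thi
  rw [if_pos h']
  have e2 : (2 : ℝ) ^ (u.choose 2) = √2 ^ (u.choose 2) * √2 ^ (u.choose 2) := by
    rw [← mul_pow, Real.mul_self_sqrt (by norm_num)]
  have e3 : α ^ u = √α ^ u * √α ^ u := by rw [← mul_pow, P.csq]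
  rw [e2, e3]
  field_simp

theorem baseH (P : Par n d τ α b) (u a a' : ℕ) (h : a ≤ a') (hu : a' ≤ u)
    (x : ℝ) (hx : x ≤ (√α ^ (a + a'))⁻¹) :
    α ^ u * x * bd n b (u - a') ((u - a) + (u - a')) ≤ b * ((b⁻¹) ^ 19) ^ ((u - a) + (u - a')) := by
  have hb := P.b0
  have hb1 := P.b1
  have hc := P.c0
  have hα := P.hα
  have hR1 := P.R1
  have hR : 0 < √(n : ℝ) := by linarith [P.R1]
  set r := (u - a) + (u - a') with hr
  have hrho : 0 < √√(n : ℝ) := Real.sqrt_pos.2 hR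
  have hrho1 : 1 ≤ √√(n : ℝ) := Real.one_le_sqrt.2 hR1
  have e1 : √(n : ℝ) ^ (u - a') ≤ √√(n : ℝ) ^ r := by
    have : √(n : ℝ) ^ (u - a') = √√(n : ℝ) ^ (2 * (u - a')) := by
      rw [pow_mul, Real.sq_sqrt hR.le]
    rw [this]
    exact pow_le_pow_right₀ hrho1 (by omega)
  have e2 : α ^ u * (√α ^ (a + a'))⁻¹ = √α ^ r := by
    have : α ^ u = √α ^ r * √α ^ (a + a') := by
      rw [← pow_add]
      have : r + (a + a') = 2 * u := by omega
      rw [this, pow_mul, Real.sq_sqrt hα.le]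
    rw [this]; field_simp
  have e3 : √α * √√(n : ℝ) = (b⁻¹) ^ 20 := by
    rw [← Real.sqrt_mul hα.le, P.aR]
    rw [show (b⁻¹) ^ 40 = ((b⁻¹) ^ 20) ^ 2 by rw [← pow_mul]]
    exact Real.sqrt_sq (by positivity)
  unfold bd
  calc α ^ u * x * (b * √(n : ℝ) ^ (u - a') * b ^ r)
      ≤ α ^ u * (√α ^ (a + a'))⁻¹ * (b * √√(n : ℝ) ^ r * b ^ r) := by gcongr
    _ = b * ((√α * √√(n : ℝ)) * b) ^ r := by rw [e2, mul_pow, mul_pow]; ring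
    _ = _ := by rw [e3]; congr 2; field_simp


end Par
end scalar

section blocks
open scoped Matrix.Norms.L2Operator
variable {n : ℕ}

theorem norm_diag_le {κ : Type*} [Fintype κ] [DecidableEq κ] (f : κ → ℝ) (B : ℝ) (hB : 0 ≤ B)
    (h : ∀ i, |f i| ≤ B) : ‖(Matrix.diagonal f : Matrix κ κ ℝ)‖ ≤ B := by
  rw [Matrix.l2_opNorm_diagonal]
  exact (pi_norm_le_iff_of_nonneg hB).2 h

theorem gmat_zero (G : Graph n) (c : PR n → PR n → Finset (Edge n) → Prop)
    (h : ∀ x y T, ¬ c x y T) : gmat G c = 0 := by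
  ext x y
  simp [gmat, sumChi, h]

theorem sumChi_and (G : Graph n) (c : Finset (Edge n) → Prop) (p : Prop) :
    sumChi G (fun T => c T ∧ p) = if p then sumChi G c else 0 := by
  by_cases h : p
  · simp only [h, and_true, if_true]
  · simp [h, sumChi]

theorem sumChi_false (G : Graph n) (c : Finset (Edge n) → Prop) (h : ∀ T, ¬ c T) :
    sumChi G c = 0 := by
  simp [h, sumChi]

theorem block_sum (d : ℕ) (G : Graph n) (x y : PR n) (c : Finset (Edge n) → Prop) (F : ℕ → ℕ → ℝ)
    (hc : ∀ T, c T → x.1.card ≤ d ∧ y.1.card ≤ d) :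
    F x.1.card y.1.card * sumChi G c = ∑ p ∈ range (d + 1) ×ˢ range (d + 1),
      F p.1 p.2 * sumChi G (fun T => c T ∧ (x.1.card = p.1 ∧ y.1.card = p.2)) := by
  by_cases h : x.1.card ≤ d ∧ y.1.card ≤ d
  · rw [Finset.sum_eq_single (x.1.card, y.1.card)]
    · rw [sumChi_and, if_pos ⟨rfl, rfl⟩]
    · rintro ⟨p, q⟩ _ hne
      rw [sumChi_and, if_neg, mul_zero]
      rintro ⟨h1, h2⟩
      exact hne (Prod.ext h1.symm h2.symm)
    · intro hh
      exfalso; apply hh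
      simp only [mem_product, mem_range]; omega
  · rw [sumChi_false G c (fun T hT => h (hc T hT)), mul_zero, Finset.sum_eq_zero]
    intro p _
    rw [sumChi_false _ _ (fun T hT => h (hc T hT.1)), mul_zero]

theorem norm_block_sum {κ ι : Type*} [Fintype κ] [DecidableEq κ] (F : Finset ι)
    (f : ι → ℝ) (A : ι → Matrix κ κ ℝ) (B N : ℝ) (hB : 0 ≤ B) (hN : (F.card : ℝ) ≤ N)
    (h : ∀ i ∈ F, ‖f i • A i‖ ≤ B) : ‖∑ i ∈ F, f i • A i‖ ≤ N * B := by
  refine (norm_sum_le _ _).trans ((Finset.sum_le_sum h).trans ?_)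
  rw [sum_const, nsmul_eq_mul]
  gcongr

end blocks


section scaled
open scoped Matrix.Norms.L2Operator
variable {n : ℕ}

noncomputable def Sg (n : ℕ) : Matrix (PR n) (PR n) ℝ := Matrix.diagonal fun x => (-1) ^ x.2.card
noncomputable def pi0 (n : ℕ) : Matrix (PR n) (PR n) ℝ :=
  Matrix.diagonal fun x => if x.2 = ∅ then 1 else 0
noncomputable def PiC (G : Graph n) : Matrix (PR n) (PR n) ℝ :=
  Matrix.diagonal fun x => if Clq G x.1 then 1 else 0
noncomputable def Ed (n d : ℕ) : Matrix (PR n) (PR n) ℝ :=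
  Matrix.diagonal fun x => if x.2 = ∅ ∧ x.1.card ≤ d then 1 else 0
noncomputable def Eu (n d u : ℕ) : Matrix (PR n) (PR n) ℝ :=
  Matrix.diagonal fun x => if x.2 = ∅ ∧ x.1.card = u ∧ u ≤ d then 1 else 0
noncomputable def Th (n d : ℕ) (α : ℝ) : Matrix (PR n) (PR n) ℝ :=
  Matrix.diagonal fun x => (thi d α x.1.card)⁻¹
noncomputable def Ti (n d : ℕ) (α : ℝ) : Matrix (PR n) (PR n) ℝ :=
  Matrix.diagonal fun x => thi d α x.1.card

noncomputable def gS (d : ℕ) (α : ℝ) (G : Graph n) (w : ℕ) : Matrix (PR n) (PR n) ℝ :=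
  α ^ w • (Th n d α * Gam d G w * Ti n d α)
noncomputable def hS (d : ℕ) (α : ℝ) (G : Graph n) (w : ℕ) : Matrix (PR n) (PR n) ℝ :=
  α ^ w • (Th n d α * Hm d G w * Th n d α)
noncomputable def lS (d : ℕ) (α : ℝ) (G : Graph n) (w : ℕ) : Matrix (PR n) (PR n) ℝ :=
  α ^ w • (Lh d G w * pi0 n)

theorem norm_Sg : ‖Sg n‖ ≤ 1 := by
  apply norm_diag_le _ _ zero_le_one
  intro x; simp [abs_pow]
theorem norm_pi0 : ‖pi0 n‖ ≤ 1 := by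
  apply norm_diag_le _ _ zero_le_one
  intro x; split_ifs <;> simp
theorem norm_pi0' : ‖1 - pi0 n‖ ≤ 1 := by
  have : 1 - pi0 n = Matrix.diagonal fun x => if x.2 = ∅ then 0 else 1 := by
    unfold pi0
    rw [← Matrix.diagonal_one, Matrix.diagonal_sub]
    congr 1
    ext x
    split_ifs <;> simp
  rw [this]
  apply norm_diag_le _ _ zero_le_one
  intro x; split_ifs <;> simp
theorem norm_PiC (G : Graph n) : ‖PiC G‖ ≤ 1 := by
  apply norm_diag_le _ _ zero_le_one
  intro x; split_ifs <;> simp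
theorem norm_Ed (d : ℕ) : ‖Ed n d‖ ≤ 1 := by
  apply norm_diag_le _ _ zero_le_one
  intro x; split_ifs <;> simp
theorem norm_Eu (d u : ℕ) : ‖Eu n d u‖ ≤ 1 := by
  apply norm_diag_le _ _ zero_le_one
  intro x; split_ifs <;> simp

theorem gS_apply (d : ℕ) (α : ℝ) (G : Graph n) (w : ℕ) (x y : PR n) :
    gS d α G w x y = α ^ w * ((thi d α x.1.card)⁻¹ * Gam d G w x y * thi d α y.1.card) := by
  simp [gS, Th, Ti, Matrix.mul_diagonal, Matrix.diagonal_mul]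

theorem hS_apply (d : ℕ) (α : ℝ) (G : Graph n) (w : ℕ) (x y : PR n) :
    hS d α G w x y = α ^ w * ((thi d α x.1.card)⁻¹ * Hm d G w x y * (thi d α y.1.card)⁻¹) := by
  simp [hS, Th, Matrix.mul_diagonal, Matrix.diagonal_mul]

theorem gS_zero (d : ℕ) (α : ℝ) (hα : 0 < α) (G : Graph n) : gS d α G 0 = Ed n d := by
  ext x y
  rw [gS_apply]
  unfold Gam
  rw [GC_zero]
  have hp := (thi_pos (d := d) hα x.1.card).ne'
  unfold Ed
  by_cases hxy : x = y
  · subst hxy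
    rw [Matrix.diagonal_apply_eq]
    by_cases h : x.2 = ∅ ∧ x.1.card ≤ d
    · rw [if_pos h, if_pos ⟨rfl, h⟩, h.1]
      simp [hp]
    · rw [if_neg h, if_neg (fun h' => h h'.2)]
      simp
  · rw [Matrix.diagonal_apply_ne _ hxy, if_neg (fun h' => hxy h'.1)]
    simp

theorem gS_block (d : ℕ) (α : ℝ) (G : Graph n) (w : ℕ) :
    gS d α G w = Sg n * ∑ p ∈ range (d + 1) ×ˢ range (d + 1),
      (α ^ w * ((thi d α p.1)⁻¹ * thi d α p.2)) • gmat G (cG d w p.1 p.2) := by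
  ext x y
  rw [gS_apply, Sg, Matrix.diagonal_mul, Matrix.sum_apply]
  simp only [Matrix.smul_apply, smul_eq_mul]
  have := block_sum d G x y (GC d x y w) (fun p q => α ^ w * ((thi d α p)⁻¹ * thi d α q))
    (fun T hT => by
      have h1 := hT.2.1.1
      have h2 := hT.2.1.2.1.card_le
      exact ⟨h1, h2.trans h1⟩)
  change _ = _ * ∑ p ∈ range (d + 1) ×ˢ range (d + 1), (α ^ w * ((thi d α p.1)⁻¹ * thi d α p.2)) *
    sumChi G (fun T => GC d x y w T ∧ (x.1.card = p.1 ∧ y.1.card = p.2))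
  rw [← this]
  unfold Gam
  ring

theorem lS_apply (d : ℕ) (α : ℝ) (G : Graph n) (w : ℕ) (x y : PR n) :
    lS d α G w x y = α ^ w * (Lh d G w x y * if y.2 = ∅ then 1 else 0) := by
  simp [lS, pi0, Matrix.mul_diagonal]

theorem lS_zero (d : ℕ) (α : ℝ) (G : Graph n) : lS d α G 0 = Ed n d := by
  ext x y
  rw [lS_apply]
  unfold Lh Ed
  rw [LC_zero]
  by_cases hxy : x = y
  · subst hxy
    rw [Matrix.diagonal_apply_eq]
    by_cases h : x.2 = ∅ ∧ x.1.card ≤ d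
    · rw [if_pos h, if_pos h, if_pos ⟨rfl, h.1⟩, h.1]
      simp
    · rw [if_neg h, if_neg h]
      simp
  · rw [Matrix.diagonal_apply_ne _ hxy]
    have : ¬ ((x.2 = ∅ ∧ x.1.card ≤ d) ∧ (x.1 = y.1 ∧ y.2 = ∅)) := by
      rintro ⟨⟨h1, _⟩, h2, h3⟩
      exact hxy (Prod.ext h2 (h1.trans h3.symm))
    by_cases h : x.2 = ∅ ∧ x.1.card ≤ d
    · rw [if_pos h, if_neg (fun h' => this ⟨h, h'⟩)]; simp
    · rw [if_neg h]; simp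

theorem lS_block (d : ℕ) (α : ℝ) (G : Graph n) (w : ℕ) :
    lS d α G w = ∑ p ∈ range (d + 1) ×ˢ range (d + 1), (α ^ w) • gmat G (cL d w p.1 p.2) := by
  ext x y
  rw [lS_apply, Matrix.sum_apply]
  simp only [Matrix.smul_apply, smul_eq_mul]
  set c : Finset (Edge n) → Prop := fun T => LC x.1 y w T ∧ (x.2 = ∅ ∧ y.2 = ∅ ∧ x.1.card ≤ d)
    with hc
  have := block_sum d G x y c (fun p q => α ^ w)
    (fun T hT => by
      have h1 := hT.2.2.2
      have h2 := hT.1.1.card_le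
      exact ⟨h1, h2.trans h1⟩)
  have e : ∀ p : ℕ × ℕ, gmat G (cL d w p.1 p.2) x y =
      sumChi G (fun T => c T ∧ (x.1.card = p.1 ∧ y.1.card = p.2)) := by
    intro p
    apply sumChi_congr
    intro T
    simp only [hc, cL]
    tauto
  simp only [e]
  rw [← this, hc, sumChi_and]
  unfold Lh
  by_cases h1 : x.2 = ∅ <;> by_cases h2 : y.2 = ∅ <;> by_cases h3 : x.1.card ≤ d <;> simp [h1, h2, h3]

theorem lS_Ed (d : ℕ) (α : ℝ) (G : Graph n) (w : ℕ) : lS d α G w * Ed n d = lS d α G w := by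
  ext x y
  rw [Ed, Matrix.mul_diagonal]
  by_cases h : y.2 = ∅ ∧ y.1.card ≤ d
  · rw [if_pos h, mul_one]
  · rw [if_neg h, mul_zero, lS_block, Matrix.sum_apply, Finset.sum_eq_zero]
    intro p _
    rw [Matrix.smul_apply]
    have : gmat G (cL d w p.1 p.2) x y = 0 := by
      apply sumChi_false
      intro T hT
      have h1 := cL_le hT
      apply h
      refine ⟨hT.1.2.1, ?_⟩
      have := hT.1.2.2.2.1
      omega
    rw [this, smul_zero]

variable {d τ : ℕ} {α b : ℝ}

theorem Par.fin (P : Par n d τ α b) (w : ℕ) (hw : 1 ≤ w) :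
    b ^ 2 * (b * ((b⁻¹) ^ 38) ^ w) ≤ ((b⁻¹) ^ 30) ^ w := by
  have hb := P.b0
  have h1 : b ^ 3 ≤ (b ^ 3) ^ w := le_self_pow₀ (one_le_pow₀ P.b1) (by omega)
  have h2 : b⁻¹ ≤ 1 := inv_le_one_of_one_le₀ P.b1
  calc b ^ 2 * (b * ((b⁻¹) ^ 38) ^ w) = b ^ 3 * ((b⁻¹) ^ 38) ^ w := by ring
    _ ≤ (b ^ 3) ^ w * ((b⁻¹) ^ 38) ^ w := by gcongr
    _ = ((b⁻¹) ^ 35) ^ w := by rw [← mul_pow]; congr 1; field_simp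
    _ ≤ _ := by
      apply pow_le_pow_left₀ (by positivity)
      exact pow_le_pow_of_le_one (by positivity) h2 (by norm_num)

theorem Par.card (P : Par n d τ α b) : (((range (d + 1) ×ˢ range (d + 1)).card : ℕ) : ℝ) ≤ b ^ 2 := by
  rw [card_product, card_range]
  push_cast
  rw [sq]
  have := P.d1
  have := P.b0.le
  gcongr

theorem gS_norm (P : Par n d τ α b) {G : Graph n} (hG : Good G d τ b) (w : ℕ) (hw : w ≤ τ) :
    ‖gS d α G w‖ ≤ ((b⁻¹) ^ 30) ^ w := by
  have hb := P.b0
  have hα := P.hα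
  rcases Nat.eq_zero_or_pos w with rfl | hw1
  · rw [gS_zero d α P.hα, pow_zero]; exact norm_Ed d
  rw [gS_block]
  refine (norm_mul_le _ _).trans ?_
  refine (mul_le_of_le_one_left (norm_nonneg _) norm_Sg).trans (le_trans ?_ (P.fin w hw1))
  refine norm_block_sum _ _ _ _ _ (by positivity) P.card ?_
  rintro ⟨a', a⟩ hp
  simp only [mem_product, mem_range] at hp
  have ht := thi_pos (d := d) hα a'
  have ht' := thi_pos (d := d) hα a
  rw [norm_smul, Real.norm_of_nonneg (by positivity)]
  by_cases hc : a ≤ a' ∧ a' ≤ a + w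
  · have h1 := hG.hG w a' a hw (by omega) (by omega) hc.2
    refine (mul_le_mul_of_nonneg_left h1 (by positivity)).trans ?_
    exact P.base w (a + w - a') _ (by omega) (a' - a) (by omega) _ (P.thi_ratio hc.1 (by omega))
  · rw [gmat_zero G _ (fun x y T hT => hc ⟨(cG_le hT).1, (cG_le hT).2.2⟩), norm_zero, mul_zero]
    positivity

theorem lS_norm (P : Par n d τ α b) {G : Graph n} (hG : Good G d τ b) (w : ℕ) (hw : w ≤ τ) :
    ‖lS d α G w‖ ≤ ((b⁻¹) ^ 30) ^ w := by
  have hb := P.b0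
  have hα := P.hα
  rcases Nat.eq_zero_or_pos w with rfl | hw1
  · rw [lS_zero d α, pow_zero]; exact norm_Ed d
  rw [lS_block]
  refine le_trans ?_ (P.fin w hw1)
  refine norm_block_sum _ _ _ _ _ (by positivity) P.card ?_
  rintro ⟨a', a⟩ hp
  simp only [mem_product, mem_range] at hp
  rw [norm_smul, Real.norm_of_nonneg (by positivity)]
  by_cases hc : a ≤ a'
  · have h1 := hG.hL w a' a hw (by omega) (by omega)
    refine (mul_le_mul_of_nonneg_left h1 (by positivity)).trans ?_
    have := P.base w w ((a + w - a') + w) (by omega) 0 (by omega) 1 (by simp)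
    rwa [mul_one] at this
  · rw [gmat_zero G _ (fun x y T hT => hc (cL_le hT).1), norm_zero, mul_zero]
    positivity

/-- the off-diagonal part of `hS` -/
noncomputable def zS (d : ℕ) (α : ℝ) (G : Graph n) (u : ℕ) : Matrix (PR n) (PR n) ℝ :=
  PiC G * (Sg n * (∑ p ∈ (range (d + 1) ×ˢ range (d + 1)).erase (u, u),
      (α ^ u * ((thi d α p.1)⁻¹ * (thi d α p.2)⁻¹ * 2 ^ (p.1.choose 2))) • gmat G (cH d u p.1 p.2))
      * Sg n)

theorem Eu_gmat (d u : ℕ) (G : Graph n) : gmat G (cH d u u u) = Eu n d u := by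
  ext x y
  rw [HC0_diag]
  unfold Eu
  by_cases hxy : x = y
  · subst hxy
    rw [Matrix.diagonal_apply_eq]
    by_cases h : x.2 = ∅ ∧ x.1.card = u ∧ u ≤ d
    · rw [if_pos h, if_pos ⟨rfl, h⟩]
    · rw [if_neg h, if_neg (fun h' => h h'.2)]
  · rw [Matrix.diagonal_apply_ne _ hxy, if_neg (fun h' => hxy h'.1)]

theorem Sg_Eu (d u : ℕ) : Sg n * Eu n d u * Sg n = Eu n d u := by
  unfold Sg Eu
  rw [Matrix.diagonal_mul_diagonal, Matrix.diagonal_mul_diagonal]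
  congr 1
  ext x
  by_cases h : x.2 = ∅ ∧ x.1.card = u ∧ u ≤ d
  · rw [if_pos h, h.1]; simp
  · rw [if_neg h]; simp

theorem hS_block (d : ℕ) (α : ℝ) (G : Graph n) (u : ℕ) :
    hS d α G u = PiC G * (Sg n * (∑ p ∈ range (d + 1) ×ˢ range (d + 1),
      (α ^ u * ((thi d α p.1)⁻¹ * (thi d α p.2)⁻¹ * 2 ^ (p.1.choose 2))) • gmat G (cH d u p.1 p.2))
      * Sg n) := by
  ext x y
  rw [hS_apply, PiC, Matrix.diagonal_mul]
  by_cases hx : Clq G x.1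
  · rw [if_pos hx, one_mul, Sg, Matrix.mul_diagonal, Matrix.diagonal_mul, Matrix.sum_apply]
    simp only [Matrix.smul_apply, smul_eq_mul]
    have := block_sum d G x y (HC0 d u x y)
      (fun p q => α ^ u * ((thi d α p)⁻¹ * (thi d α q)⁻¹ * 2 ^ (p.choose 2)))
      (fun T hT => by
        have hT' : cH d u x.1.card y.1.card x y T := ⟨hT, rfl, rfl⟩
        have := cH_le hT'
        omega)
    change _ = _ * (∑ p ∈ range (d + 1) ×ˢ range (d + 1),
      (α ^ u * ((thi d α p.1)⁻¹ * (thi d α p.2)⁻¹ * 2 ^ (p.1.choose 2))) *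
      sumChi G (fun T => HC0 d u x y T ∧ (x.1.card = p.1 ∧ y.1.card = p.2))) * _
    rw [← this]
    unfold Hm
    rw [HC_factor d u G x y hx]
    ring
  · rw [Hm_clq_left d G u x y hx, if_neg hx]
    simp

theorem hS_split (P : Par n d τ α b) (G : Graph n) (u : ℕ) :
    hS d α G u = PiC G * Eu n d u + zS d α G u := by
  rw [hS_block]
  unfold zS
  by_cases hu : u ≤ d
  · have hm : (u, u) ∈ range (d + 1) ×ˢ range (d + 1) := by simp; omega
    rw [← Finset.add_sum_erase _ _ hm, P.thi_diag hu, one_smul, Eu_gmat, mul_add (Sg n), add_mul,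
      mul_add, Sg_Eu]
  · have : Eu n d u = 0 := by
      rw [← Eu_gmat d u (Classical.arbitrary (Graph n)), gmat_zero]
      intro x y T hT
      have := cH_le hT
      omega
    rw [this, mul_zero, zero_add, Finset.erase_eq_of_notMem]
    simp; omega

theorem zS_norm (P : Par n d τ α b) {G : Graph n} (hG : Good G d τ b) (u : ℕ) (hu : u ≤ τ)
    (k : ℕ) (hk : k ≤ u - d) : ‖zS d α G u‖ ≤ ((b⁻¹) ^ 16) ^ (max 1 k) := by
  have hb := P.b0
  have hα := P.hα
  unfold zS
  refine (norm_mul_le _ _).trans ((mul_le_of_le_one_left (norm_nonneg _) (norm_PiC G)).trans ?_)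
  refine (norm_mul_le _ _).trans ((mul_le_of_le_one_right (norm_nonneg _) norm_Sg).trans ?_)
  refine (norm_mul_le _ _).trans ((mul_le_of_le_one_left (norm_nonneg _) norm_Sg).trans ?_)
  have hk' : 1 ≤ max 1 k := le_max_left _ _
  have h1 : b ^ 3 ≤ (b ^ 3) ^ (max 1 k) := le_self_pow₀ (one_le_pow₀ P.b1) (by omega)
  have hb1 : b⁻¹ ≤ 1 := inv_le_one_of_one_le₀ P.b1
  have hfin : b ^ 2 * (b * ((b⁻¹) ^ 19) ^ (max 1 k)) ≤ ((b⁻¹) ^ 16) ^ (max 1 k) := by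
    calc b ^ 2 * (b * ((b⁻¹) ^ 19) ^ (max 1 k)) = b ^ 3 * ((b⁻¹) ^ 19) ^ (max 1 k) := by ring
      _ ≤ (b ^ 3) ^ (max 1 k) * ((b⁻¹) ^ 19) ^ (max 1 k) := by gcongr
      _ = ((b⁻¹) ^ 16) ^ (max 1 k) := by rw [← mul_pow]; congr 1; field_simp
  refine le_trans ?_ hfin
  refine norm_block_sum _ _ _ _ _ (by positivity) ?_ ?_
  · refine le_trans ?_ P.card
    exact_mod_cast card_le_card (Finset.erase_subset _ _)
  rintro ⟨a, a'⟩ hp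
  simp only [mem_erase, mem_product, mem_range, ne_eq, Prod.mk.injEq] at hp
  have ht := thi_pos (d := d) hα a'
  have ht' := thi_pos (d := d) hα a
  rw [norm_smul, Real.norm_of_nonneg (by positivity)]
  by_cases hc : a ≤ a' ∧ a' ≤ u
  · have h1 := hG.hH u a a' hu (by omega) (by omega) hc.2
    refine (mul_le_mul_of_nonneg_left h1 (by positivity)).trans ?_
    refine (P.baseH u a a' hc.1 hc.2 _ (P.thi_prod hc.1 (by omega))).trans ?_
    apply mul_le_mul_of_nonneg_left _ hb.le
    apply pow_le_pow_of_le_one (by positivity) (pow_le_one₀ (by positivity) hb1)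
    omega
  · rw [gmat_zero G _ (fun x y T hT => hc ⟨(cH_le hT).1, (cH_le hT).2.2⟩), norm_zero, mul_zero]
    positivity

end scaled


theorem tri_sum {M : Type*} [AddCommMonoid M] (τ : ℕ) (f : ℕ → ℕ → ℕ → M) :
    ∑ v ∈ range (τ + 1), ∑ p ∈ antidiagonal v, ∑ q ∈ antidiagonal p.2, f p.1 q.1 q.2 =
      ∑ t ∈ (range (τ + 1) ×ˢ (range (τ + 1) ×ˢ range (τ + 1))).filter
        (fun t => t.1 + t.2.1 + t.2.2 ≤ τ), f t.1 t.2.1 t.2.2 := by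
  simp only [Finset.sum_sigma']
  refine Finset.sum_nbij' (fun z => (z.2.1.1, z.2.2.1, z.2.2.2))
    (fun t => ⟨t.1 + t.2.1 + t.2.2, ⟨(t.1, t.2.1 + t.2.2), (t.2.1, t.2.2)⟩⟩) ?_ ?_ ?_ ?_ ?_
  · rintro ⟨v, ⟨⟨i, j⟩, ⟨e, k⟩⟩⟩ h
    simp only [mem_sigma, mem_range, HasAntidiagonal.mem_antidiagonal, mem_filter,
      mem_product] at h ⊢
    omega
  · rintro ⟨i, e, k⟩ h
    simp only [mem_sigma, mem_range, HasAntidiagonal.mem_antidiagonal, mem_filter,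
      mem_product] at h ⊢
    refine ⟨by omega, ?_, ?_⟩ <;> simp [add_assoc]
  · rintro ⟨v, ⟨⟨i, j⟩, ⟨e, k⟩⟩⟩ h
    simp only [mem_sigma, mem_range, HasAntidiagonal.mem_antidiagonal] at h
    obtain ⟨h1, h2, h3⟩ := h
    subst h3
    subst h2
    simp [add_assoc]
  · rintro ⟨i, e, k⟩ h
    rfl
  · rintro ⟨v, ⟨⟨i, j⟩, ⟨e, k⟩⟩⟩ h
    rfl

section assembly
open scoped Matrix.Norms.L2Operator
variable {n : ℕ} {d τ : ℕ} {α b : ℝ}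

theorem Ti_Th (hα : 0 < α) : Ti n d α * Th n d α = 1 := by
  unfold Ti Th
  rw [Matrix.diagonal_mul_diagonal, ← Matrix.diagonal_one]
  congr 1
  ext x
  exact mul_inv_cancel₀ (thi_pos hα _).ne'

theorem Th_Ti (hα : 0 < α) : Th n d α * Ti n d α = 1 := by
  unfold Ti Th
  rw [Matrix.diagonal_mul_diagonal, ← Matrix.diagonal_one]
  congr 1
  ext x
  exact inv_mul_cancel₀ (thi_pos hα _).ne'

theorem star_diag {κ : Type*} [Fintype κ] [DecidableEq κ] (f : κ → ℝ) :
    star (Matrix.diagonal f : Matrix κ κ ℝ) = Matrix.diagonal f := by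
  rw [Matrix.star_eq_conjTranspose, Matrix.diagonal_conjTranspose]
  simp

theorem star_Ti : star (Ti n d α) = Ti n d α := star_diag _
theorem star_Ed : star (Ed n d) = Ed n d := star_diag _
theorem star_PiC (G : Graph n) : star (PiC G) = PiC G := star_diag _

theorem pi0_idem : pi0 n * pi0 n = pi0 n := by
  unfold pi0
  rw [Matrix.diagonal_mul_diagonal]; congr 1; ext x; split_ifs <;> simp

theorem pi0_Ed : pi0 n * Ed n d = Ed n d := by
  unfold pi0 Ed
  rw [Matrix.diagonal_mul_diagonal]; congr 1; ext x
  by_cases h : x.2 = ∅ <;> simp [h]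

theorem Ti_pi0 : Ti n d α * pi0 n = pi0 n * Ti n d α := by
  unfold Ti pi0
  rw [Matrix.diagonal_mul_diagonal, Matrix.diagonal_mul_diagonal]; congr 1; ext x; ring

theorem g_zero (hα : 0 < α) (G : Graph n) : (1 - pi0 n) * gS d α G 0 = 0 := by
  rw [gS_zero d α hα, sub_mul, one_mul, pi0_Ed, sub_self]

theorem antidiag_smul {κ : Type*} [Fintype κ] (α : ℝ) (i : ℕ)
    (A B : ℕ → Matrix κ κ ℝ) : α ^ i • ∑ p ∈ antidiagonal i, A p.1 * B p.2 =
      ∑ p ∈ antidiagonal i, (α ^ p.1 • A p.1) * (α ^ p.2 • B p.2) := by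
  rw [Finset.smul_sum]
  refine Finset.sum_congr rfl fun p hp => ?_
  rw [HasAntidiagonal.mem_antidiagonal] at hp
  rw [← hp, Matrix.smul_mul, Matrix.mul_smul, smul_smul, pow_add]

theorem M_eq (hα : 0 < α) (G : Graph n) (v : ℕ) :
    α ^ v • Mm d G v = ∑ p ∈ antidiagonal v, ∑ q ∈ antidiagonal p.2,
      (lS d α G p.1 * Ti n d α) * xS (pi0 n) (gS d α G) (hS d α G) q.1 *
        star (lS d α G q.2 * Ti n d α) := by
  have key := m_eq (pi0 n) (gS d α G) (hS d α G) (fun i => α ^ i • (Lh d G i * Ti n d α))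
    (fun i => α ^ i • (Th n d α * Nm d G i)) (fun i => α ^ i • Mm d G i) (g_zero hα G) pi0_idem
    (fun i => by
      have h1 : Lh d G i * Ti n d α = ∑ p ∈ antidiagonal i,
          (Lh d G p.1 * Ti n d α) * (Th n d α * Gam d G p.2 * Ti n d α) := by
        rw [Lh_eq d G i, Finset.sum_mul]
        refine Finset.sum_congr rfl fun p _ => ?_
        calc Lh d G p.1 * Gam d G p.2 * Ti n d α = Lh d G p.1 * 1 * Gam d G p.2 * Ti n d α := by
              rw [mul_one]
          _ = _ := by rw [← Ti_Th (d := d) hα]; simp only [mul_assoc]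
      rw [h1]
      exact antidiag_smul α i (fun j => Lh d G j * Ti n d α)
        (fun j => Th n d α * Gam d G j * Ti n d α))
    (fun i => by
      have h1 : Mm d G i = ∑ p ∈ antidiagonal i,
          (Lh d G p.1 * Ti n d α) * (Th n d α * Nm d G p.2) := by
        rw [Mm_eq d G i]
        refine Finset.sum_congr rfl fun p _ => ?_
        calc Lh d G p.1 * Nm d G p.2 = Lh d G p.1 * 1 * Nm d G p.2 := by
              rw [mul_one]
          _ = _ := by rw [← Ti_Th (d := d) hα]; simp only [mul_assoc]
      rw [h1]
      exact antidiag_smul α i (fun j => Lh d G j * Ti n d α)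
        (fun j => Th n d α * Nm d G j))
    (fun i => by
      have hst : ∀ j, star (α ^ j • (Lh d G j * Ti n d α)) =
          α ^ j • (Ti n d α * (Lh d G j).transpose) := by
        intro j
        rw [star_smul, star_mul, star_Ti, star_trivial, Matrix.star_eq_conjTranspose,
          Matrix.conjTranspose_eq_transpose_of_trivial]
      simp only [hst]
      have h1 : Th n d α * Nm d G i = ∑ p ∈ antidiagonal i,
          (Th n d α * Hm d G p.1 * Th n d α) * (Ti n d α * (Lh d G p.2).transpose) := by
        rw [Nm_eq d G i, Finset.mul_sum]
        refine Finset.sum_congr rfl fun p _ => ?_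
        calc Th n d α * (Hm d G p.1 * (Lh d G p.2).transpose) =
            Th n d α * Hm d G p.1 * 1 * (Lh d G p.2).transpose := by
              rw [mul_one, mul_assoc]
          _ = _ := by rw [← Th_Ti (d := d) hα]; simp only [mul_assoc]
      rw [h1]
      exact antidiag_smul α i (fun j => Th n d α * Hm d G j * Th n d α)
        (fun j => Ti n d α * (Lh d G j).transpose)) v
  have e : ∀ i, α ^ i • (Lh d G i * Ti n d α) * pi0 n = lS d α G i * Ti n d α := by
    intro i
    rw [Matrix.smul_mul, mul_assoc, Ti_pi0, ← mul_assoc, lS, Matrix.smul_mul]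
  simp only [e] at key
  exact key

theorem Pi_pi0 (G : Graph n) : pi0 n * PiC G = PiC G * pi0 n := by
  unfold pi0 PiC
  rw [Matrix.diagonal_mul_diagonal, Matrix.diagonal_mul_diagonal]; congr 1; ext x; ring

theorem gS_Pi (G : Graph n) (w : ℕ) : gS d α G w * PiC G = PiC G * gS d α G w * PiC G := by
  ext x y
  rw [PiC, Matrix.mul_diagonal, Matrix.mul_diagonal, Matrix.diagonal_mul]
  by_cases hx : Clq G x.1
  · rw [if_pos hx, one_mul]
  · by_cases hy : Clq G y.1
    · rw [gS_apply, Gam_clq d G w x y hx hy]; simp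
    · rw [if_neg hy]; simp

theorem hS_Pi (G : Graph n) (w : ℕ) : hS d α G w = PiC G * hS d α G w * PiC G := by
  ext x y
  rw [PiC, Matrix.mul_diagonal, Matrix.diagonal_mul]
  by_cases hx : Clq G x.1
  · by_cases hy : Clq G y.1
    · rw [if_pos hx, if_pos hy]; simp
    · rw [hS_apply, Hm_clq_right d G w x y hy]; simp
  · rw [hS_apply, Hm_clq_left d G w x y hx]; simp

theorem X_proj (hα : 0 < α) (G : Graph n) (e : ℕ) :
    xS (pi0 n) (gS d α G) (hS d α G) e =
      PiC G * xS (pi0 n) (gS d α G) (hS d α G) e * PiC G :=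
  xS_proj _ _ _ _ (g_zero hα G) (Pi_pi0 G) (star_PiC G) (gS_Pi G) (hS_Pi G) e

theorem Eu_zero {u : ℕ} (hu : d < u) : Eu n d u = 0 := by
  unfold Eu
  rw [← Matrix.diagonal_zero]
  congr 1
  ext x
  rw [if_neg]
  omega

theorem sum_Eu (hd : d ≤ τ) : ∑ u ∈ range (τ + 1), Eu n d u = Ed n d := by
  ext x y
  rw [Matrix.sum_apply]
  unfold Eu Ed
  by_cases hxy : x = y
  · subst hxy
    simp only [Matrix.diagonal_apply_eq]
    by_cases h : x.2 = ∅ ∧ x.1.card ≤ d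
    · rw [if_pos h, Finset.sum_eq_single x.1.card]
      · rw [if_pos ⟨h.1, rfl, h.2⟩]
      · intro u _ hu
        rw [if_neg]
        rintro ⟨_, h2, _⟩
        exact hu h2.symm
      · intro hh
        exfalso; apply hh; rw [mem_range]; omega
    · rw [if_neg h, Finset.sum_eq_zero]
      intro u _
      rw [if_neg]
      rintro ⟨h1, h2, h3⟩
      exact h ⟨h1, by omega⟩
  · simp only [Matrix.diagonal_apply_ne _ hxy, Finset.sum_const_zero]

theorem Ed_Eu (G : Graph n) (u : ℕ) : Ed n d * (PiC G * Eu n d u) * Ed n d = PiC G * Eu n d u := by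
  unfold Ed PiC Eu
  rw [Matrix.diagonal_mul_diagonal, Matrix.diagonal_mul_diagonal, Matrix.diagonal_mul_diagonal]
  congr 1
  ext x
  by_cases h : x.2 = ∅ ∧ x.1.card ≤ d
  · simp [h]
  · rw [if_neg h, if_neg (c := x.2 = ∅ ∧ x.1.card = u ∧ u ≤ d)]
    · simp
    · rintro ⟨h1, h2, h3⟩
      exact h ⟨h1, by omega⟩

theorem yS_zero (hα : 0 < α) (G : Graph n) : yS (pi0 n) (gS d α G) 0 = Ed n d := by
  rw [yS_rec _ _ (g_zero hα G)]
  simp only [Finset.HasAntidiagonal.antidiagonal_zero, sum_singleton]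
  rw [g_zero hα G, mul_zero, add_zero, gS_zero d α hα, pi0_Ed]

theorem yS_bd (P : Par n d τ α b) {G : Graph n} (hG : Good G d τ b) (i : ℕ) (hi : i ≤ τ) :
    ‖yS (pi0 n) (gS d α G) i‖ ≤ ((b⁻¹) ^ 8) ^ i := by
  have hb := P.b0
  refine (yS_norm _ _ (g_zero P.hα G) ((b⁻¹) ^ 30) (by positivity) norm_pi0 norm_pi0' τ
    (fun w hw => gS_norm P hG w hw) i hi).trans ?_
  apply pow_le_pow_left₀ (by positivity)
  have h1 : b⁻¹ ≤ 1 / 2 := by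
    rw [inv_le_comm₀ hb (by norm_num)]; linarith [P.hb]
  have hi0 : 0 < b⁻¹ := inv_pos.2 hb
  calc 2 * (b⁻¹) ^ 30 = (2 * (b⁻¹) ^ 22) * (b⁻¹) ^ 8 := by ring
    _ ≤ 1 * (b⁻¹) ^ 8 := by
      gcongr
      calc 2 * (b⁻¹) ^ 22 ≤ 2 * (1 / 2) ^ 22 := by gcongr
        _ ≤ 1 := by norm_num
    _ = _ := one_mul _

theorem inv_le (P : Par n d τ α b) : b⁻¹ ≤ 1 / 100 := by
  rw [inv_le_comm₀ P.b0 (by norm_num)]; linarith [P.hb]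

theorem zS_bd (P : Par n d τ α b) {G : Graph n} (hG : Good G d τ b) (u : ℕ) (hu : u ≤ τ) :
    ‖zS d α G u‖ ≤ (b⁻¹) ^ 8 ∧ ‖zS d α G u‖ ≤ ((b⁻¹) ^ 8) ^ (u - d) := by
  have hi0 : 0 < b⁻¹ := inv_pos.2 P.b0
  have hi1 : b⁻¹ ≤ 1 := by linarith [inv_le P]
  have h := zS_norm P hG u hu (u - d) le_rfl
  have h16 : (b⁻¹) ^ 16 ≤ (b⁻¹) ^ 8 := pow_le_pow_of_le_one hi0.le hi1 (by norm_num)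
  have h8 : (b⁻¹) ^ 8 ≤ 1 := pow_le_one₀ hi0.le hi1
  have h2 : ‖zS d α G u‖ ≤ ((b⁻¹) ^ 8) ^ (max 1 (u - d)) :=
    h.trans (pow_le_pow_left₀ (by positivity) h16 _)
  refine ⟨h2.trans ?_, h2.trans ?_⟩
  · calc ((b⁻¹) ^ 8) ^ (max 1 (u - d)) ≤ ((b⁻¹) ^ 8) ^ 1 :=
          pow_le_pow_of_le_one (by positivity) h8 (le_max_left _ _)
      _ = _ := pow_one _
  · exact pow_le_pow_of_le_one (by positivity) h8 (le_max_right _ _)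

theorem hS_bd (P : Par n d τ α b) {G : Graph n} (hG : Good G d τ b) (u : ℕ) (hu : u ≤ τ) :
    ‖hS d α G u‖ ≤ 2 * ((b⁻¹) ^ 8) ^ (u - d) := by
  have hi0 : 0 < b⁻¹ := inv_pos.2 P.b0
  have hi1 : b⁻¹ ≤ 1 := by linarith [inv_le P]
  obtain ⟨h1, h2⟩ := zS_bd P hG u hu
  have h8 : (b⁻¹) ^ 8 ≤ 1 := pow_le_one₀ hi0.le hi1
  rw [hS_split P G u]
  by_cases hud : u ≤ d
  · have : u - d = 0 := by omega
    rw [this, pow_zero]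
    have h3 : ‖PiC G * Eu n d u‖ ≤ 1 := by
      refine (norm_mul_le _ _).trans ?_
      exact mul_le_one₀ (norm_PiC G) (norm_nonneg _) (norm_Eu d u)
    refine (norm_add_le _ _).trans ?_
    linarith
  · rw [Eu_zero (by omega), mul_zero, zero_add]
    have : 0 ≤ ((b⁻¹) ^ 8) ^ (u - d) := by positivity
    linarith

end assembly


section assembly2
open scoped Matrix.Norms.L2Operator
variable {n : ℕ} {d τ : ℕ} {α b : ℝ}

noncomputable def Xt (d τ : ℕ) (α : ℝ) (G : Graph n) : Matrix (PR n) (PR n) ℝ :=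
  ∑ e ∈ range (τ + 1), xS (pi0 n) (gS d α G) (hS d α G) e
noncomputable def Lt (d τ : ℕ) (α : ℝ) (G : Graph n) : Matrix (PR n) (PR n) ℝ :=
  ∑ e ∈ range (τ + 1), lS d α G e
noncomputable def Mt (d τ : ℕ) (α : ℝ) (G : Graph n) : Matrix (PR n) (PR n) ℝ :=
  ∑ v ∈ range (τ + 1), α ^ v • Mm d G v

def cube (τ : ℕ) : Finset (ℕ × ℕ × ℕ) := range (τ + 1) ×ˢ (range (τ + 1) ×ˢ range (τ + 1))

theorem card_cube (P : Par n d τ α b) (F : Finset (ℕ × ℕ × ℕ)) (hF : F ⊆ cube τ) :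
    (F.card : ℝ) ≤ b ^ 3 := by
  have h1 : F.card ≤ (τ + 1) ^ 3 := by
    refine (card_le_card hF).trans ?_
    unfold cube
    rw [card_product, card_product, card_range]
    exact le_of_eq (by ring)
  calc (F.card : ℝ) ≤ ((τ : ℝ) + 1) ^ 3 := by exact_mod_cast h1
    _ ≤ b ^ 3 := by have := P.hτ; gcongr

theorem norm_sum_const {E ι : Type*} [SeminormedAddCommGroup E] (F : Finset ι) (A : ι → E)
    (B N : ℝ) (hB : 0 ≤ B) (hN : (F.card : ℝ) ≤ N) (h : ∀ i ∈ F, ‖A i‖ ≤ B) :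
    ‖∑ i ∈ F, A i‖ ≤ N * B := by
  refine (norm_sum_le _ _).trans ((Finset.sum_le_sum h).trans ?_)
  rw [sum_const, nsmul_eq_mul]
  gcongr

theorem norm_triple {R : Type*} [NormedRing R] {x y z : R} {a b c : ℝ} (hx : ‖x‖ ≤ a) (hy : ‖y‖ ≤ b)
    (hz : ‖z‖ ≤ c) : ‖x * y * z‖ ≤ a * b * c := by
  have h0 := norm_nonneg x
  have h1 := norm_nonneg y
  have h2 := norm_nonneg z
  calc ‖x * y * z‖ ≤ ‖x‖ * ‖y‖ * ‖z‖ := norm_mul₃_le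
    _ ≤ a * b * c := by
      have ha : 0 ≤ a := h0.trans hx
      have hb : 0 ≤ b := h1.trans hy
      gcongr

theorem X_norm (P : Par n d τ α b) {G : Graph n} (hG : Good G d τ b) (e : ℕ) (he : e ≤ τ) :
    ‖xS (pi0 n) (gS d α G) (hS d α G) e‖ ≤ b ^ 2 * (2 * ((b⁻¹) ^ 8) ^ (e - d)) := by
  have hi0 : 0 < b⁻¹ := inv_pos.2 P.b0
  have hi1 : b⁻¹ ≤ 1 := by linarith [inv_le P]
  have h8 : (b⁻¹) ^ 8 ≤ 1 := pow_le_one₀ hi0.le hi1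
  have hb := P.b0
  have ec : (e : ℝ) + 1 ≤ b := by
    have : (e : ℝ) ≤ τ := by exact_mod_cast he
    linarith [P.hτ]
  unfold xS
  rw [sq, mul_assoc]
  refine norm_sum_const _ _ _ _ (by positivity) (by simpa using ec) ?_
  intro p hp
  rw [HasAntidiagonal.mem_antidiagonal] at hp
  have ec' : (p.2 : ℝ) + 1 ≤ b := by
    have : (p.2 : ℝ) ≤ e := by exact_mod_cast (by omega)
    linarith
  refine norm_sum_const _ _ _ _ (by positivity) (by simpa using ec') ?_
  intro q hq
  rw [HasAntidiagonal.mem_antidiagonal] at hq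
  have h1 := yS_bd P hG p.1 (by omega)
  have h2 := hS_bd P hG q.1 (by omega)
  have h3 := yS_bd P hG q.2 (by omega)
  rw [← norm_star] at h3
  refine (norm_triple h1 h2 h3).trans ?_
  have : ((b⁻¹) ^ 8) ^ p.1 * (2 * ((b⁻¹) ^ 8) ^ (q.1 - d)) * ((b⁻¹) ^ 8) ^ q.2 =
      2 * ((b⁻¹) ^ 8) ^ (p.1 + (q.1 - d) + q.2) := by
    rw [pow_add, pow_add]; ring
  rw [this]
  apply mul_le_mul_of_nonneg_left _ (by norm_num)
  exact pow_le_pow_of_le_one (by positivity) h8 (by omega)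

theorem small (P : Par n d τ α b) : b ^ 3 * (2 * (b⁻¹) ^ 8) ≤ 1 / 4 := by
  have hb := P.b0
  have hi0 : 0 < b⁻¹ := inv_pos.2 P.b0
  have h1 : b ^ 3 * (2 * (b⁻¹) ^ 8) = 2 * (b⁻¹) ^ 5 := by field_simp
  rw [h1]
  calc 2 * (b⁻¹) ^ 5 ≤ 2 * (1 / 100) ^ 5 := by
        have := inv_le P
        gcongr
    _ ≤ 1 / 4 := by norm_num

theorem X_close (P : Par n d τ α b) {G : Graph n} (hG : Good G d τ b) :
    ‖Xt d τ α G - PiC G * Ed n d‖ ≤ 1 / 4 := by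
  have hi0 : 0 < b⁻¹ := inv_pos.2 P.b0
  have hi1 : b⁻¹ ≤ 1 := by linarith [inv_le P]
  have h8 : (b⁻¹) ^ 8 ≤ 1 := pow_le_one₀ hi0.le hi1
  have hb := P.b0
  have hd : d ≤ τ := by have := P.hdτ; omega
  set F := (cube τ).filter (fun t => t.1 + t.2.1 + t.2.2 ≤ τ) with hF
  have e1 : Xt d τ α G = ∑ t ∈ F, yS (pi0 n) (gS d α G) t.1 * hS d α G t.2.1 *
      star (yS (pi0 n) (gS d α G) t.2.2) := by
    unfold Xt xS
    exact tri_sum τ (fun i u k => yS (pi0 n) (gS d α G) i * hS d α G u *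
      star (yS (pi0 n) (gS d α G) k))
  have e2 : PiC G * Ed n d = ∑ t ∈ F, if t.1 = 0 ∧ t.2.2 = 0 then PiC G * Eu n d t.2.1 else 0 := by
    rw [← sum_Eu hd, Finset.mul_sum, ← Finset.sum_filter]
    refine Finset.sum_nbij' (fun u => (0, u, 0)) (fun t => t.2.1) ?_ ?_ ?_ ?_ ?_
    · intro u hu
      simp only [mem_range] at hu
      simp only [hF, cube, mem_filter, mem_product, mem_range, and_true]
      omega
    · rintro ⟨i, u, k⟩ ht
      simp only [hF, cube, mem_filter, mem_product, mem_range] at ht ⊢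
      omega
    · intro u _; rfl
    · rintro ⟨i, u, k⟩ ht
      simp only [hF, cube, mem_filter, mem_product, mem_range] at ht
      obtain ⟨_, rfl, rfl⟩ := ht
      rfl
    · intro u _; rfl
  rw [e1, e2, ← Finset.sum_sub_distrib]
  refine le_trans ?_ (small P)
  refine norm_sum_const _ _ _ _ (by positivity) (card_cube P _ (filter_subset _ _)) ?_
  rintro ⟨i, u, k⟩ ht
  simp only [hF, cube, mem_filter, mem_product, mem_range] at ht
  have h2 := hS_bd P hG u (by omega)
  dsimp only
  by_cases h : i = 0 ∧ k = 0
  · rw [if_pos h, h.1, h.2, yS_zero P.hα, star_Ed, hS_split P, mul_add, add_mul, Ed_Eu,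
      add_sub_cancel_left]
    refine (norm_triple (norm_Ed d) (zS_bd P hG u (by omega)).1 (norm_Ed d)).trans ?_
    have : 0 < (b⁻¹) ^ 8 := by positivity
    linarith
  · rw [if_neg h, sub_zero]
    have h1 := yS_bd P hG i (by omega)
    have h3 := yS_bd P hG k (by omega)
    rw [← norm_star] at h3
    refine (norm_triple h1 h2 h3).trans ?_
    have : ((b⁻¹) ^ 8) ^ i * (2 * ((b⁻¹) ^ 8) ^ (u - d)) * ((b⁻¹) ^ 8) ^ k =
        2 * ((b⁻¹) ^ 8) ^ (i + (u - d) + k) := by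
      rw [pow_add, pow_add]; ring
    rw [this]
    apply mul_le_mul_of_nonneg_left _ (by norm_num)
    calc ((b⁻¹) ^ 8) ^ (i + (u - d) + k) ≤ ((b⁻¹) ^ 8) ^ 1 :=
          pow_le_pow_of_le_one (by positivity) h8 (by omega)
      _ = _ := pow_one _

theorem lS_bd (P : Par n d τ α b) {G : Graph n} (hG : Good G d τ b) (i : ℕ) (hi : i ≤ τ) :
    ‖lS d α G i‖ ≤ ((b⁻¹) ^ 8) ^ i := by
  have hi0 : 0 < b⁻¹ := inv_pos.2 P.b0
  have hi1 : b⁻¹ ≤ 1 := by linarith [inv_le P]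
  refine (lS_norm P hG i hi).trans ?_
  apply pow_le_pow_left₀ (by positivity)
  exact pow_le_pow_of_le_one hi0.le hi1 (by norm_num)

theorem norm_Ti (P : Par n d τ α b) : ‖Ti n d α‖ ≤ 1 := by
  apply norm_diag_le _ _ zero_le_one
  intro x
  rw [abs_of_pos (thi_pos P.hα _)]
  exact P.thi_le_one _

theorem L_close (P : Par n d τ α b) {G : Graph n} (hG : Good G d τ b) :
    ‖Lt d τ α G - Ed n d‖ ≤ 1 / 4 := by
  have hi0 : 0 < b⁻¹ := inv_pos.2 P.b0
  have hi1 : b⁻¹ ≤ 1 := by linarith [inv_le P]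
  have h8 : (b⁻¹) ^ 8 ≤ 1 := pow_le_one₀ hi0.le hi1
  have hb := P.b0
  unfold Lt
  rw [Finset.sum_range_succ', lS_zero, add_sub_cancel_right]
  have hs := small P
  have hb1 := P.b1
  refine (norm_sum_const (range τ) _ ((b⁻¹) ^ 8) b (by positivity) ?_ ?_).trans (le_trans ?_ hs)
  · rw [card_range]; linarith [P.hτ]
  · intro i hi
    rw [mem_range] at hi
    refine (lS_bd P hG (i + 1) (by omega)).trans ?_
    calc ((b⁻¹) ^ 8) ^ (i + 1) ≤ ((b⁻¹) ^ 8) ^ 1 :=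
          pow_le_pow_of_le_one (by positivity) h8 (by omega)
      _ = _ := pow_one _
  · have h1 : b ≤ b ^ 3 := le_self_pow₀ hb1 (by norm_num)
    have h2 : 0 < (b⁻¹) ^ 8 := by positivity
    nlinarith

theorem err_small (P : Par n d τ α b) :
    b ^ 3 * (b ^ 2 * (2 * ((b⁻¹) ^ 8) ^ (τ + 1 - d))) ≤ α ^ d / 4 := by
  have hi0 : 0 < b⁻¹ := inv_pos.2 P.b0
  have hi1 : b⁻¹ ≤ 1 := by linarith [inv_le P]
  have hb := P.b0
  have hα := P.hα
  have hnr : (0 : ℝ) < n := by linarith [P.nr]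
  have h1 : (b⁻¹) ^ τ ≤ α ^ d := by
    have h2 : ((n : ℝ)⁻¹) ^ d ≤ α ^ d := by
      gcongr
      rw [inv_le_iff_one_le_mul₀ hnr]
      exact P.hαn
    refine le_trans ?_ h2
    rw [inv_pow, inv_pow]
    gcongr
    exact P.hd
  have h3 : ((b⁻¹) ^ 8) ^ (τ + 1 - d) ≤ (b⁻¹) ^ 8 * (b⁻¹) ^ τ := by
    rw [← pow_mul, ← pow_add]
    have := P.hdτ
    exact pow_le_pow_of_le_one hi0.le hi1 (by omega)
  calc b ^ 3 * (b ^ 2 * (2 * ((b⁻¹) ^ 8) ^ (τ + 1 - d)))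
      ≤ b ^ 3 * (b ^ 2 * (2 * ((b⁻¹) ^ 8 * (b⁻¹) ^ τ))) := by gcongr
    _ = 2 * (b⁻¹) ^ 3 * (b⁻¹) ^ τ := by field_simp
    _ ≤ 2 * (1 / 100) ^ 3 * α ^ d := by
      have := inv_le P
      gcongr
    _ ≤ α ^ d / 4 := by
      have : 0 < α ^ d := by positivity
      linarith

theorem trunc (P : Par n d τ α b) {G : Graph n} (hG : Good G d τ b) :
    ‖Lt d τ α G * Ti n d α * Xt d τ α G * star (Lt d τ α G * Ti n d α) - Mt d τ α G‖
      ≤ α ^ d / 4 := by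
  have hi0 : 0 < b⁻¹ := inv_pos.2 P.b0
  have hi1 : b⁻¹ ≤ 1 := by linarith [inv_le P]
  have h8 : (b⁻¹) ^ 8 ≤ 1 := pow_le_one₀ hi0.le hi1
  have hb := P.b0
  set f : ℕ × ℕ × ℕ → Matrix (PR n) (PR n) ℝ := fun t => (lS d α G t.1 * Ti n d α) *
    xS (pi0 n) (gS d α G) (hS d α G) t.2.1 * star (lS d α G t.2.2 * Ti n d α) with hf
  have e1 : Mt d τ α G = ∑ t ∈ (cube τ).filter (fun t => t.1 + t.2.1 + t.2.2 ≤ τ), f t := by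
    unfold Mt
    simp only [M_eq P.hα]
    exact tri_sum τ (fun i e k => (lS d α G i * Ti n d α) *
      xS (pi0 n) (gS d α G) (hS d α G) e * star (lS d α G k * Ti n d α))
  have e2 : Lt d τ α G * Ti n d α * Xt d τ α G * star (Lt d τ α G * Ti n d α) =
      ∑ t ∈ cube τ, f t := by
    unfold Lt Xt cube
    rw [Finset.sum_product]
    simp only [Finset.sum_product, hf]
    simp only [← Finset.mul_sum, ← Finset.sum_mul, ← star_sum]
  rw [e1, e2, ← Finset.sum_filter_add_sum_filter_not (cube τ) (fun t => t.1 + t.2.1 + t.2.2 ≤ τ) f,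
    add_sub_cancel_left]
  refine le_trans ?_ (err_small P)
  refine norm_sum_const _ _ _ _ (by positivity) (card_cube P _ (filter_subset _ _)) ?_
  rintro ⟨i, e, k⟩ ht
  simp only [cube, mem_filter, mem_product, mem_range] at ht
  have lt : ∀ i ≤ τ, ‖lS d α G i * Ti n d α‖ ≤ ((b⁻¹) ^ 8) ^ i := fun i hi =>
    (norm_mul_le _ _).trans ((mul_le_of_le_one_right (norm_nonneg _) (norm_Ti P)).trans
      (lS_bd P hG i hi))
  have h1 := lt i (by omega)
  have h2 := X_norm P hG e (by omega)
  have h3 := lt k (by omega)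
  rw [← norm_star] at h3
  refine (norm_triple h1 h2 h3).trans ?_
  have : ((b⁻¹) ^ 8) ^ i * (b ^ 2 * (2 * ((b⁻¹) ^ 8) ^ (e - d))) * ((b⁻¹) ^ 8) ^ k =
      b ^ 2 * (2 * ((b⁻¹) ^ 8) ^ (i + (e - d) + k)) := by
    rw [pow_add, pow_add]; ring
  rw [this]
  gcongr ?_ * (?_ * ?_)
  exact pow_le_pow_of_le_one (by positivity) h8 (by omega)

end assembly2

section quad
open scoped Matrix.Norms.L2Operator
variable {κ : Type*} [Fintype κ] [DecidableEq κ]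

theorem dot_eq_norm (x : κ → ℝ) : x ⬝ᵥ x = ‖WithLp.toLp 2 x‖ ^ 2 := by
  rw [EuclideanSpace.norm_sq_eq]
  simp [dotProduct, sq]

theorem mulVec_sq (A : Matrix κ κ ℝ) (x : κ → ℝ) :
    (A.mulVec x) ⬝ᵥ (A.mulVec x) ≤ ‖A‖ ^ 2 * (x ⬝ᵥ x) := by
  rw [dot_eq_norm, dot_eq_norm, ← mul_pow]
  gcongr
  exact Matrix.l2_opNorm_mulVec A (WithLp.toLp 2 x)

theorem quad_abs (A : Matrix κ κ ℝ) (x : κ → ℝ) :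
    |x ⬝ᵥ A.mulVec x| ≤ ‖A‖ * (x ⬝ᵥ x) := by
  have h1 : x ⬝ᵥ A.mulVec x = inner ℝ (WithLp.toLp 2 (A.mulVec x)) (WithLp.toLp 2 x) := by
    rw [EuclideanSpace.inner_eq_star_dotProduct]
    simp
  rw [h1, dot_eq_norm]
  refine (abs_real_inner_le_norm _ _).trans ?_
  have := Matrix.l2_opNorm_mulVec A (WithLp.toLp 2 x)
  calc _ ≤ (‖A‖ * ‖WithLp.toLp 2 x‖) * ‖WithLp.toLp 2 x‖ := by
        gcongr
        exact this
    _ = _ := by ring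

theorem dot_ge (z w : κ → ℝ) : (z ⬝ᵥ z) / 2 - w ⬝ᵥ w ≤ (z + w) ⬝ᵥ (z + w) := by
  have h : 0 ≤ (z + (2:ℝ) • w) ⬝ᵥ (z + (2:ℝ) • w) := by
    simp only [dotProduct]
    exact Finset.sum_nonneg fun i _ => mul_self_nonneg _
  simp only [add_dotProduct, dotProduct_add, smul_dotProduct, dotProduct_smul, smul_eq_mul] at h ⊢
  rw [dotProduct_comm w z] at h ⊢
  linarith

end quad


section final
open scoped Matrix.Norms.L2Operator
variable {n : ℕ} {d τ : ℕ} {α b : ℝ}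

theorem diag_quad {κ : Type*} [Fintype κ] [DecidableEq κ] (f : κ → ℝ) (x : κ → ℝ) (c : ℝ)
    (h : ∀ i, c ≤ f i * f i) :
    c * (x ⬝ᵥ x) ≤ ((Matrix.diagonal f).mulVec x) ⬝ᵥ ((Matrix.diagonal f).mulVec x) := by
  simp only [dotProduct, Matrix.mulVec_diagonal, Finset.mul_sum]
  refine Finset.sum_le_sum fun i _ => ?_
  have := mul_le_mul_of_nonneg_right (h i) (mul_self_nonneg (x i))
  linarith [this]

theorem PiC_norm (G : Graph n) (x : PR n → ℝ) :
    ((PiC G).mulVec x) ⬝ᵥ ((PiC G).mulVec x) ≤ x ⬝ᵥ x := by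
  simp only [dotProduct, PiC, Matrix.mulVec_diagonal]
  refine Finset.sum_le_sum fun i _ => ?_
  split_ifs
  · simp
  · simpa using mul_self_nonneg (x i)

theorem quad_star (B X : Matrix (PR n) (PR n) ℝ) (z : PR n → ℝ) :
    z ⬝ᵥ (B * X * star B).mulVec z = ((star B).mulVec z) ⬝ᵥ X.mulVec ((star B).mulVec z) := by
  rw [← Matrix.mulVec_mulVec, ← Matrix.mulVec_mulVec, Matrix.dotProduct_mulVec,
    Matrix.star_eq_conjTranspose, Matrix.conjTranspose_eq_transpose_of_trivial, Matrix.mulVec_transpose]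

theorem psd_core (P : Par n d τ α b) {G : Graph n} (hG : Good G d τ b) (z : PR n → ℝ)
    (hE : (Ed n d).mulVec z = z) (hP : (PiC G).mulVec z = z) :
    0 ≤ z ⬝ᵥ (Mt d τ α G).mulVec z := by
  have hd0 : 0 < α ^ d := pow_pos P.hα d
  have hz0 : 0 ≤ z ⬝ᵥ z := by
    simp only [dotProduct]; exact Finset.sum_nonneg fun i _ => mul_self_nonneg _
  set L := Lt d τ α G with hL
  set X := Xt d τ α G with hX
  have hLE : L * Ed n d = L := by
    rw [hL, Lt, Finset.sum_mul]
    exact Finset.sum_congr rfl fun e _ => lS_Ed d α G e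
  have hXP : X = PiC G * X * star (PiC G) := by
    rw [star_PiC, hX, Xt, Finset.mul_sum, Finset.sum_mul]
    exact Finset.sum_congr rfl fun e _ => X_proj P.hα G e
  -- the vector u = PiC Lᵀ z
  set u := (PiC G).mulVec ((star L).mulVec z) with hu
  set y := (Ti n d α).mulVec u with hy
  have hy1 : (star (PiC G)).mulVec ((star (L * Ti n d α)).mulVec z) = y := by
    rw [hy, hu, star_mul, star_Ti, star_PiC]
    simp only [Matrix.mulVec_mulVec]
    congr 1
    rw [← mul_assoc, ← mul_assoc]
    congr 1
    rw [PiC, Ti, Matrix.diagonal_mul_diagonal, Matrix.diagonal_mul_diagonal]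
    congr 1; ext x; ring
  have q1 : z ⬝ᵥ (L * Ti n d α * X * star (L * Ti n d α)).mulVec z = y ⬝ᵥ X.mulVec y := by
    rw [quad_star]
    conv_lhs => rw [hXP]
    rw [quad_star, hy1]
  have q2 : (PiC G * Ed n d).mulVec y = y := by
    have hs : star L = Ed n d * star L := by
      conv_lhs => rw [← hLE, star_mul, star_Ed]
    rw [hy, hu, hs]
    simp only [Matrix.mulVec_mulVec]
    congr 1
    simp only [← mul_assoc]
    congr 1
    simp only [PiC, Ti, Ed, Matrix.diagonal_mul_diagonal]
    congr 1; ext x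
    split_ifs <;> simp
  have q3 : y ⬝ᵥ X.mulVec y ≥ 3 / 4 * (y ⬝ᵥ y) := by
    have h1 := quad_abs (X - PiC G * Ed n d) y
    rw [Matrix.sub_mulVec, q2, dotProduct_sub] at h1
    have h2 := X_close P hG
    have hy0 : 0 ≤ y ⬝ᵥ y := by
      simp only [dotProduct]; exact Finset.sum_nonneg fun i _ => mul_self_nonneg _
    have h3 := mul_le_mul_of_nonneg_right h2 hy0
    have h4 := (abs_le.1 (h1.trans h3)).1
    linarith
  have q4 : α ^ d * (u ⬝ᵥ u) ≤ y ⬝ᵥ y := by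
    rw [hy, Ti]
    exact diag_quad _ _ _ fun i => P.thi_ge i.1.card
  have q5 : 7 / 16 * (z ⬝ᵥ z) ≤ u ⬝ᵥ u := by
    set w := (PiC G).mulVec ((star (L - Ed n d)).mulVec z) with hw
    have hzw : u = z + w := by
      rw [hw, star_sub, star_Ed, Matrix.sub_mulVec, hE, Matrix.mulVec_sub, hP, hu]
      abel
    have h1 := dot_ge z w
    have h2 : w ⬝ᵥ w ≤ 1 / 16 * (z ⬝ᵥ z) := by
      refine (PiC_norm G _).trans ((mulVec_sq _ _).trans ?_)
      gcongr
      rw [norm_star]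
      have := L_close P hG
      calc ‖L - Ed n d‖ ^ 2 ≤ (1 / 4) ^ 2 := by gcongr
        _ = 1 / 16 := by norm_num
    rw [hzw]
    linarith
  have q6 := quad_abs (L * Ti n d α * X * star (L * Ti n d α) - Mt d τ α G) z
  rw [Matrix.sub_mulVec, dotProduct_sub, q1] at q6
  have q7 := (abs_le.1 (q6.trans (mul_le_mul_of_nonneg_right (trunc P hG) hz0))).2
  have q8 := mul_le_mul_of_nonneg_left q5 hd0.le
  have q9 : 0 ≤ α ^ d * (z ⬝ᵥ z) := by positivity
  nlinarith

theorem Mt_apply (G : Graph n) (x y : PR n) :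
    Mt d τ α G x y = ∑ v ∈ range (τ + 1), α ^ v * Mm d G v x y := by
  rw [Mt, Matrix.sum_apply]
  simp

theorem psd_all (P : Par n d τ α b) {G : Graph n} (hG : Good G d τ b) (z : PR n → ℝ) :
    0 ≤ z ⬝ᵥ (Mt d τ α G).mulVec z := by
  set z' : PR n → ℝ := fun x => if (x.2 = ∅ ∧ x.1.card ≤ d) ∧ Clq G x.1 then z x else 0 with hz'
  have h := psd_core P hG z' (by
    ext x
    rw [Ed, Matrix.mulVec_diagonal]
    simp only [hz']
    split_ifs <;> simp_all) (by
    ext x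
    rw [PiC, Matrix.mulVec_diagonal]
    simp only [hz']
    split_ifs <;> simp_all)
  have e : z ⬝ᵥ (Mt d τ α G).mulVec z = z' ⬝ᵥ (Mt d τ α G).mulVec z' := by
    simp only [dotProduct, Matrix.mulVec, Finset.mul_sum]
    refine Finset.sum_congr rfl fun x _ => Finset.sum_congr rfl fun y _ => ?_
    by_cases h0 : Mt d τ α G x y = 0
    · rw [h0]; ring
    · have h1 : ∃ v, Mm d G v x y ≠ 0 := by
        by_contra! hc
        exact h0 (by rw [Mt_apply]; simp [hc])
      obtain ⟨v, hv⟩ := h1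
      have c1 : Clq G x.1 := by by_contra hc; exact hv (Mm_clq_left d G v x y hc)
      have c2 : Clq G y.1 := by by_contra hc; exact hv (Mm_clq_right d G v x y hc)
      have c3 : (x.2 = ∅ ∧ x.1.card ≤ d) ∧ (y.2 = ∅ ∧ y.1.card ≤ d) := by
        by_contra hc; exact hv (by unfold Mm; rw [if_neg hc])
      simp only [hz']
      rw [if_pos ⟨c3.1, c1⟩, if_pos ⟨c3.2, c2⟩]
  rw [e]; exact h

theorem tE_eq (G : Graph n) (ω : ℝ) (hω : α = ω / n) (I J : Finset (Fin n)) (hI : I.card ≤ d)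
    (hJ : J.card ≤ d) : tE τ ω G (I ∪ J) = Mt d τ α G (I, ∅) (J, ∅) := by
  rw [Mt_apply]
  unfold tE Mm sumChi
  rw [← hω]
  simp only [hI, hJ, and_self, if_true, Finset.mul_sum, Finset.union_assoc]
  rw [Finset.sum_comm]
  refine Finset.sum_congr rfl fun T _ => ?_
  simp only [mul_ite, mul_zero]
  rw [Finset.sum_ite_eq]
  simp only [mem_range, Nat.lt_succ_iff]

theorem sum_eq (G : Graph n) (ω : ℝ) (hω : α = ω / n) (a : Finset (Fin n) → ℝ)
    (ha : ∀ S : Finset (Fin n), ¬ S.card ≤ d → a S = 0) :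
    ∑ I : Finset (Fin n), ∑ J : Finset (Fin n), a I * a J * tE τ ω G (I ∪ J) =
      (fun x : PR n => if x.2 = ∅ then a x.1 else 0) ⬝ᵥ
        (Mt d τ α G).mulVec (fun x : PR n => if x.2 = ∅ then a x.1 else 0) := by
  simp only [dotProduct, Matrix.mulVec, Fintype.sum_prod_type]
  refine Finset.sum_congr rfl fun I _ => ?_
  simp only [ite_mul, zero_mul, mul_ite, mul_zero, Finset.sum_ite_eq', Finset.mem_univ, if_true]
  rw [Finset.mul_sum]
  refine Finset.sum_congr rfl fun J _ => ?_
  by_cases hI : I.card ≤ d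
  · by_cases hJ : J.card ≤ d
    · rw [tE_eq G ω hω I J hI hJ]; ring
    · rw [ha J hJ]; ring
  · rw [ha I hI]; ring

theorem good_psd (P : Par n d τ α b) {G : Graph n} (hG : Good G d τ b) (ω : ℝ) (hω : α = ω / n)
    (a : Finset (Fin n) → ℝ) (ha : ∀ S : Finset (Fin n), ¬ S.card ≤ d → a S = 0) :
    0 ≤ ∑ I : Finset (Fin n), ∑ J : Finset (Fin n), a I * a J * tE τ ω G (I ∪ J) := by
  rw [sum_eq G ω hω a ha]
  exact psd_all P hG _

end final


theorem par_numerics (n d τ : ℕ) (ε l b : ℝ) (hl : l = Real.log n) (hn : 1 ≤ n) (hl1 : 1000 ≤ l)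
    (hε : 0 < ε) (hε2 : ε < 1 / 2) (h1 : 4000 * d / ε ≤ (τ : ℝ)) (h2 : (τ : ℝ) ≤ (ε / 4000) * l)
    (h3 : 4000 * Real.log l / l ≤ ε) (hb : b = Real.exp (ε * l / 40)) :
    Par n d τ ((n : ℝ) ^ ((1 : ℝ) / 2 - ε) / n) b ∧ 2000 * (τ : ℝ) ≤ l ∧ Real.exp 2 ≤ b ∧
      l ^ 4 * 2 ^ (2 * τ + 1) ≤ b := by
  have hl0 : 0 < l := by linarith
  have hn0 : (0 : ℝ) < n := by exact_mod_cast hn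
  have hnl : (n : ℝ) = Real.exp l := by rw [hl, Real.exp_log hn0]
  set s := ε * l / 40 with hs
  have hlog : 2 ≤ Real.log l := by
    rw [Real.le_log_iff_exp_le hl0]
    have : Real.exp 2 = Real.exp 1 ^ 2 := by rw [← Real.exp_nat_mul]; norm_num
    rw [this]
    have h := Real.exp_one_lt_d9
    have h0 := Real.exp_pos 1
    nlinarith
  have hs1 : 100 * Real.log l ≤ s := by
    rw [div_le_iff₀ hl0] at h3
    rw [hs]; linarith
  have hs2 : 100 * (τ : ℝ) ≤ s := by rw [hs]; linarith
  have hd : 4000 * (d : ℝ) ≤ τ * ε := by rwa [div_le_iff₀ hε] at h1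
  have hτ0 : (0 : ℝ) ≤ τ := Nat.cast_nonneg _
  have two : (2 : ℝ) ≤ Real.exp 1 := by have := Real.add_one_le_exp 1; linarith
  have twop : ∀ k : ℕ, (2 : ℝ) ^ k ≤ Real.exp k := by
    intro k
    calc (2 : ℝ) ^ k ≤ Real.exp 1 ^ k := by gcongr
      _ = Real.exp k := by rw [← Real.exp_nat_mul, mul_one]
  have hα : (n : ℝ) ^ ((1 : ℝ) / 2 - ε) = Real.exp (l * (1 / 2 - ε)) := by
    rw [Real.rpow_def_of_pos hn0, ← hl]
  refine ⟨⟨hn, ?_, ?_, ?_, ?_, ?_, ?_, ?_, ?_⟩, ?_, ?_, ?_⟩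
  · rw [hb]; have := Real.add_one_le_exp s; linarith
  · positivity
  · rw [hα, hb, Real.sqrt_eq_rpow, Real.rpow_def_of_pos hn0, ← hl, ← Real.exp_nat_mul]
    rw [hnl, ← Real.exp_sub, ← Real.exp_add, ← Real.exp_add, Real.exp_eq_one_iff, hs]
    push_cast
    ring
  · rw [div_mul_cancel₀ _ hn0.ne', hα]
    exact Real.one_le_exp (mul_nonneg hl0.le (by linarith))
  · rw [hnl, hb, ← Real.exp_nat_mul, ← Real.exp_nat_mul]
    apply Real.exp_le_exp.2
    rw [hs]
    nlinarith
  · have : (2 * d : ℝ) ≤ τ := by nlinarith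
    exact_mod_cast this
  · rw [hb]
    exact (Real.add_one_le_exp _).trans (Real.exp_le_exp.2 (by linarith))
  · rw [hb]
    exact (twop τ).trans (Real.exp_le_exp.2 (by linarith))
  · nlinarith
  · rw [hb]; exact Real.exp_le_exp.2 (by linarith)
  · have e1 : l ^ 4 = Real.exp (4 * Real.log l) := by
      rw [show (4 : ℝ) = ((4 : ℕ) : ℝ) by norm_num, Real.exp_nat_mul, Real.exp_log hl0]
    calc l ^ 4 * 2 ^ (2 * τ + 1) ≤ Real.exp (4 * Real.log l) * Real.exp ((2 * τ + 1 : ℕ) : ℝ) := by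
          rw [e1]; gcongr; exact twop _
      _ = Real.exp (4 * Real.log l + ((2 * τ + 1 : ℕ) : ℝ)) := by rw [Real.exp_add]
      _ ≤ b := by
        rw [hb]; apply Real.exp_le_exp.2
        push_cast
        linarith

theorem pE_positivity :
    ∃ C : ℝ, 0 < C ∧ ∃ N : ℕ, ∀ n : ℕ, N ≤ n → ∀ d τ : ℕ, ∀ ε : ℝ,
      0 < ε → ε < 1 / 2 → C * d / ε ≤ (τ : ℝ) → (τ : ℝ) ≤ (ε / C) * Real.log n →
      C * Real.log (Real.log n) / Real.log n ≤ ε →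
      1 - C / (n : ℝ) ^ (10 * Real.log n) ≤
        probGraph n (fun G => ∀ a : Finset (Fin n) → ℝ,
          (∀ S : Finset (Fin n), ¬ S.card ≤ d → a S = 0) →
          0 ≤ ∑ I : Finset (Fin n), ∑ J : Finset (Fin n),
            a I * a J * tE τ ((n : ℝ) ^ ((1 : ℝ) / 2 - ε)) G (I ∪ J)) := by
  refine ⟨4000, by norm_num, ⌈Real.exp 1000⌉₊, ?_⟩
  intro n hN d τ ε hε hε2 h1 h2 h3
  have hNn : Real.exp 1000 ≤ n := Nat.ceil_le.1 hN
  have hn0 : (0 : ℝ) < n := (Real.exp_pos _).trans_le hNn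
  have hn : 0 < n := by exact_mod_cast hn0
  have hl1 : 1000 ≤ Real.log n := (Real.le_log_iff_exp_le hn0).2 hNn
  obtain ⟨P, hv, hb, hb2⟩ := par_numerics n d τ ε (Real.log n) _ rfl hn hl1 hε hε2 h1 h2 h3 rfl
  have hg := good_prob hn d τ (Real.log n) _ rfl hl1 (by have := P.hdτ; omega) hv hb hb2
  have e : Real.exp (-10 * Real.log n ^ 2) ≤ 4000 / (n : ℝ) ^ (10 * Real.log n) := by
    rw [Real.rpow_def_of_pos hn0, div_eq_mul_inv, ← Real.exp_neg]
    have h : -10 * Real.log n ^ 2 = -(Real.log n * (10 * Real.log n)) := by ring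
    rw [h]
    have := Real.exp_pos (-(Real.log n * (10 * Real.log n)))
    linarith
  refine le_trans ?_ (probGraph_mono fun G hG a ha => good_psd P hG _ rfl a ha)
  refine le_trans ?_ (probGraph_compl _)
  linarith


end PlantedClique
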